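/- For every configuration of 6 points on the square flat torus, the minimal toroidal distance is at most d6 = √3/2 − (√2·√(3√3 + 2))/6 + 1/6. Precisely: for every map p : Fin 6 → ℝ × ℝ there exist indices i ≠ j and integers m, n such that ‖p i − p j + (m, n)‖ ≤ √3/2 − (√2·√(3·√3 + 2))/6 + 1/6, where ‖·‖ denotes the Euclidean norm on ℝ². -/

import Mathlib

/-- The Euclidean norm on `ℝ × ℝ`. -/
noncomputable def e2norm (v : ℝ × ℝ) : ℝ := Real.sqrt (v.1 ^ 2 + v.2 ^ 2)

/-- The optimal minimal toroidal distance for 6 points on the square flat torus. -/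
noncomputable def d6 : ℝ :=
  Real.sqrt 3 / 2 - Real.sqrt 2 * Real.sqrt (3 * Real.sqrt 3 + 2) / 6 + 1 / 6
noncomputable section

/-! ### A checker for branch-and-bound certificates -/

/-- Evaluate a natural number before passing it on. -/
def forceNat (n : ℕ) (k : ℕ → Bool) : Bool := Nat.rec (k 0) (fun m _ => k m.succ) n

/-- Evaluate an integer before passing it on. -/
def forceInt (z : ℤ) (k : ℤ → Bool) : Bool :=
  Int.rec (fun n => forceNat n fun m => k (Int.ofNat m))
    (fun n => forceNat n fun m => k (Int.negSucc m)) z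

/-- Nonnegativity of an integer, read off from its constructor. -/
def isNonneg (z : ℤ) : Bool := Int.rec (fun _ => true) (fun _ => false) z

/-- Pass the entry at index `n` to the continuation; fail if it does not exist. -/
def withNth {α : Type} (l : List α) : ℕ → (α → Bool) → Bool :=
  List.rec (fun _ _ => false) (fun a _ ih n k => Nat.rec (k a) (fun m _ => ih m k) n) l

/-- Pass the list whose entry at index `n` has been transformed by `f` to the continuation. -/
def modifyNth {α : Type} (f : α → (α → Bool) → Bool) (l : List α) :
    ℕ → (List α → Bool) → Bool :=
  List.rec (fun _ _ => false) (fun a l ih n k =>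
    Nat.rec (f a fun b => k (b :: l)) (fun m _ => ih m fun l' => k (a :: l')) n) l

/-- Bounds `a ≤ x ≤ b` and `c ≤ y ≤ e` for the two coordinates of a vector. -/
structure Box where
  a : ℤ
  b : ℤ
  c : ℤ
  e : ℤ

/-- Entry `d` of row `i` of a table bounds the difference of the points `i + d + 1` and `i`. -/
abbrev Table := List (List Box)

/-- Coefficients of the two coordinates of each point in a linear form. -/
abbrev Form := List (ℤ × ℤ)

/-- Add `α` and `β` to the coefficients of the point `i`. -/
def Form.add (g : Form) (i : ℕ) (α β : ℤ) (k : Form → Bool) : Bool :=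
  modifyNth (fun p k' => Prod.rec (fun u v => forceInt (u.add α) fun u =>
    forceInt (v.add β) fun v => k' (u, v)) p) g i k

/-- Add `α` and `β` times the differences of the coordinates of the points `i + d + 1` and `i`. -/
def Form.addDiff (g : Form) (i d : ℕ) (α β : ℤ) (k : Form → Bool) : Bool :=
  forceInt α fun α => forceInt β fun β => forceInt α.neg fun α' => forceInt β.neg fun β' =>
  List.rec (fun _ _ => false) (fun p l ih i k =>
    Nat.rec
      (Prod.rec (fun u v => forceInt (u.add α') fun u => forceInt (v.add β') fun v =>
        Form.add l d α β fun l => k ((u, v) :: l)) p)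
      (fun m _ => ih m fun l' => k (p :: l')) i) g i k

/-- An approximation from above of the square root. -/
def approxSqrt (n : ℕ) (k : ℕ → Bool) : Bool :=
  forceNat n fun n =>
  forceNat (bif n.ble 100000000 then Nat.add 3000 (n.div 14000)
    else Nat.add 11500 ((n.sub 100000000).div 50000)) fun x =>
  forceNat ((x.add (n.div x)).div 2) fun x =>
  forceNat ((x.add (n.div x)).div 2) fun x =>
  forceNat ((x.add (n.div x)).div 2) fun x => k x.succ

/-- Whether the upper end `b` of an interval `[a, b]` may be replaced by `b'` when only the points
outside a disc matter. -/
def endOk (a b b' c e' : ℤ) : Bool :=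
  isNonneg (b'.sub b) || (isNonneg (a.add b') &&
    isNonneg (((b'.mul b').add (c.mul c)).sub (Int.ofNat 1603246000)) &&
    isNonneg (((b'.mul b').add (e'.mul e')).sub (Int.ofNat 1603246000)))

/-- Choose upper ends for the rectangle `[a, b] × [c, e]` from which to cut off the disc. -/
def chooseEnds (a b c e : ℤ) (k : ℤ → ℤ → Bool) : Bool :=
  approxSqrt (Nat.sub 1603246000 (a.natAbs.mul a.natAbs)) fun e₁ =>
  (fun k' => bif isNonneg (e.sub (Int.ofNat e₁)) && isNonneg (c.add (Int.ofNat e₁))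
    then k' (Int.ofNat e₁) else k' e : (ℤ → Bool) → Bool) fun e' =>
  (fun k' => bif Nat.ble c.natAbs e'.natAbs then forceNat c.natAbs k' else forceNat e'.natAbs k' :
    (ℕ → Bool) → Bool) fun m =>
  approxSqrt (Nat.sub 1603246000 (m.mul m)) fun b₁ =>
  (fun k' => bif isNonneg (b.sub (Int.ofNat b₁)) then k' (Int.ofNat b₁) else k' b :
    (ℤ → Bool) → Bool) fun b' =>
  bif endOk a b b' c e' && endOk c e e' a b' then k b' e' else k b e

/-- Reflect an interval so that its midpoint is nonnegative, and report the sign. -/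
def orient (a b : ℤ) (k : ℤ → ℤ → ℤ → Bool) : Bool :=
  bif isNonneg (a.add b) then k a b (Int.ofNat 1)
  else forceInt b.neg fun a' => forceInt a.neg fun b' => k a' b' (Int.negSucc 0)

/-- Add to the linear form `g + r` the multiple `w` of a linear inequality which holds outside the
disc for translates of the points `i`, `i + d + 1` by `(m, n)`. -/
def addCut (s : Table) (i d : ℕ) (m n : ℤ) (w : ℤ) (g : Form) (r : ℤ)
    (k : Form → ℤ → Bool) : Bool :=
  withNth s i fun row => withNth row d fun B =>
  Box.rec (fun a b c e =>
    forceInt (m.mul (Int.ofNat 100000)) fun m' =>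
    forceInt (n.mul (Int.ofNat 100000)) fun n' =>
    forceInt (a.add m') fun a => forceInt (b.add m') fun b =>
    forceInt (c.add n') fun c => forceInt (e.add n') fun e =>
    orient a b fun a b σ => orient c e fun c e τ =>
    chooseEnds a b c e fun b' e' =>
    forceInt (w.mul (σ.mul (a.add b'))) fun α =>
    forceInt (w.mul (τ.mul (c.add e'))) fun β =>
    g.addDiff i d α β fun g =>
    forceInt ((r.sub (w.mul (((Int.ofNat 1603246000).add (a.mul b')).add (c.mul e')))).add
      ((α.mul m').add (β.mul n'))) fun r => k g r) B

/-- Add to the linear form `g + r` the multiple `w` of one of the four bounds in a box. -/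
def addBound (s : Table) (i d side : ℕ) (w : ℤ) (g : Form) (r : ℤ)
    (k : Form → ℤ → Bool) : Bool :=
  withNth s i fun row => withNth row d fun B =>
  Box.rec (fun a b c e =>
    bif side.ble 1 then
      bif side.ble 0 then
        g.addDiff i d w (Int.ofNat 0) fun g => forceInt (r.sub (w.mul a)) fun r => k g r
      else g.addDiff i d w.neg (Int.ofNat 0) fun g => forceInt (r.add (w.mul b)) fun r => k g r
    else
      bif side.ble 2 then
        g.addDiff i d (Int.ofNat 0) w fun g => forceInt (r.sub (w.mul c)) fun r => k g r
      else
        g.addDiff i d (Int.ofNat 0) w.neg fun g => forceInt (r.add (w.mul e)) fun r => k g r) B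

def addItem (s : Table) (code : ℕ) (w : ℤ) (g : Form) (r : ℤ) (k : Form → ℤ → Bool) : Bool :=
  bif code.ble 149 then
    forceNat (code.div 30) fun i => forceNat ((code.div 6).mod 5) fun d =>
    addCut s i d (Int.subNatNat ((code.div 3).mod 2) 1) (Int.subNatNat (code.mod 3) 1) w g r k
  else bif code.ble 249 then
    forceNat ((code.sub 150).div 20) fun i => forceNat (((code.sub 150).div 4).mod 5) fun d =>
    forceNat ((code.sub 150).mod 4) fun side => addBound s i d side w g r k
  else bif code.ble 254 then
    g.addDiff (code.sub 250) 0 w.neg (Int.ofNat 0) fun g =>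
    g.addDiff 0 4 w.neg (Int.ofNat 0) fun g =>
    forceInt (r.add (w.mul (Int.ofNat 100000))) fun r => k g r
  else
    g.addDiff 0 0 w.neg (Int.ofNat 0) fun g => g.addDiff 4 0 w (Int.ofNat 0) fun g => k g r

def addItems (s : Table) (l : List ℕ) : Form → ℤ → (Form → ℤ → Bool) → Bool :=
  List.rec (fun g r k => k g r) (fun n _ ih g r k =>
    forceNat (n.div 256) fun w => forceNat (n.mod 256) fun code =>
    addItem s code (Int.ofNat w) g r fun g r => ih g r k) l

/-- Add to `r` the maximum of a multiple of a number between `a` and `b`. -/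
def boundTerm (v a b r : ℤ) (k : ℤ → Bool) : Bool :=
  bif isNonneg v then forceInt (r.add (v.mul b)) k else forceInt (r.add (v.mul a)) k

/-- Bound a linear form in the coordinates of points in boxes. -/
def boundForm (g : Form) : List Box → ℤ → (ℤ → Bool) → Bool :=
  List.rec (fun _ r k => k r) (fun p _ ih row r k =>
    List.rec false (fun B row' _ => Prod.rec (fun u v => Box.rec (fun a b c e =>
      boundTerm u a b r fun r => boundTerm v c e r fun r => ih row' r k) B) p) row) g

/-- Add items to a linear form and bound the result, given that the point `0` is the origin. -/
def boundItems (s : Table) (items : List ℕ) (g : Form) (k : ℤ → Bool) : Bool :=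
  addItems s items g (Int.ofNat 0) fun g r => withNth s 0 fun row => boundForm g.tail row r k

/-- Certificates: trees of case distinctions with rounds of bound tightening. -/
inductive Cert
  | leaf (items : List ℕ)
  | near (k : ℕ)
  | split (c i d : ℕ) (v : ℤ) (l r : Cert)
  | node (steps : List (List ℕ)) (rest : Cert)

def zeroForm : Form := [(0, 0), (0, 0), (0, 0), (0, 0), (0, 0), (0, 0)]

/-- Replace one of the four bounds of a box. -/
def Box.set (B : Box) (side : ℕ) (v : ℤ) (k : Box → Bool) : Bool :=
  Box.rec (fun a b c e =>
    bif side.ble 1 then bif side.ble 0 then k ⟨v, b, c, e⟩ else k ⟨a, v, c, e⟩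
    else bif side.ble 2 then k ⟨a, b, v, e⟩ else k ⟨a, b, c, v⟩) B

def Table.set (s : Table) (i d side : ℕ) (v : ℤ) (k : Table → Bool) : Bool :=
  modifyNth (fun row => modifyNth (fun B => B.set side v) row d) s i k

/-- Replace an entry of the table by a better bound derived from a linear combination. -/
def tightenStep (s : Table) (step : List ℕ) (k : Table → Bool) : Bool :=
  withNth step 0 fun key => withNth step 1 fun q =>
  forceNat (key.div 20) fun i => forceNat ((key.div 4).mod 5) fun d =>
  forceNat (key.mod 4) fun side => forceNat (Nat.pow 2 q) fun t =>
  bif side.ble 1 then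
    bif side.ble 0 then
      zeroForm.addDiff i d (Int.negOfNat t) (Int.ofNat 0) fun g =>
      boundItems s step.tail.tail g fun r =>
      forceInt (Int.ediv r.neg (Int.ofNat t)) fun v => s.set i d 0 v k
    else
      zeroForm.addDiff i d (Int.ofNat t) (Int.ofNat 0) fun g =>
      boundItems s step.tail.tail g fun r =>
      forceInt (Int.ediv r.neg (Int.ofNat t)).neg fun v => s.set i d 1 v k
  else
    bif side.ble 2 then
      zeroForm.addDiff i d (Int.ofNat 0) (Int.negOfNat t) fun g =>
      boundItems s step.tail.tail g fun r =>
      forceInt (Int.ediv r.neg (Int.ofNat t)) fun v => s.set i d 2 v k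
    else
      zeroForm.addDiff i d (Int.ofNat 0) (Int.ofNat t) fun g =>
      boundItems s step.tail.tail g fun r =>
      forceInt (Int.ediv r.neg (Int.ofNat t)).neg fun v => s.set i d 3 v k

def tighten (l : List (List ℕ)) : Table → (Table → Bool) → Bool :=
  List.rec (fun s k => k s) (fun a _ ih s k => tightenStep s a fun s => ih s k) l

/-- Whether boxes are contained in squares around given centers. -/
def withinBoxes : List (ℤ × ℤ) → List Box → Bool
  | [], [] => true
  | q :: l, B :: row =>
    isNonneg (500 + B.a - q.1) && isNonneg (q.1 + 500 - B.b) &&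
    isNonneg (500 + B.c - q.2) && isNonneg (q.2 + 500 - B.e) && withinBoxes l row
  | _, _ => false

def Cert.check (centers : List (List (ℤ × ℤ))) (t : Cert) : Table → Bool :=
  Cert.rec
    (fun items s => boundItems s items zeroForm fun r => isNonneg ((Int.negSucc 0).sub r))
    (fun k s => withNth centers k fun q => withNth s 0 fun row => withinBoxes q row)
    (fun c i d v _ _ l r s => forceInt v fun v =>
      (s.set i d (bif c.ble 0 then 1 else 3) v fun s => l s) &&
        s.set i d (bif c.ble 0 then 0 else 2) v fun s => r s)
    (fun steps _ ih s => tighten steps s fun s => ih s) t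

def nearCenters : List (List (ℤ × ℤ)) :=
  [[(0, 40041), (26542, -29980), (34676, 20020), (61218, 50000), (61218, -9959)],
   [(0, 40041), (26542, -29980), (34676, 20020), (61218, -9959), (61218, 50000)],
   [(9959, 38782), (29980, -26542), (50000, 38782), (59959, 0), (79980, -34676)]]

/-- The bounds which hold for normalized configurations. -/
def initialTable : Table :=
  let B : Box := ⟨0, 100000, -40000, 60000⟩
  let C : Box := ⟨0, 100000, -100000, 100000⟩
  [[⟨0, 100000, 0, 50000⟩, B, B, B, B], [C, C, C, C], [C, C, C], [C, C], [C]]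

/-! ### Soundness of the checker -/

theorem forceNat_eq (n : ℕ) (k : ℕ → Bool) : forceNat n k = k n := by
  cases n <;> rfl

theorem forceInt_eq (z : ℤ) (k : ℤ → Bool) : forceInt z k = k z := by
  cases z with
  | ofNat n => exact forceNat_eq n fun m => k (Int.ofNat m)
  | negSucc n => exact forceNat_eq n fun m => k (Int.negSucc m)

theorem isNonneg_iff (z : ℤ) : isNonneg z = true ↔ 0 ≤ z := by
  cases z <;> simp [isNonneg]

theorem withNth_eq_true {α : Type} {l : List α} {n : ℕ} {k : α → Bool}
    (h : withNth l n k = true) : ∃ a, l[n]? = some a ∧ k a = true := by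
  induction l generalizing n with
  | nil => cases h
  | cons a l ih =>
    cases n with
    | zero => exact ⟨a, rfl, h⟩
    | succ n => simpa using ih h

theorem modifyNth_eq_true {α : Type} {f : α → (α → Bool) → Bool} {l : List α} {n : ℕ}
    {k : List α → Bool} (h : modifyNth f l n k = true) :
    ∃ a, l[n]? = some a ∧ f a (fun b => k (l.set n b)) = true := by
  induction l generalizing n k with
  | nil => cases h
  | cons a l ih =>
    cases n with
    | zero => exact ⟨a, rfl, h⟩
    | succ n => simpa using ih h

/-- The value of a linear form at points with coordinates `x` and `y`. -/
def Form.eval : Form → (ℕ → ℝ) → (ℕ → ℝ) → ℝ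
  | [], _, _ => 0
  | p :: g, x, y => p.1 * x 0 + p.2 * y 0 + Form.eval g (fun i => x (i + 1)) fun i => y (i + 1)

theorem Form.eval_set (g : Form) (i : ℕ) (p q : ℤ × ℤ) (h : g[i]? = some p) (x y : ℕ → ℝ) :
    Form.eval (g.set i q) x y = g.eval x y + (q.1 - p.1) * x i + (q.2 - p.2) * y i := by
  induction g generalizing i x y with
  | nil => simp at h
  | cons r g ih =>
    cases i with
    | zero =>
      simp only [List.getElem?_cons_zero, Option.some.injEq] at h
      subst h
      simp only [List.set_cons_zero, Form.eval]
      ring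
    | succ i =>
      simp only [List.set_cons_succ, Form.eval, ih i (by simpa using h)]
      ring

theorem Form.add_eq_true {g : Form} {i : ℕ} {α β : ℤ} {k : Form → Bool}
    (h : g.add i α β k = true) :
    ∃ g' : Form, k g' = true ∧ ∀ x y, g'.eval x y = g.eval x y + α * x i + β * y i := by
  obtain ⟨p, hp, h⟩ := modifyNth_eq_true h
  simp only [forceInt_eq] at h
  refine ⟨_, h, fun x y => ?_⟩
  rw [Form.eval_set g i p _ hp]
  change _ + (((p.1 + α : ℤ) : ℝ) - p.1) * x i + (((p.2 + β : ℤ) : ℝ) - p.2) * y i = _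
  push_cast
  ring

theorem Form.addDiff_eq_true {g : Form} {i d : ℕ} {α β : ℤ} {k : Form → Bool}
    (h : g.addDiff i d α β k = true) :
    ∃ g' : Form, k g' = true ∧ ∀ x y, g'.eval x y =
      g.eval x y + α * (x (i + d + 1) - x i) + β * (y (i + d + 1) - y i) := by
  simp only [Form.addDiff, forceInt_eq] at h
  induction g generalizing i k with
  | nil => cases h
  | cons p g ih =>
    cases i with
    | zero =>
      obtain ⟨g', hk, hg⟩ := Form.add_eq_true h
      refine ⟨_, hk, fun x y => ?_⟩
      simp only [Form.eval, hg, Nat.zero_add]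
      change ((p.1 + -α : ℤ) : ℝ) * x 0 + ((p.2 + -β : ℤ) : ℝ) * y 0 + _ = _
      push_cast
      ring
    | succ i =>
      obtain ⟨g', hk, hg⟩ := ih h
      refine ⟨_, hk, fun x y => ?_⟩
      simp only [Form.eval, hg]
      rw [show i + 1 + d + 1 = i + d + 1 + 1 by omega]
      ring

/-- A vector lies in a box. -/
def Box.Holds (B : Box) (u v : ℝ) : Prop := B.a ≤ u ∧ u ≤ B.b ∧ B.c ≤ v ∧ v ≤ B.e

/-- All bounds of a table for six points hold. -/
def Table.Holds (s : Table) (x y : ℕ → ℝ) : Prop :=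
  ∀ i row, s[i]? = some row → ∀ d B, row[d]? = some B →
    i + d + 1 < 6 ∧ Box.Holds B (x (i + d + 1) - x i) (y (i + d + 1) - y i)

/-- Normalized configurations, in units of `1 / 100000`, of six separated points of the torus. -/
structure Normalized (x y : ℕ → ℝ) : Prop where
  x_zero : x 0 = 0
  y_zero : y 0 = 0
  sep : ∀ i j, i < j → j < 6 → ∀ m n : ℤ,
    1603246000 ≤ (x j - x i + m * 100000) ^ 2 + (y j - y i + n * 100000) ^ 2
  gap : ∀ i, i < 5 → x (i + 1) - x i + x 5 ≤ 100000
  first_le_last : x 1 ≤ x 5 - x 4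

theorem approxSqrt_eq_true {n : ℕ} {k : ℕ → Bool} (h : approxSqrt n k = true) :
    ∃ m, k m = true := by
  simp only [approxSqrt, forceNat_eq] at h
  exact ⟨_, h⟩

/-- A linear inequality cutting off a disc from a rectangle. -/
theorem cut_le {D a b' c e' X Y : ℝ} (hD : D ≤ X ^ 2 + Y ^ 2) (ha : a ≤ X) (hc : c ≤ Y)
    (hb : X ≤ b' ∨ 0 ≤ a + b' ∧ D ≤ b' ^ 2 + c ^ 2 ∧ D ≤ b' ^ 2 + e' ^ 2)
    (he : Y ≤ e' ∨ 0 ≤ c + e' ∧ D ≤ e' ^ 2 + a ^ 2 ∧ D ≤ e' ^ 2 + b' ^ 2) :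
    D + a * b' + c * e' ≤ (a + b') * X + (c + e') * Y := by
  have key : ∀ {D a b' c e' X Y : ℝ}, c ≤ Y → Y ≤ e' → b' ≤ X → 0 ≤ a + b' → D ≤ b' ^ 2 + c ^ 2 →
      D ≤ b' ^ 2 + e' ^ 2 → D + a * b' + c * e' ≤ (a + b') * X + (c + e') * Y := by
    intro D a b' c e' X Y hc he hX hb h₁ h₂
    have := mul_le_mul_of_nonneg_left hX hb
    rcases le_total 0 (c + e') with h | h
    · linarith [mul_le_mul_of_nonneg_left hc h]
    · linarith [mul_le_mul_of_nonpos_left he h]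
  rcases le_or_gt X b' with hX | hX <;> rcases le_or_gt Y e' with hY | hY
  · nlinarith [mul_nonneg (sub_nonneg.mpr ha) (sub_nonneg.mpr hX),
      mul_nonneg (sub_nonneg.mpr hc) (sub_nonneg.mpr hY)]
  · obtain ⟨h₀, h₁, h₂⟩ := he.resolve_left hY.not_ge
    linarith [key ha hX hY.le h₀ h₁ h₂]
  · obtain ⟨h₀, h₁, h₂⟩ := hb.resolve_left hX.not_ge
    exact key hc hY hX.le h₀ h₁ h₂
  · obtain ⟨h₀, h₁, h₂⟩ := hb.resolve_left hX.not_ge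
    obtain ⟨h₃, -, -⟩ := he.resolve_left hY.not_ge
    linarith [mul_le_mul_of_nonneg_left hX.le h₀, mul_le_mul_of_nonneg_left hY.le h₃]

theorem endOk_eq_true {a b b' c e' : ℤ} (h : endOk a b b' c e' = true) {X : ℝ} (hX : X ≤ b) :
    X ≤ b' ∨ 0 ≤ (a : ℝ) + b' ∧ (1603246000 : ℝ) ≤ b' ^ 2 + c ^ 2 ∧
      (1603246000 : ℝ) ≤ b' ^ 2 + e' ^ 2 := by
  simp only [endOk, Bool.or_eq_true, Bool.and_eq_true, isNonneg_iff] at h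
  rcases h with h | ⟨⟨h₁, h₂⟩, h₃⟩
  · left
    have h : 0 ≤ b' - b := h
    have : (b : ℝ) ≤ b' := by exact_mod_cast (by linarith : b ≤ b')
    linarith
  · right
    have h₁ : 0 ≤ a + b' := h₁
    have h₂ : 0 ≤ b' * b' + c * c - 1603246000 := h₂
    have h₃ : 0 ≤ b' * b' + e' * e' - 1603246000 := h₃
    refine ⟨by exact_mod_cast h₁, ?_, ?_⟩
    · exact_mod_cast (by linarith : 1603246000 ≤ b' ^ 2 + c ^ 2)
    · exact_mod_cast (by linarith : 1603246000 ≤ b' ^ 2 + e' ^ 2)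

theorem endOk_self (a b c e : ℤ) : endOk a b b c e = true := by
  simp only [endOk, Bool.or_eq_true, isNonneg_iff]
  exact Or.inl (le_of_eq (sub_self b).symm)

theorem chooseEnds_eq_true {a b c e : ℤ} {k : ℤ → ℤ → Bool} (h : chooseEnds a b c e k = true) :
    ∃ b' e', k b' e' = true ∧ endOk a b b' c e' = true ∧ endOk c e e' a b' = true := by
  have key : ∀ b' e', (bif endOk a b b' c e' && endOk c e e' a b' then k b' e' else k b e) = true →
      ∃ b' e', k b' e' = true ∧ endOk a b b' c e' = true ∧ endOk c e e' a b' = true := by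
    intro b' e' h
    cases hc : endOk a b b' c e' && endOk c e e' a b' with
    | false =>
      rw [hc] at h
      exact ⟨b, e, h, endOk_self _ _ _ _, endOk_self _ _ _ _⟩
    | true =>
      rw [hc] at h
      rw [Bool.and_eq_true] at hc
      exact ⟨b', e', h, hc⟩
  obtain ⟨e₁, h⟩ := approxSqrt_eq_true h
  have key₂ : ∀ m e', (approxSqrt (Nat.sub 1603246000 (Nat.mul m m)) fun b₁ =>
      (fun k' => bif isNonneg (b.sub (Int.ofNat b₁)) then k' (Int.ofNat b₁) else k' b :
        (ℤ → Bool) → Bool) fun b' =>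
      bif endOk a b b' c e' && endOk c e e' a b' then k b' e' else k b e) = true →
      ∃ b' e', k b' e' = true ∧ endOk a b b' c e' = true ∧ endOk c e e' a b' = true := by
    intro m e' h
    obtain ⟨b₁, h⟩ := approxSqrt_eq_true h
    cases hc : isNonneg (b.sub (Int.ofNat b₁)) <;> simp only [hc] at h <;> exact key _ _ h
  have key₃ : ∀ e', ((fun k' => bif Nat.ble c.natAbs e'.natAbs then forceNat c.natAbs k'
        else forceNat e'.natAbs k' : (ℕ → Bool) → Bool) fun m =>
      approxSqrt (Nat.sub 1603246000 (Nat.mul m m)) fun b₁ =>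
      (fun k' => bif isNonneg (b.sub (Int.ofNat b₁)) then k' (Int.ofNat b₁) else k' b :
        (ℤ → Bool) → Bool) fun b' =>
      bif endOk a b b' c e' && endOk c e e' a b' then k b' e' else k b e) = true →
      ∃ b' e', k b' e' = true ∧ endOk a b b' c e' = true ∧ endOk c e e' a b' = true := by
    intro e' h
    simp only [forceNat_eq] at h
    cases hc : Nat.ble c.natAbs e'.natAbs <;> simp only [hc] at h <;> exact key₂ _ _ h
  cases hc : isNonneg (e.sub (Int.ofNat e₁)) && isNonneg (c.add (Int.ofNat e₁)) <;>
    simp only [hc] at h <;> exact key₃ _ h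

theorem orient_eq_true {a b : ℤ} {k : ℤ → ℤ → ℤ → Bool} (h : orient a b k = true) {X : ℝ}
    (ha : a ≤ X) (hb : X ≤ b) :
    ∃ a' b' σ : ℤ, k a' b' σ = true ∧ (σ : ℝ) ^ 2 = 1 ∧ a' ≤ σ * X ∧ σ * X ≤ b' := by
  simp only [orient, forceInt_eq] at h
  cases hc : isNonneg (a.add b) <;> simp only [hc, cond_true, cond_false] at h
  · have h : k (-b) (-a) (-1) = true := h
    refine ⟨-b, -a, -1, h, ?_, ?_, ?_⟩ <;> push_cast <;> linarith
  · have h : k a b 1 = true := h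
    refine ⟨a, b, 1, h, ?_, ?_, ?_⟩ <;> push_cast <;> linarith

theorem addCut_eq_true {s : Table} {i d : ℕ} {m n w : ℤ} {g : Form} {r : ℤ}
    {k : Form → ℤ → Bool} {x y : ℕ → ℝ} (hx : Normalized x y) (hs : s.Holds x y) (hw : 0 ≤ w)
    (h : addCut s i d m n w g r k = true) :
    ∃ g' r', k g' r' = true ∧ g.eval x y + r ≤ g'.eval x y + r' := by
  obtain ⟨row, hrow, h⟩ := withNth_eq_true h
  obtain ⟨⟨a, b, c, e⟩, hB, h⟩ := withNth_eq_true h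
  obtain ⟨hij, ha, hb, hc, he⟩ := hs i row hrow d _ hB
  simp only [forceInt_eq] at h ha hb hc he
  obtain ⟨a', b', σ, h, hσ, ha', hb'⟩ := orient_eq_true h
    (X := x (i + d + 1) - x i + m * 100000)
    (by change ((a + m * 100000 : ℤ) : ℝ) ≤ _; push_cast; linarith)
    (by change _ ≤ ((b + m * 100000 : ℤ) : ℝ); push_cast; linarith)
  obtain ⟨c', e', τ, h, hτ, hc', he'⟩ := orient_eq_true h
    (X := y (i + d + 1) - y i + n * 100000)
    (by change ((c + n * 100000 : ℤ) : ℝ) ≤ _; push_cast; linarith)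
    (by change _ ≤ ((e + n * 100000 : ℤ) : ℝ); push_cast; linarith)
  obtain ⟨b'', e'', h, hbe, heb⟩ := chooseEnds_eq_true h
  obtain ⟨g₁, h, hg₁⟩ := Form.addDiff_eq_true h
  refine ⟨g₁, _, h, ?_⟩
  have hw : (0 : ℝ) ≤ w := by exact_mod_cast hw
  have hcut := mul_le_mul_of_nonneg_left (cut_le (D := 1603246000)
    (by rw [mul_pow, mul_pow, hσ, hτ, one_mul, one_mul]; exact hx.sep i _ (by omega) hij m n)
    ha' hc' (endOk_eq_true hbe hb') (endOk_eq_true heb he')) hw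
  rw [hg₁]
  change _ ≤ _ + ((w * (σ * (a' + b'')) : ℤ) : ℝ) * _ + ((w * (τ * (c' + e'')) : ℤ) : ℝ) * _ +
    ((r - w * (1603246000 + a' * b'' + c' * e'') + (w * (σ * (a' + b'')) * (m * 100000) +
      w * (τ * (c' + e'')) * (n * 100000)) : ℤ) : ℝ)
  push_cast
  linarith

theorem addBound_eq_true {s : Table} {i d side : ℕ} {w : ℤ} {g : Form} {r : ℤ}
    {k : Form → ℤ → Bool} {x y : ℕ → ℝ} (hs : s.Holds x y) (hw : 0 ≤ w)
    (h : addBound s i d side w g r k = true) :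
    ∃ g' r', k g' r' = true ∧ g.eval x y + r ≤ g'.eval x y + r' := by
  obtain ⟨row, hrow, h⟩ := withNth_eq_true h
  obtain ⟨⟨a, b, c, e⟩, hB, h⟩ := withNth_eq_true h
  obtain ⟨-, ha, hb, hc, he⟩ := hs i row hrow d _ hB
  have hw : (0 : ℝ) ≤ w := by exact_mod_cast hw
  simp only [forceInt_eq] at h ha hb hc he
  have ha := mul_le_mul_of_nonneg_left ha hw
  have hb := mul_le_mul_of_nonneg_left hb hw
  have hc := mul_le_mul_of_nonneg_left hc hw
  have he := mul_le_mul_of_nonneg_left he hw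
  have h₀ : ((Int.ofNat 0 : ℤ) : ℝ) = 0 := by simp
  have hneg : ((w.neg : ℤ) : ℝ) = -w := by exact_mod_cast Int.cast_neg w
  have hadd : ∀ u : ℤ, ((r.add (w.mul u) : ℤ) : ℝ) = r + w * u := fun u => by
    change ((r + w * u : ℤ) : ℝ) = _; push_cast; rfl
  have hsub : ∀ u : ℤ, ((r.sub (w.mul u) : ℤ) : ℝ) = r - w * u := fun u => by
    change ((r - w * u : ℤ) : ℝ) = _; push_cast; rfl
  cases h₁ : side.ble 1 <;> simp only [h₁, cond_true, cond_false] at h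
  · cases h₂ : side.ble 2 <;> simp only [h₂, cond_true, cond_false] at h <;>
      obtain ⟨g₁, h, hg₁⟩ := Form.addDiff_eq_true h <;> refine ⟨g₁, _, h, ?_⟩ <;>
      rw [hg₁] <;> simp only [h₀, hneg, hadd, hsub] <;> linarith
  · cases h₂ : side.ble 0 <;> simp only [h₂, cond_true, cond_false] at h <;>
      obtain ⟨g₁, h, hg₁⟩ := Form.addDiff_eq_true h <;> refine ⟨g₁, _, h, ?_⟩ <;>
      rw [hg₁] <;> simp only [h₀, hneg, hadd, hsub] <;> linarith

theorem addItem_eq_true {s : Table} {code : ℕ} {w : ℤ} {g : Form} {r : ℤ}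
    {k : Form → ℤ → Bool} {x y : ℕ → ℝ} (hx : Normalized x y) (hs : s.Holds x y) (hw : 0 ≤ w)
    (h : addItem s code w g r k = true) :
    ∃ g' r', k g' r' = true ∧ g.eval x y + r ≤ g'.eval x y + r' := by
  have hw' : (0 : ℝ) ≤ w := by exact_mod_cast hw
  have h₀ : ((Int.ofNat 0 : ℤ) : ℝ) = 0 := by simp
  have hneg : ((w.neg : ℤ) : ℝ) = -w := by exact_mod_cast Int.cast_neg w
  simp only [addItem, forceNat_eq] at h
  cases h₁ : code.ble 149 <;> simp only [h₁, cond_true, cond_false] at h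
  · cases h₂ : code.ble 249 <;> simp only [h₂, cond_true, cond_false] at h
    · cases h₃ : code.ble 254 <;> simp only [h₃, cond_true, cond_false] at h
      · obtain ⟨g₁, h, hg₁⟩ := Form.addDiff_eq_true h
        obtain ⟨g₂, h, hg₂⟩ := Form.addDiff_eq_true h
        refine ⟨g₂, _, h, ?_⟩
        have := mul_le_mul_of_nonneg_left hx.first_le_last hw'
        rw [hg₂, hg₁]
        simp only [h₀, hneg, hx.x_zero, Nat.zero_add, Nat.reduceAdd]
        linarith
      · obtain ⟨g₁, h, hg₁⟩ := Form.addDiff_eq_true h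
        obtain ⟨g₂, h, hg₂⟩ := Form.addDiff_eq_true h
        simp only [forceInt_eq] at h
        refine ⟨g₂, _, h, ?_⟩
        have hcode : code.sub 250 < 5 := by
          have := Nat.le_of_ble_eq_true h₃
          change code - 250 < 5
          omega
        have := mul_le_mul_of_nonneg_left (hx.gap _ hcode) hw'
        rw [hg₂, hg₁]
        change _ ≤ _ + ((r + w * 100000 : ℤ) : ℝ)
        push_cast
        simp only [hneg, hx.x_zero, Nat.add_zero]
        linarith
    · exact addBound_eq_true hs hw h
  · exact addCut_eq_true hx hs hw h

theorem addItems_eq_true {s : Table} {l : List ℕ} {g : Form} {r : ℤ}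
    {k : Form → ℤ → Bool} {x y : ℕ → ℝ} (hx : Normalized x y) (hs : s.Holds x y)
    (h : addItems s l g r k = true) :
    ∃ g' r', k g' r' = true ∧ g.eval x y + r ≤ g'.eval x y + r' := by
  induction l generalizing g r with
  | nil => exact ⟨g, r, h, le_rfl⟩
  | cons n l ih =>
    have h : forceNat (n.div 256) (fun w => forceNat (n.mod 256) fun code =>
      addItem s code (Int.ofNat w) g r fun g r => addItems s l g r k) = true := h
    rw [forceNat_eq, forceNat_eq] at h
    obtain ⟨g₁, r₁, h, h₁⟩ := addItem_eq_true hx hs (Int.natCast_nonneg _) h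
    obtain ⟨g₂, r₂, h, h₂⟩ := ih h
    exact ⟨g₂, r₂, h, h₁.trans h₂⟩

theorem boundTerm_eq_true {v a b r : ℤ} {k : ℤ → Bool} (h : boundTerm v a b r k = true) {u : ℝ}
    (ha : a ≤ u) (hb : u ≤ b) : ∃ r' : ℤ, k r' = true ∧ v * u + r ≤ r' := by
  simp only [boundTerm, forceInt_eq] at h
  cases hv : isNonneg v <;> simp only [hv] at h
  · refine ⟨_, h, ?_⟩
    change _ ≤ ((r + v * a : ℤ) : ℝ)
    have hv : (v : ℝ) ≤ 0 := by
      have : ¬ 0 ≤ v := by rw [← isNonneg_iff, hv]; simp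
      exact_mod_cast (not_le.mp this).le
    push_cast
    linarith [mul_le_mul_of_nonpos_left ha hv]
  · refine ⟨_, h, ?_⟩
    change _ ≤ ((r + v * b : ℤ) : ℝ)
    have hv : (0 : ℝ) ≤ v := by exact_mod_cast (isNonneg_iff v).mp hv
    push_cast
    linarith [mul_le_mul_of_nonneg_left hb hv]

theorem boundForm_eq_true {g : Form} {row : List Box} {r : ℤ} {k : ℤ → Bool} {x y : ℕ → ℝ}
    (hrow : ∀ d B, row[d]? = some B → Box.Holds B (x d) (y d))
    (h : boundForm g row r k = true) : ∃ r' : ℤ, k r' = true ∧ g.eval x y + r ≤ r' := by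
  induction g generalizing row r x y with
  | nil => exact ⟨r, h, by simp [Form.eval]⟩
  | cons p g ih =>
    cases row with
    | nil => cases h
    | cons B row =>
      obtain ⟨ha, hb, hc, he⟩ := hrow 0 B rfl
      obtain ⟨r₁, h, h₁⟩ := boundTerm_eq_true h ha hb
      obtain ⟨r₂, h, h₂⟩ := boundTerm_eq_true h hc he
      obtain ⟨r₃, h, h₃⟩ := ih (x := fun i => x (i + 1)) (y := fun i => y (i + 1))
        (fun d B hB => hrow (d + 1) B (by simpa using hB)) h
      refine ⟨r₃, h, ?_⟩
      simp only [Form.eval]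
      linarith

theorem boundItems_eq_true {s : Table} {items : List ℕ} {g : Form} {k : ℤ → Bool} {x y : ℕ → ℝ}
    (hx : Normalized x y) (hs : s.Holds x y) (h : boundItems s items g k = true) :
    ∃ r : ℤ, k r = true ∧ g.eval x y ≤ r := by
  obtain ⟨g₁, r₁, h, h₁⟩ := addItems_eq_true hx hs h
  obtain ⟨row, hrow, h⟩ := withNth_eq_true h
  obtain ⟨r₂, h, h₂⟩ := boundForm_eq_true (x := fun i => x (i + 1)) (y := fun i => y (i + 1))
    (fun d B hB => by simpa [hx.x_zero, hx.y_zero] using (hs 0 row hrow d B hB).2) h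
  refine ⟨r₂, h, ?_⟩
  have : g₁.eval x y = Form.eval g₁.tail (fun i => x (i + 1)) fun i => y (i + 1) := by
    cases g₁ <;> simp [Form.eval, hx.x_zero, hx.y_zero]
  have h₀ : ((Int.ofNat 0 : ℤ) : ℝ) = 0 := by simp
  rw [h₀, add_zero] at h₁
  linarith

theorem Table.set_eq_true {s : Table} {i d side : ℕ} {v : ℤ} {k : Table → Bool} {x y : ℕ → ℝ}
    (hs : s.Holds x y)
    (hv : if side = 0 then v ≤ x (i + d + 1) - x i else if side = 1 then x (i + d + 1) - x i ≤ v
      else if side = 2 then v ≤ y (i + d + 1) - y i else y (i + d + 1) - y i ≤ v)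
    (h : s.set i d side v k = true) : ∃ s' : Table, k s' = true ∧ s'.Holds x y := by
  obtain ⟨row, hrow, h⟩ := modifyNth_eq_true h
  obtain ⟨B, hB, h⟩ := modifyNth_eq_true h
  obtain ⟨hij, ha, hb, hc, he⟩ := hs i row hrow d B hB
  have key : ∀ B' : Box, Box.Holds B' (x (i + d + 1) - x i) (y (i + d + 1) - y i) →
      Table.Holds (List.set s i (row.set d B')) x y := by
    intro B' hB' i' row' hrow' d' C hC
    rw [List.getElem?_set] at hrow'
    split_ifs at hrow' with h₁ h₂
    · simp only [Option.some.injEq] at hrow'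
      subst h₁ hrow'
      rw [List.getElem?_set] at hC
      split_ifs at hC with h₃ h₄
      · simp only [Option.some.injEq] at hC
        subst h₃ hC
        exact ⟨hij, hB'⟩
      · exact hs i row hrow d' C hC
    · exact hs i' row' hrow' d' C hC
  have h₁ : side.ble 1 = decide (side ≤ 1) := by
    rw [Bool.eq_iff_iff, Nat.ble_eq, decide_eq_true_iff]
  have h₂ : side.ble 0 = decide (side ≤ 0) := by
    rw [Bool.eq_iff_iff, Nat.ble_eq, decide_eq_true_iff]
  have h₃ : side.ble 2 = decide (side ≤ 2) := by
    rw [Bool.eq_iff_iff, Nat.ble_eq, decide_eq_true_iff]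
  simp only [Box.set, h₁, h₂, h₃, Bool.cond_decide] at h
  split_ifs at h hv <;> first
    | exact ⟨_, h, key _ ⟨by assumption, hb, hc, he⟩⟩
    | exact ⟨_, h, key _ ⟨ha, by assumption, hc, he⟩⟩
    | exact ⟨_, h, key _ ⟨ha, hb, by assumption, he⟩⟩
    | exact ⟨_, h, key _ ⟨ha, hb, hc, by assumption⟩⟩
    | omega

theorem zeroForm_eval (x y : ℕ → ℝ) : zeroForm.eval x y = 0 := by
  simp [zeroForm, Form.eval]

theorem tightenStep_eq_true {s : Table} {step : List ℕ} {k : Table → Bool} {x y : ℕ → ℝ}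
    (hx : Normalized x y) (hs : s.Holds x y) (h : tightenStep s step k = true) :
    ∃ s' : Table, k s' = true ∧ s'.Holds x y := by
  obtain ⟨key, -, h⟩ := withNth_eq_true h
  obtain ⟨q, -, h⟩ := withNth_eq_true h
  simp only [forceNat_eq, forceInt_eq] at h
  have ht : 0 < Nat.pow 2 q := Nat.pow_pos two_pos
  generalize Nat.pow 2 q = t at h ht
  have ht' : (0 : ℝ) < t := by exact_mod_cast ht
  have hneg : ((Int.negOfNat t : ℤ) : ℝ) = -t := by rw [Int.negOfNat_eq]; simp
  have hpos : ((Int.ofNat t : ℤ) : ℝ) = t := by simp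
  have h₀ : ((Int.ofNat 0 : ℤ) : ℝ) = 0 := by simp
  have upper : ∀ (u : ℝ) (r : ℤ), t * u ≤ r → u ≤ ((r.neg.ediv (Int.ofNat t)).neg : ℤ) := by
    intro u r hu
    change u ≤ ((-(-r / (t : ℤ)) : ℤ) : ℝ)
    have : (-r / (t : ℤ)) * t ≤ -r := Int.ediv_mul_le _ (by exact_mod_cast ht.ne')
    have : (((-r / (t : ℤ)) * t : ℤ) : ℝ) ≤ ((-r : ℤ) : ℝ) := by exact_mod_cast this
    rw [← mul_le_mul_iff_right₀ ht']
    push_cast at this ⊢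
    linarith
  have lower : ∀ (u : ℝ) (r : ℤ), -t * u ≤ r → ((r.neg.ediv (Int.ofNat t) : ℤ) : ℝ) ≤ u := by
    intro u r hu
    have := upper (-u) r (by linarith)
    have e : (((r.neg.ediv (Int.ofNat t)).neg : ℤ) : ℝ) = -(r.neg.ediv (Int.ofNat t) : ℤ) := by
      exact_mod_cast Int.cast_neg _
    rw [e] at this
    linarith
  generalize hside : key.mod 4 = side at h
  cases h₁ : side.ble 1 <;> simp only [h₁, cond_true, cond_false] at h
  · cases h₂ : side.ble 2 <;> simp only [h₂, cond_true, cond_false] at h <;>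
      obtain ⟨g, h, hg⟩ := Form.addDiff_eq_true h <;>
      obtain ⟨r, h, hr⟩ := boundItems_eq_true hx hs h <;>
      rw [hg, zeroForm_eval] at hr <;> simp only [h₀, hneg, hpos, zero_mul, zero_add, add_zero] at hr
    · exact Table.set_eq_true (side := 3) hs (upper _ _ hr) h
    · exact Table.set_eq_true (side := 2) hs (lower _ _ hr) h
  · cases h₂ : side.ble 0 <;> simp only [h₂, cond_true, cond_false] at h <;>
      obtain ⟨g, h, hg⟩ := Form.addDiff_eq_true h <;>
      obtain ⟨r, h, hr⟩ := boundItems_eq_true hx hs h <;>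
      rw [hg, zeroForm_eval] at hr <;> simp only [h₀, hneg, hpos, zero_mul, zero_add, add_zero] at hr
    · exact Table.set_eq_true (side := 1) hs (upper _ _ hr) h
    · exact Table.set_eq_true (side := 0) hs (lower _ _ hr) h

theorem tighten_eq_true {l : List (List ℕ)} {s : Table} {k : Table → Bool} {x y : ℕ → ℝ}
    (hx : Normalized x y) (hs : s.Holds x y) (h : tighten l s k = true) :
    ∃ s' : Table, k s' = true ∧ s'.Holds x y := by
  induction l generalizing s with
  | nil => exact ⟨s, h, hs⟩
  | cons a l ih =>
    obtain ⟨s', h, hset⟩ := tightenStep_eq_true hx hs h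
    exact ih hset h

/-- The points `1`, `2`, … lie in squares around given centers. -/
def Near (q : List (ℤ × ℤ)) (x y : ℕ → ℝ) : Prop :=
  ∀ i p, q[i]? = some p → |x (i + 1) - p.1| ≤ 500 ∧ |y (i + 1) - p.2| ≤ 500

theorem withinBoxes_eq_true {q : List (ℤ × ℤ)} {row : List Box} {x y : ℕ → ℝ}
    (h : withinBoxes q row = true)
    (hrow : ∀ d B, row[d]? = some B → Box.Holds B (x (d + 1)) (y (d + 1))) : Near q x y := by
  induction q generalizing row x y with
  | nil => simp [Near]
  | cons p q ih =>
    cases row with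
    | nil => simp [withinBoxes] at h
    | cons B row =>
      simp only [withinBoxes, Bool.and_eq_true, isNonneg_iff] at h
      obtain ⟨⟨⟨⟨h₁, h₂⟩, h₃⟩, h₄⟩, h⟩ := h
      have h₁ : (0 : ℝ) ≤ 500 + B.a - p.1 := by exact_mod_cast h₁
      have h₂ : (0 : ℝ) ≤ p.1 + 500 - B.b := by exact_mod_cast h₂
      have h₃ : (0 : ℝ) ≤ 500 + B.c - p.2 := by exact_mod_cast h₃
      have h₄ : (0 : ℝ) ≤ p.2 + 500 - B.e := by exact_mod_cast h₄
      obtain ⟨ha, hb, hc, he⟩ := hrow 0 B rfl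
      intro i r hr
      cases i with
      | zero =>
        simp only [List.getElem?_cons_zero, Option.some.injEq] at hr
        subst hr
        constructor <;> rw [abs_le] <;> constructor <;> linarith
      | succ i =>
        exact ih (x := fun i => x (i + 1)) (y := fun i => y (i + 1)) h
          (fun d C hC => hrow (d + 1) C (by simpa using hC)) i r (by simpa using hr)

theorem Cert.exists_near_of_check {centers : List (List (ℤ × ℤ))} {t : Cert} {s : Table}
    {x y : ℕ → ℝ} (hx : Normalized x y) (hs : s.Holds x y) (h : t.check centers s = true) :
    ∃ q ∈ centers, Near q x y := by
  induction t generalizing s with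
  | leaf items =>
    obtain ⟨r, h, hr⟩ := boundItems_eq_true hx hs h
    rw [zeroForm_eval] at hr
    have h : 0 ≤ -1 - r := (isNonneg_iff _).mp h
    have : r < 0 := by linarith
    have : (r : ℝ) < 0 := by exact_mod_cast this
    linarith
  | near k =>
    obtain ⟨q, hq, h⟩ := withNth_eq_true h
    obtain ⟨row, hrow, h⟩ := withNth_eq_true h
    refine ⟨q, List.mem_of_getElem? hq, withinBoxes_eq_true h fun d B hB => ?_⟩
    simpa [hx.x_zero, hx.y_zero] using (hs 0 row hrow d B hB).2
  | split c i d v l r ihl ihr =>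
    have h : (forceInt v fun v =>
      (s.set i d (bif c.ble 0 then 1 else 3) v fun s => l.check centers s) &&
        s.set i d (bif c.ble 0 then 0 else 2) v fun s => r.check centers s) = true := h
    rw [forceInt_eq, Bool.and_eq_true] at h
    obtain ⟨hl, hr⟩ := h
    cases hc : c.ble 0 <;> simp only [hc, cond_true, cond_false] at hl hr
    · rcases le_total (y (i + d + 1) - y i) v with hv | hv
      · obtain ⟨s', h, hset⟩ := Table.set_eq_true hs (by simpa using hv) hl
        exact ihl hset h
      · obtain ⟨s', h, hset⟩ := Table.set_eq_true hs (by simpa using hv) hr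
        exact ihr hset h
    · rcases le_total (x (i + d + 1) - x i) v with hv | hv
      · obtain ⟨s', h, hset⟩ := Table.set_eq_true hs (by simpa using hv) hl
        exact ihl hset h
      · obtain ⟨s', h, hset⟩ := Table.set_eq_true hs (by simpa using hv) hr
        exact ihr hset h
  | node steps rest ih =>
    obtain ⟨s', h, hset⟩ := tighten_eq_true hx hs h
    exact ih hset h

/-! ### Local optimality of the extremal configuration -/

/-- The horizontal offset between the two columns of touching triples. -/
def offsetH : ℝ := Real.sqrt 3 * d6 / 2

def offsetW : ℝ := offsetH / (2 * (1 - offsetH))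

theorem sqrt_three_bounds : 1.7320508 ≤ Real.sqrt 3 ∧ Real.sqrt 3 ≤ 1.7320509 :=
  ⟨Real.le_sqrt_of_sq_le (by norm_num), Real.sqrt_le_iff.mpr (by norm_num)⟩

theorem d6_quadratic : 3 * d6 ^ 2 - (3 * Real.sqrt 3 + 1) * d6 + 2 = 0 := by
  have h₃ : Real.sqrt 3 ^ 2 = 3 := Real.sq_sqrt (by norm_num)
  have h₂ : Real.sqrt 2 ^ 2 = 2 := Real.sq_sqrt (by norm_num)
  have h : Real.sqrt (3 * Real.sqrt 3 + 2) ^ 2 = 3 * Real.sqrt 3 + 2 :=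
    Real.sq_sqrt (by positivity)
  unfold d6
  generalize Real.sqrt (3 * Real.sqrt 3 + 2) = t at *
  generalize Real.sqrt 3 = s at *
  generalize Real.sqrt 2 = r at *
  linear_combination (t ^ 2 / 12) * h₂ + h / 6 - (3 / 4) * h₃

theorem d6_bounds : 0.4004055 ≤ d6 ∧ d6 ≤ 0.4004056 := by
  obtain ⟨h₁, h₂⟩ := sqrt_three_bounds
  have h : Real.sqrt 2 * Real.sqrt (3 * Real.sqrt 3 + 2) = Real.sqrt (6 * Real.sqrt 3 + 4) := by
    rw [← Real.sqrt_mul (by norm_num)]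
    ring_nf
  have h₃ : Real.sqrt (6 * Real.sqrt 3 + 4) ≤ 3 * Real.sqrt 3 + 1 - 6 * 0.4004055 :=
    Real.sqrt_le_iff.mpr ⟨by linarith, by nlinarith⟩
  have h₄ : 3 * Real.sqrt 3 + 1 - 6 * 0.4004056 ≤ Real.sqrt (6 * Real.sqrt 3 + 4) :=
    Real.le_sqrt_of_sq_le (by nlinarith)
  unfold d6
  rw [h]
  constructor <;> linarith

theorem offsetH_bounds : 0.34676 ≤ offsetH ∧ offsetH ≤ 0.34677 := by
  obtain ⟨h₁, h₂⟩ := sqrt_three_bounds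
  obtain ⟨h₃, h₄⟩ := d6_bounds
  unfold offsetH
  constructor <;> nlinarith

theorem offsetW_mul : 2 * offsetW * (1 - offsetH) = offsetH := by
  have := offsetH_bounds
  have : 1 - offsetH ≠ 0 := by linarith
  unfold offsetW
  field_simp

theorem offsetW_bounds : 0.26541 ≤ offsetW ∧ offsetW ≤ 0.26543 := by
  obtain ⟨h₁, h₂⟩ := offsetH_bounds
  have h := offsetW_mul
  constructor <;> nlinarith

theorem offsetH_sq : offsetH ^ 2 + (d6 / 2) ^ 2 = d6 ^ 2 := by
  have h₃ : Real.sqrt 3 ^ 2 = 3 := Real.sq_sqrt (by norm_num)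
  unfold offsetH
  linear_combination (d6 ^ 2 / 4) * h₃

theorem offsetW_sq : offsetW ^ 2 + ((1 - d6) / 2) ^ 2 = d6 ^ 2 := by
  have h₃ : Real.sqrt 3 ^ 2 = 3 := Real.sq_sqrt (by norm_num)
  have hd := d6_quadratic
  have hw := offsetW_mul
  have hh : offsetH = Real.sqrt 3 * d6 / 2 := rfl
  have h₀ : 1 - offsetH ≠ 0 := by have := offsetH_bounds; linarith
  have : (2 * offsetW * (1 - offsetH)) ^ 2 = (3 * d6 ^ 2 + 2 * d6 - 1) * (1 - offsetH) ^ 2 := by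
    rw [hw, hh]
    generalize d6 = d at *
    generalize Real.sqrt 3 = s at *
    grind
  have : 4 * offsetW ^ 2 = 3 * d6 ^ 2 + 2 * d6 - 1 :=
    mul_right_cancel₀ (pow_ne_zero 2 h₀) (by linarith)
  linarith

theorem offset_sum_sq : (offsetW + offsetH - 1) ^ 2 + (d6 - 1 / 2) ^ 2 = d6 ^ 2 := by
  have hd := d6_quadratic
  have hw := offsetW_mul
  have hw₂ := offsetW_sq
  have hh₂ := offsetH_sq
  have hh : offsetH = Real.sqrt 3 * d6 / 2 := rfl
  linear_combination hw₂ + hh₂ + hd / 2 - hw - 3 * hh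

/-- The linearized condition at a pair of touching discs. -/
theorem linear_lower_bound {A B a b α β M : ℝ} (hAB : A ^ 2 + B ^ 2 = d6 ^ 2)
    (h : d6 ^ 2 < (A + α) ^ 2 + (B + β) ^ 2) (hα : |α| ≤ 2 * M) (hβ : |β| ≤ 2 * M)
    (hM : M ≤ 0.00502) (ha : |A - a| ≤ 0.00002) (hb : |B - b| ≤ 0.00002) :
    -0.041 * M < 2 * a * α + 2 * b * β := by
  have hM₀ : 0 ≤ M := by linarith [abs_nonneg α]
  have hα₂ : α ^ 2 ≤ (2 * M) ^ 2 := sq_le_sq' (abs_le.mp hα).1 (abs_le.mp hα).2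
  have hβ₂ : β ^ 2 ≤ (2 * M) ^ 2 := sq_le_sq' (abs_le.mp hβ).1 (abs_le.mp hβ).2
  have hMM : M * M ≤ 0.00502 * M := mul_le_mul_of_nonneg_right hM hM₀
  have h₁ : (A - a) * α ≤ 0.00002 * (2 * M) := by
    refine (le_abs_self _).trans ?_
    rw [abs_mul]
    exact mul_le_mul ha hα (abs_nonneg _) (by norm_num)
  have h₂ : (B - b) * β ≤ 0.00002 * (2 * M) := by
    refine (le_abs_self _).trans ?_
    rw [abs_mul]
    exact mul_le_mul hb hβ (abs_nonneg _) (by norm_num)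
  nlinarith

/-- Infinitesimal rigidity of the extremal configuration, with a margin. -/
theorem abs_lt_of_linear_lower_bounds {u v : Fin 6 → ℝ} {M : ℝ} (hu₀ : u 0 = 0) (hv₀ : v 0 = 0)
    (hu : ∀ k, |u k| ≤ M) (hv : ∀ k, |v k| ≤ M)
    (h : ∀ e ∈ ([(0, 1, 0, 0.40041), (0, 2, 0.26542, -0.2998), (0, 3, 0.34676, 0.2002),
      (0, 5, -0.38782, -0.09959), (1, 2, 0.26542, 0.2998), (1, 3, 0.34676, -0.2002),
      (1, 4, -0.38782, 0.09959), (2, 4, 0.34676, -0.2002), (2, 5, 0.34676, 0.2002),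
      (3, 4, 0.26542, 0.2998), (3, 5, 0.26542, -0.2998), (4, 5, 0, 0.40041)] :
        List (Fin 6 × Fin 6 × ℝ × ℝ)),
      -0.041 * M < 2 * e.2.2.1 * (u e.2.1 - u e.1) + 2 * e.2.2.2 * (v e.2.1 - v e.1)) (k : Fin 6) :
    |u k| < M ∧ |v k| < M := by
  simp only [List.forall_mem_cons, List.not_mem_nil, false_imp_iff, implies_true, and_true,
    hu₀, hv₀, sub_zero, mul_zero, zero_mul, zero_add] at h
  obtain ⟨c₁, c₂, c₃, c₄, c₅, c₆, c₇, c₈, c₉, c₁₀, c₁₁, c₁₂⟩ := h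
  simp only [abs_le] at hu hv
  obtain ⟨a₁, b₁⟩ := hu 1
  obtain ⟨a₂, b₂⟩ := hu 2
  obtain ⟨a₃, b₃⟩ := hu 3
  obtain ⟨a₄, b₄⟩ := hu 4
  obtain ⟨a₅, b₅⟩ := hu 5
  obtain ⟨a₆, b₆⟩ := hv 1
  obtain ⟨a₇, b₇⟩ := hv 2
  obtain ⟨a₈, b₈⟩ := hv 3
  obtain ⟨a₉, b₉⟩ := hv 4
  obtain ⟨a₁₀, b₁₀⟩ := hv 5
  clear hu hv
  have hM : 0 < M := by
    linarith
  have key : ((|u 1| < M ∧ |v 1| < M) ∧ |u 2| < M ∧ |v 2| < M) ∧ (|u 3| < M ∧ |v 3| < M) ∧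
      (|u 4| < M ∧ |v 4| < M) ∧ |u 5| < M ∧ |v 5| < M := by
    simp only [abs_lt]
    refine ⟨⟨⟨⟨?_, ?_⟩, ?_, ?_⟩, ⟨?_, ?_⟩, ?_, ?_⟩, ⟨⟨?_, ?_⟩, ?_, ?_⟩, ⟨⟨?_, ?_⟩, ?_, ?_⟩,
      ⟨?_, ?_⟩, ?_, ?_⟩ <;> linarith
  fin_cases k
  · simpa [hu₀, hv₀] using hM
  · exact key.1.1
  · exact key.1.2
  · exact key.2.1
  · exact key.2.2.1
  · exact key.2.2.2

/-- All pairs of points have toroidal distance more than `d6`. -/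
def Separated (x y : Fin 6 → ℝ) : Prop :=
  ∀ i j, i ≠ j → ∀ m n : ℤ, d6 ^ 2 < (x j - x i + m) ^ 2 + (y j - y i + n) ^ 2

theorem Separated.relabel {x y : Fin 6 → ℝ} (h : Separated x y) {σ : Fin 6 → Fin 6}
    (hσ : Function.Injective σ) {s t : Fin 6 → ℤ} :
    Separated (fun i => x (σ i) + s i) fun i => y (σ i) + t i := by
  intro i j hij m n
  have := h (σ i) (σ j) (hσ.ne hij) (s j - s i + m) (t j - t i + n)
  push_cast at this
  convert this using 3 <;> ring

theorem Separated.swap {x y : Fin 6 → ℝ} (h : Separated x y) : Separated y x := by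
  intro i j hij m n
  rw [add_comm]
  exact h i j hij n m

theorem Separated.neg_left {x y : Fin 6 → ℝ} (h : Separated x y) :
    Separated (fun i => -x i) y := by
  intro i j hij m n
  have := h i j hij (-m) n
  push_cast at this
  convert this using 2
  ring

theorem Separated.add_const {x y : Fin 6 → ℝ} (h : Separated x y) (s t : ℝ) :
    Separated (fun i => x i + s) fun i => y i + t := by
  intro i j hij m n
  convert h i j hij m n using 3 <;> ring

theorem not_separated_of_near {x y : Fin 6 → ℝ} (h : Separated x y) (hx₀ : x 0 = 0)
    (hy₀ : y 0 = 0)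
    (hx : ∀ k, |x k - (![0, 0, 0.26542, 0.34676, 0.61218, 0.61218] : Fin 6 → ℝ) k| ≤ 0.005)
    (hy : ∀ k, |y k - (![0, 0.40041, 0.7002, 0.2002, 0.5, 0.90041] : Fin 6 → ℝ) k| ≤ 0.005) :
    False := by
  obtain ⟨hd₁, hd₂⟩ := d6_bounds
  obtain ⟨hh₁, hh₂⟩ := offsetH_bounds
  obtain ⟨hw₁, hw₂⟩ := offsetW_bounds
  have e₁ := offsetH_sq
  have e₂ := offsetW_sq
  have e₃ := offset_sum_sq
  let X : Fin 6 → ℝ := ![0, 0, offsetW, offsetH, offsetW + offsetH, offsetW + offsetH]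
  let Y : Fin 6 → ℝ := ![0, d6, 1 / 2 + d6 / 2, d6 / 2, 1 / 2, 1 / 2 + d6]
  have hu : ∀ k, |x k - X k| ≤ 0.00502 := by
    intro k
    have := hx k
    rw [abs_le] at this ⊢
    fin_cases k <;> simp [X] at this ⊢ <;> constructor <;> linarith
  have hv : ∀ k, |y k - Y k| ≤ 0.00502 := by
    intro k
    have := hy k
    rw [abs_le] at this ⊢
    fin_cases k <;> simp [Y] at this ⊢ <;> constructor <;> linarith
  obtain ⟨k, -, hk⟩ := Finset.exists_max_image Finset.univ
    (fun k => max |x k - X k| |y k - Y k|) Finset.univ_nonempty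
  set M := max |x k - X k| |y k - Y k| with hM
  have hMr : M ≤ 0.00502 := max_le (hu k) (hv k)
  have hu' : ∀ k, |x k - X k| ≤ M := fun j => (le_max_left _ _).trans (hk j (Finset.mem_univ j))
  have hv' : ∀ k, |y k - Y k| ≤ M := fun j => (le_max_right _ _).trans (hk j (Finset.mem_univ j))
  have key : ∀ (i j : Fin 6) (m n : ℤ) (A B : ℝ) {a b : ℝ}, i ≠ j → X j - X i + m = A →
      Y j - Y i + n = B → A ^ 2 + B ^ 2 = d6 ^ 2 → |A - a| ≤ 0.00002 → |B - b| ≤ 0.00002 →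
      -0.041 * M < 2 * a * ((x j - X j) - (x i - X i)) + 2 * b * ((y j - Y j) - (y i - Y i)) := by
    intro i j m n A B a b hij hA hB hd ha hb
    refine linear_lower_bound hd ?_ ?_ ?_ hMr ha hb
    · rw [← hA, ← hB]
      convert h i j hij m n using 3 <;> ring
    · rw [two_mul]; exact (abs_sub _ _).trans (add_le_add (hu' j) (hu' i))
    · rw [two_mul]; exact (abs_sub _ _).trans (add_le_add (hv' j) (hv' i))
  have hX : X 0 = 0 ∧ X 1 = 0 ∧ X 2 = offsetW ∧ X 3 = offsetH ∧ X 4 = offsetW + offsetH ∧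
      X 5 = offsetW + offsetH := ⟨rfl, rfl, rfl, rfl, rfl, rfl⟩
  have hY : Y 0 = 0 ∧ Y 1 = d6 ∧ Y 2 = 1 / 2 + d6 / 2 ∧ Y 3 = d6 / 2 ∧ Y 4 = 1 / 2 ∧
      Y 5 = 1 / 2 + d6 := ⟨rfl, rfl, rfl, rfl, rfl, rfl⟩
  clear_value X Y M
  obtain ⟨hX₀, hX₁, hX₂, hX₃, hX₄, hX₅⟩ := hX
  obtain ⟨hY₀, hY₁, hY₂, hY₃, hY₄, hY₅⟩ := hY
  have key₂ := abs_lt_of_linear_lower_bounds (u := fun k => x k - X k) (v := fun k => y k - Y k)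
    (M := M) (by simp only [hX₀, hx₀, sub_zero]) (by simp only [hY₀, hy₀, sub_zero]) hu' hv' (by
      simp only [List.forall_mem_cons, List.not_mem_nil, false_imp_iff, implies_true, and_true]
      have c₁ : ∀ {A a : ℝ}, a - 0.00002 ≤ A → A ≤ a + 0.00002 → |A - a| ≤ 0.00002 :=
        fun h₁ h₂ => abs_le.mpr ⟨by linarith, by linarith⟩
      refine ⟨key 0 1 0 0 0 d6 (by decide) ?_ ?_ ?_ (c₁ ?_ ?_) (c₁ ?_ ?_),
        key 0 2 0 (-1) offsetW (-((1 - d6) / 2)) (by decide) ?_ ?_ ?_ (c₁ ?_ ?_) (c₁ ?_ ?_),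
        key 0 3 0 0 offsetH (d6 / 2) (by decide) ?_ ?_ ?_ (c₁ ?_ ?_) (c₁ ?_ ?_),
        key 0 5 (-1) (-1) (offsetW + offsetH - 1) (d6 - 1 / 2) (by decide) ?_ ?_ ?_ (c₁ ?_ ?_) (c₁ ?_ ?_),
        key 1 2 0 0 offsetW ((1 - d6) / 2) (by decide) ?_ ?_ ?_ (c₁ ?_ ?_) (c₁ ?_ ?_),
        key 1 3 0 0 offsetH (-(d6 / 2)) (by decide) ?_ ?_ ?_ (c₁ ?_ ?_) (c₁ ?_ ?_),
        key 1 4 (-1) 0 (offsetW + offsetH - 1) (-(d6 - 1 / 2)) (by decide) ?_ ?_ ?_ (c₁ ?_ ?_) (c₁ ?_ ?_),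
        key 2 4 0 0 offsetH (-(d6 / 2)) (by decide) ?_ ?_ ?_ (c₁ ?_ ?_) (c₁ ?_ ?_),
        key 2 5 0 0 offsetH (d6 / 2) (by decide) ?_ ?_ ?_ (c₁ ?_ ?_) (c₁ ?_ ?_),
        key 3 4 0 0 offsetW ((1 - d6) / 2) (by decide) ?_ ?_ ?_ (c₁ ?_ ?_) (c₁ ?_ ?_),
        key 3 5 0 (-1) offsetW (-((1 - d6) / 2)) (by decide) ?_ ?_ ?_ (c₁ ?_ ?_) (c₁ ?_ ?_),
        key 4 5 0 0 0 d6 (by decide) ?_ ?_ ?_ (c₁ ?_ ?_) (c₁ ?_ ?_)⟩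
      all_goals first
        | linarith only [hd₁, hd₂, hh₁, hh₂, hw₁, hw₂]
        | linear_combination e₁
        | linear_combination e₂
        | linear_combination e₃
        | ring1
        | (simp only [hX₀, hX₁, hX₂, hX₃, hX₄, hX₅, hY₀, hY₁, hY₂, hY₃, hY₄, hY₅]
           push_cast
           ring1)) k
  exact lt_irrefl M (hM.trans_lt (max_lt key₂.1 key₂.2))

/-! ### The certificate -/

set_option maxRecDepth 100000

def cert0 : Cert :=
  .node [[13, 27, 8139926469, 203388, 4058375933, 358410, 22184611583, 22184611579, 4058375932],
    [15, 25, 378122, 9564164095, 1615880133, 246854, 9564164091],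
    [21, 27, 16216284923, 252028, 31784, 26930, 40979, 327238, 142693, 155712],
    [4, 26, 291594, 32380, 95236, 25906, 29510, 456339653, 143331838, 106531],
    [6, 25, 268156, 5348946174, 138054, 6828060357, 99594],
    [41, 27, 175710, 427018, 30739, 245318, 364412, 126821, 20947961852],
    [40, 26, 1524920573, 21267, 873681659, 210216, 176946, 313158, 232060, 149056],
    [42, 26, 68702, 76554, 268864, 68732, 27237, 4113320444],
    [14, 26, 187914, 451417298, 47936, 222534, 505468, 10086614270, 44383],
    [44, 26, 333382, 1313886930, 139072, 129119],
    [46, 26, 228709, 1740621307, 292618, 78888, 66610, 129350, 518780, 236352, 13971133182],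
    [81, 27, 404234, 1243261949, 440134, 1243261948, 163964, 19208355326]]
    (.leaf [319356, 5440, 7474, 459018, 524358, 191702267, 8744, 2408968957, 3050277116, 296211])

def cert1 : Cert :=
  .node [[5, 24, 22026, 244604, 283698, 285022, 74515, 72780, 249128, 8964, 135525, 5205894321],
    [13, 27, 66826, 74108, 94258, 140126, 503827, 31564, 82216, 45375, 37733, 1973023153]]
    (.leaf [305930, 13669500, 12402994, 15728734, 144204, 14844712, 207679, 8999013, 3911955, 157307076785])

def cert2 : Cert :=
  .node [[5, 24, 87372, 6249172401, 340530, 342110, 299048, 162661, 38410, 10756, 89363, 293500]]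
    (.leaf [25610])

def cert3 : Cert :=
  .node [[7, 26, 10897006591, 10897006587, 4524477617, 110686, 63272, 349706, 148550],
    [15, 26, 264286, 13997090993, 4130739197, 75560, 4130739199],
    [17, 27, 2567983612, 46888, 30558, 14136135934, 951500285, 2567983611, 377619],
    [19, 27, 15710265009, 392316, 211993, 383838, 219432, 787],
    [33, 0],
    [35, 27, 354684, 208665, 160004, 346974, 26513405, 197928, 14226449585],
    [4, 27, 312611, 212228, 417546],
    [20, 27, 279587, 288266, 169340, 5455546879, 10933068796, 221022, 6501, 331816, 74310],
    [22, 27, 262947, 358780, 216370, 351070, 23909, 353087, 26816255],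
    [41, 28, 447845, 4701873, 261667, 1043, 195588, 34342943484, 410206, 419196, 400138],
    [43, 27, 85605, 531, 229411, 20209035697, 194398, 198780, 181554, 357951],
    [51, 27, 27852285, 49448, 230947, 1589124091, 144388, 364638, 372604, 188697, 313407],
    [10, 26, 328834557, 522, 3875, 219176, 403550, 409468, 217138, 4166, 4624],
    [24, 27, 117342, 20490, 5783490045, 399400, 151587, 5783490047, 157766, 176144],
    [26, 26, 373342, 186920, 15615036600, 208434, 381564, 528, 28517119],
    [44, 27, 352862, 29772, 28210, 37160, 364023035, 315455, 468294, 4476],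
    [81, 28, 293982, 113674, 14454161329, 55556, 147752, 420899, 428102, 34359738622],
    [83, 26, 31838, 12298, 1559521457, 5892, 15912, 45347, 269948, 46150, 3707219454],
    [16, 27, 88926, 473354, 84776, 48675, 84860, 477260, 451443686, 52069],
    [48, 28, 228446, 492620, 19151042494, 332614, 26695930086, 249445],
    [64, 27, 409950, 2082663142, 391036, 447589],
    [66, 27, 354917, 4643353521, 318504, 354098],
    [1, 27, 160350, 24677, 11354599420, 16234480383, 283688, 6770659067, 200774, 21372, 162595],
    [7, 26, 75358, 15205, 8802168575, 2411654321, 11957182715, 50728, 365066, 109638, 35148],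
    [13, 26, 492051, 1948808625, 20008, 39774],
    [2, 27, 128350, 54885, 3129240316, 396804, 161576, 3129240315, 9491, 121724],
    [21, 28, 172126, 98661, 31498, 129842, 170536, 442700, 220230, 260627, 27760682491],
    [33, 27, 199172, 268825, 365362],
    [4, 27, 217348, 381962, 300067],
    [20, 27, 230494, 359720, 3101071615, 11944125180, 61285, 25158, 203388, 206115, 249354],
    [22, 27, 102238, 96892, 311346, 10792, 7699, 91455, 403747, 250700],
    [41, 28, 518750, 442634, 6705535921, 236548, 28093339132, 156466, 38675, 491900, 302115, 458853],
    [43, 27, 148062, 337471, 16314704817, 1290, 124722, 11027, 140412, 184867, 74597],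
    [24, 26, 155230, 13328, 77362, 341032, 788141823, 148092, 6873615288],
    [12, 27, 293982, 322826, 241983, 174340, 50728, 428102, 246819],
    [14, 27, 34058, 52274, 126278, 121092, 421244, 116771, 4142199550],
    [44, 27, 41804, 302686, 427590, 560353531, 39730, 52008, 249151, 8828],
    [46, 27, 393994, 23646, 7940, 2611949820, 48424, 212092, 51250, 295955, 425798],
    [60, 26, 25610, 322398, 128050, 13828, 1792854780, 15080584369, 164220, 99941, 179491, 195654],
    [81, 26, 147752, 151366, 267570, 2440767486, 18948, 13996074673, 288094, 163196, 149283, 35082],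
    [83, 26, 4660611505, 812761598, 306300, 89138, 6404, 49192, 50502, 96094, 49699, 11786],
    [48, 27, 138536, 84069, 11659201254, 14346, 369228, 175174, 144222, 105522, 53523],
    [50, 27, 343336, 208485, 471571, 75340, 358982, 357214, 261426, 440330],
    [64, 27, 328060, 5256229094, 365406, 402021],
    [1, 27, 378152, 323934, 74108, 65305, 332819, 6041013500, 239686, 157029, 198435, 955163899],
    [5, 28, 449320, 458590, 143996, 421139, 38389374715, 293702, 287308, 269413, 158243],
    [7, 26, 148264, 151390, 126995, 337930, 10265071611, 86342, 57676, 88933, 56700],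
    [9, 27, 149523, 344158, 237692, 29465, 110120, 10292690683, 69958, 57891, 327013, 11774984956],
    [13, 27, 33576, 89182, 2314266875, 520979, 1049, 57919, 26444, 9317, 96266],
    [15, 26, 106792, 285022, 135187, 184895, 307722, 3353, 84556, 29541, 7394667003],
    [19, 27, 51731, 264030, 233852, 207935, 374794, 255001, 173132, 64808, 4485289979],
    [2, 27, 56360, 56926, 1080300540, 1052210865, 447236, 51014, 42275, 11900, 14693, 63507],
    [21, 28, 120872, 72549, 16394, 29668627195, 123230, 144198, 447564, 91954, 172563],
    [33, 26, 199036, 114472, 2879, 175530491, 224862, 44051, 10753851569, 4106, 345906],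
    [35, 26, 169768, 260294395, 295292, 4159, 333662, 65299, 102962, 6154, 15946902705],
    [4, 27, 365066, 226820, 293411],
    [6, 27, 300292, 231804, 117580, 51219, 287523, 261726, 210738, 206143, 64296],
    [20, 27, 193571, 368680, 247562, 265822, 10784181500, 3910, 56083, 232316, 96613],
    [22, 27, 397859, 100988, 248396, 22291, 114270, 304946, 89919, 27944],
    [41, 27, 175395, 101426, 135684, 4146145457, 271198, 11889878780, 233317, 53011, 240252, 233482],
    [51, 26, 30243, 86824, 72458, 257855, 333150, 175706033, 106802, 65299, 294780, 39172],
    [24, 26, 49990, 145714, 78883, 82963, 331048, 105084, 99660, 102922, 161630],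
    [26, 26, 104774, 305458, 165155, 174099, 166952, 220540, 208716, 215818, 338782],
    [40, 26, 76102, 195378, 101139, 813777659, 295464, 44924, 176972, 9994, 116062],
    [61, 26, 256531, 116062, 31779, 295464, 87676, 104268, 96266, 144434],
    [63, 26, 116755, 134440, 47436, 317790, 43786, 65842, 14371, 40060],
    [67, 26, 32531, 128808, 137648635, 3338, 306526, 2111, 293500, 726769841, 103986],
    [14, 27, 114226, 228868, 224582, 78611, 48906, 315772, 218147],
    [44, 27, 1660, 10546, 12620, 233035259, 288831, 422982, 16168, 304734],
    [46, 27, 141180, 102404, 97571, 342547, 405258, 50994, 461638],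
    [60, 26, 304478, 157052, 14340, 24330, 177955, 14752193969, 1656662524, 113509, 127282, 191558],
    [62, 27, 225893, 345980, 19460, 38410, 176675, 17159719089, 34067, 172328, 316210, 177222],
    [81, 26, 174460, 327218, 21508, 42250, 194595, 18572411825, 37651, 170792, 338782, 195142],
    [83, 26, 100709, 420732, 3011073713, 175144, 194098, 194910],
    [32, 26, 246117, 288892, 145484, 44067, 107795, 134410, 360232, 167218, 341854],
    [34, 25, 196965, 231292, 107530, 35363, 86291, 357170, 288296, 116300, 273502],
    [48, 26, 200805, 180860, 72518, 25610, 203852, 156691, 293928, 278878, 173362],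
    [50, 27, 227173, 433683, 351242, 351302, 198962, 332584, 1540, 315742],
    [64, 26, 310629, 271484, 16394, 17996, 7459, 101139, 160552, 84018, 321118],
    [66, 27, 362341, 333106, 290600, 6973399985],
    [80, 25, 35850, 267644, 220179, 38732, 330078, 235365, 349224, 182834, 16163],
    [82, 26, 21002, 600876977, 171570, 10559, 268382, 129299, 267304, 13132, 175205]]
    (.split 1 0 1 (-25000) cert1 cert2)

def cert4 : Cert :=
  .node [[10, 26, 3705933823, 182652, 9281760253, 464990, 144400],
    [24, 27, 132643, 7925419519, 124486, 7925419517, 240990, 21514, 389928, 234768],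
    [61, 28, 34359738623, 34359738621, 297000, 267792],
    [63, 25, 6206915069, 6206915071, 343646, 53800, 48400],
    [14, 26, 16910974932, 201596, 340830, 6153317373, 98064],
    [60, 26, 475486, 17531274708],
    [13, 26, 17179869437, 17179869414, 271966, 10025125588],
    [15, 25, 355422, 3076363773, 3076363750, 327464, 230931],
    [25, 26, 323678, 289811, 55336, 9722475220],
    [27, 26, 395358, 496936, 354067, 11878079956]]
    (.leaf [466728, 261244, 524382, 205618, 6327295928, 356627, 154128])

def cert5 : Cert :=
  .node [[1, 28, 45812984831, 276062, 3323144146, 22906492414, 220963, 262184, 220998],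
    [5, 28, 387654, 34359738623, 484446, 8350420414, 34359738619, 319807],
    [2, 27, 33350, 3457829375, 41822, 493828, 3457829370, 33315, 39720, 501642450],
    [8, 27, 254504, 340496],
    [42, 27, 214282, 297280, 5569437183, 417374, 66052, 11841084868, 97330, 413288699, 121724, 6237935357],
    [12, 27, 331334, 414046, 331299, 4984716242, 393512],
    [44, 27, 8350420414, 484446, 387654, 319807],
    [81, 28, 319779, 4428392914, 367966, 17412, 56330, 34359738622, 349480, 304454],
    [83, 26, 60963, 66600, 3332, 10762, 70238, 844100050, 6549339902, 429180, 58182],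
    [7, 26, 10843262129, 7055275263, 71750, 279050, 86878, 7055275259, 112448],
    [9, 27, 10052888059, 5851813631, 4201074938, 10052888060, 318302, 229733, 224636],
    [51, 26, 144931, 43048, 24875, 55300, 293214, 163647, 3729473789, 230780, 84761],
    [10, 26, 6816076797, 366972158, 350814, 247420, 110864],
    [14, 27, 24842, 155683, 146502, 7334039550, 480636, 105732],
    [83, 26, 6922, 43555, 595381458, 41030, 49502, 302716, 4619541502, 47144, 2564],
    [48, 27, 349004, 117318, 11529836543, 141662, 102245, 10824953278],
    [66, 27, 7482677681, 284773, 263208, 370994],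
    [21, 28, 34359738619, 8977539262, 102726, 124254, 364364, 83557, 10106757887]]
    (.split 1 3 0 (-25000) cert3 cert4)

def cert6 : Cert :=
  .node [[7, 0, 429],
    [22, 0],
    [41, 27, 162405, 151843, 224892, 224862, 304138, 17179869436, 109316],
    [43, 27, 88933, 485667, 123260, 123230, 251199, 24299001009, 9413489659],
    [42, 26, 4234541821, 17179869357, 318332, 318302, 4234541822, 141072],
    [46, 26, 146021, 332608, 429180, 4879679442, 329994, 12251277822, 837514157],
    [5, 25, 241772478, 14174, 317510, 4294967551, 4294967547, 9279],
    [4, 26, 109316, 151843, 304138],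
    [24, 26, 294720, 5299791018, 143395, 159272],
    [42, 26, 160522, 185212, 185182, 401472, 7392640252],
    [48, 27, 449916, 449886, 324709, 34359738558],
    [4, 26, 265738, 91652, 127523],
    [24, 27, 389696, 362531, 410920, 543243178],
    [42, 26, 115722, 108156, 30565, 108126, 5854801148, 312640]]
    (.split 1 2 1 (10000) cert0 cert5)

def cert7 : Cert :=
  .node [[23, 27, 72542, 8910691067, 30528, 432132, 55420, 92749, 31272, 887217663, 357154],
    [20, 26, 91998, 77632, 18704, 69468862, 1125466111, 70268, 61746, 950860472, 389154],
    [22, 26, 445534, 376128, 90896, 337048510, 362034, 340348, 57933, 276002, 5460528895]]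
    (.leaf [156766, 15439694331, 1919545341, 524322, 200525, 701228478, 174596, 113984, 119676])

def cert8 : Cert :=
  .node [[5, 21, 67678, 344640, 828509183, 127589, 2355107068, 110105, 51836, 134922]]
    (.leaf [2223906, 37818305766, 5023513, 2356348, 3084638, 107501720572, 15728704, 5818213, 6414858])

def cert9 : Cert :=
  .node [[4, 25, 1476021676, 332066],
    [6, 27, 34470478252, 139900, 139870, 24866, 644467134, 413188, 124456, 5582662650],
    [20, 25, 332066, 1476021676],
    [41, 27, 224862, 224892, 359202, 162405, 17179869436, 48650],
    [43, 0, 428, 433],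
    [24, 26, 46942, 46972, 13103301822, 37426, 6928, 470818, 208448, 416910843],
    [81, 27, 351010, 11650879186, 17179869438, 49680, 69214, 431168, 69191],
    [83, 26, 7769577982, 429180, 5269097938, 158754, 22544, 195136, 31326, 31303],
    [48, 26, 203102, 171900, 1882194687, 67941, 435008, 112717],
    [1, 27, 357952, 76156, 5908985810, 89950, 13809293054, 341282, 20550445823, 66381, 1517681080],
    [17, 26, 424738, 17179869435, 1888117164],
    [19, 27, 414588, 4539184102, 489822, 337945, 319784],
    [2, 27, 101440, 73596, 3095188178, 87134, 3900946943, 228642, 63528, 443652, 6565661691],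
    [21, 27, 362560, 143484, 1568887270, 169310, 56677, 17179869435, 116301],
    [33, 26, 28697, 14498852091, 26930, 303138, 40970],
    [4, 26, 359202, 48650],
    [6, 25, 141918, 120188, 1314372607, 133386, 1314372603, 454208, 20325, 5364493564],
    [20, 26, 1888117164, 424738],
    [83, 26, 363388, 17424, 6576785150, 27998, 124194, 166208, 4345783762, 27975],
    [66, 27, 305192, 2025189809, 369253, 313650]]
    (.split 1 2 0 (-15000) cert7 cert8)

def cert10 : Cert :=
  .node [[1, 28, 45812984831, 251439, 22906492414, 1582513086, 1582513066, 298024, 335198],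
    [11, 0, 433],
    [15, 26, 216360, 8589934822, 8589934845, 429150, 7441164977],
    [19, 26, 4194930353, 429180, 288296, 5726623230, 5726623229, 429150],
    [2, 27, 13840, 180264, 7703738622, 7703738623, 192636, 192606, 505604],
    [23, 27, 6295735802, 11280, 157308, 147496, 157278, 413188],
    [31, 26, 7441164977, 216360, 8589934847, 8589934845, 429150],
    [8, 26, 175912, 262672],
    [10, 26, 161040, 4240985854, 317820, 4240985853, 317790],
    [61, 28, 312360, 34359738598, 34359738621, 408336],
    [62, 27, 306482, 365407, 356392, 401020, 1893761534],
    [81, 28, 312360, 34359738578, 34359738622, 408336],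
    [16, 27, 374878, 387173, 312360, 374908, 408336],
    [34, 0],
    [66, 27, 429362, 2611879089, 332389, 419112],
    [19, 27, 459801, 457596, 457566, 25104, 425768],
    [2, 27, 158076, 158046, 6310612479, 413188, 6310612478, 147240, 8720],
    [8, 27, 312360, 408336],
    [64, 27, 477820, 477790, 334949],
    [19, 27, 407676, 21520, 408601, 407646, 377128]]
    (.split 1 1 0 (-35000) cert6 cert9)

def cert11 : Cert :=
  .node [[17, 27, 14374666491, 101416, 510016, 323106, 19985072380],
    [2, 27, 4723048402, 1843397372, 106274, 494340, 33320, 7602699519, 2879651326, 167744],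
    [33, 0],
    [6, 27, 32009462960, 5617783762, 5617783804, 474884, 88104, 5617783807, 33236775105, 211776],
    [20, 26, 1279817665, 47912, 1529552383, 76298, 1529552380, 514082, 1529552338],
    [22, 0, 432, 449],
    [40, 25, 1002299312, 18948, 4958, 14120, 447827963, 4988, 2451711, 5197, 297280],
    [61, 26, 1112026288, 1540, 8589934845, 303650, 209728, 8589934822],
    [63, 26, 799450288, 1028, 6175416829, 429150, 218146, 150848, 6175416806],
    [65, 25, 1112026288, 39940, 63282, 70937, 334114, 209728, 867633403],
    [81, 26, 1112026288, 1540, 8589934846, 303650, 209728, 8589934802],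
    [83, 26, 429180, 1028, 799450288, 6175416830, 218146, 150848, 6175416786],
    [19, 27, 431996, 214297, 431966, 439330, 303680, 209362],
    [2, 26, 65916, 224004, 2266764028, 3030805499, 65886, 75621, 294178, 184896, 31954],
    [21, 27, 175740, 29956, 2224052400, 269413, 17179869435, 175710, 419648, 85202],
    [23, 26, 44924, 216836, 55909, 12877, 4436507387, 44894, 313634, 92992, 21970],
    [4, 26, 103178, 374562],
    [6, 25, 51666, 33284, 10365880316, 170506, 2683868848, 162661, 106078, 106108, 506432, 19490],
    [20, 26, 4885807536, 1746, 91161, 3166, 94986, 3196, 113509, 493090, 126784],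
    [22, 26, 15640957872, 4818, 292121, 304394, 9852, 363109, 406080, 9822]]
    (.leaf [49237595824, 15728674, 270858, 3888252, 5960805, 380339759611, 3887966, 9288512, 1883858])

def cert12 : Cert :=
  .node []
    (.leaf [18239, 923169531, 17788, 24330, 16388, 25650, 157294034, 16734])

def cert13 : Cert :=
  .node [[1, 27, 430949, 318558, 310140, 208659, 4377, 16699504638, 416296, 27683, 882413052, 35398],
    [3, 26, 330341, 354684, 326922, 130367, 165170, 362334, 295464, 150819, 19530186491, 43334],
    [5, 27, 423269, 297084, 33141568763, 11539, 12057, 312414, 397864, 38179, 10500, 48710],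
    [7, 26, 226149, 156540, 315658, 9235, 8729, 167006, 212520, 14115, 17544166395, 28998],
    [9, 27, 330853, 225886, 178713, 195859, 72572, 4416084987, 9955066620, 174115, 153348, 221510],
    [11, 27, 348517, 61564, 378634, 284991, 63070, 14083107067, 170792, 203801, 11299, 7494],
    [15, 26, 162917, 85884, 275210, 202559, 34841, 304478, 129576, 8739, 10693195259, 51731],
    [19, 27, 148581, 349820, 321802, 272191, 248857, 357214, 108072, 8913191163, 7203, 42566],
    [0, 26, 207717, 423804, 349706, 390463, 394546, 508254, 150056, 99859, 244228, 160838],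
    [4, 27, 80485, 164220, 119103, 266787, 167774, 20038, 61992, 330244, 472586, 152882],
    [6, 27, 100709, 205180, 66600, 240191, 109843, 144966, 368675, 444420, 292702, 191026],
    [8, 26, 211813, 432252, 373544, 102419, 344842, 164678, 384575, 236804, 519006, 402738],
    [10, 26, 120421, 245372, 315486, 85779, 123171, 33546, 175144, 245252, 123718, 228402]]
    (.near 2)

def cert14 : Cert :=
  .node [[5, 27, 349797, 363048, 210270, 20038, 60236, 3341315839, 89113, 174460, 29178713339, 67076],
    [7, 26, 100709, 104232, 6414960639, 78918, 63820, 374282, 74521, 13837627899, 60510, 19204],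
    [9, 27, 295269, 245086, 9131000060, 9131000059, 2164261631, 219516, 6966738938],
    [11, 27, 389221, 189224, 34820, 343577, 420874, 13468560123, 51020, 263999],
    [15, 26, 44389, 52776, 9732, 9142043903, 34380, 380682, 12889862395, 279902, 31257, 241727],
    [17, 28, 91493, 513320, 35903, 94724, 84249, 36547309051, 54538, 34405948156],
    [19, 27, 1028, 195934, 368153, 26643, 5160, 372234, 238412, 172412, 367665147, 187199],
    [2, 27, 143461, 194856, 75870, 48153, 3814684156, 3814684155, 10259, 66684, 502020],
    [27, 27, 466533, 268328, 61004, 401945, 356874, 219711, 10367463675, 506116],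
    [33, 27, 324914, 309785, 234500],
    [4, 27, 390154, 258595, 220676],
    [6, 27, 102757, 86878, 8028535803, 193599, 340771, 34600, 76412, 12286567856, 11795, 456196],
    [20, 27, 194917, 143139, 134494, 225034, 120444, 144388, 398888, 1187461375, 29465, 14222174716],
    [41, 28, 504421, 302115, 25603863804, 465418, 368252, 123698, 418910, 121113, 56851, 337924],
    [43, 26, 47973, 24611, 51978, 43388, 274495, 10034, 3349402108, 6675, 49246, 27396],
    [51, 27, 179737, 112163, 126218, 351868, 463167, 7883549104, 54291, 400478, 198660],
    [8, 27, 6757, 46858, 22591, 14156, 453672, 1349482747, 25348],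
    [24, 27, 25189, 671717883, 19722, 472872, 10047, 20761, 4172, 26372],
    [40, 26, 63333, 134476, 79370, 265256, 2167563184, 12930745851, 43012],
    [61, 26, 10341, 225832, 21836, 35422, 36671, 75530, 2101631995, 269075, 12036],
    [63, 26, 4453, 93224, 9036, 294494, 867438843, 31242, 15167, 111123, 4868],
    [65, 27, 103006, 419624, 129726718, 216842, 104316, 126527, 315954, 9655551483, 163097, 241156],
    [14, 27, 3795725564, 51240, 135203, 1290, 378236, 109874, 4197, 178758, 191492],
    [44, 27, 11274, 18812, 5411, 326494, 454982, 308543, 2354, 22885, 829008382, 6148],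
    [46, 27, 36146, 33832, 387082, 26884, 322323, 169340, 2661, 429894, 2513060860],
    [81, 28, 91442, 2354222588, 223011, 460042, 423006, 421183, 69244, 31401917694, 479046, 249348],
    [83, 27, 15922, 409546748, 38947, 80138, 73566, 73279, 512892, 5462757118, 83270, 43524],
    [16, 27, 312158, 411688, 44298, 437861, 14143, 300156, 34124, 12051, 22020],
    [34, 27, 340837, 16403959472, 245544, 326706],
    [48, 27, 187237, 67850, 3547164155, 176424, 159507, 127326, 9476, 131910, 397388],
    [50, 27, 430437, 11061912827, 292958, 405544, 366867, 230194, 186884, 303430, 460810],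
    [64, 27, 462949, 2111, 13331, 328572, 7720, 3404, 341854, 516, 4874],
    [66, 27, 509029, 16178338043, 179762, 160319, 374312, 148740, 3955919612, 274442],
    [80, 26, 164197, 43839, 107900, 67660, 270355, 157480, 8452, 161630, 101130],
    [1, 26, 229477, 8109839867, 153724, 158558, 8109839868, 325416, 17412, 23065, 100246014],
    [5, 27, 436837, 28441, 33320765691, 301436, 427048, 312670, 2314, 22788, 2630, 13900],
    [7, 26, 325477, 24764152059, 9535, 242526, 233852, 12313, 317480, 16900, 2118, 435978],
    [13, 26, 33381, 21372, 265747, 2273968123, 71262, 4633, 29224, 1540, 47167, 65034],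
    [15, 26, 173925, 8196, 11924930811, 110972, 373598, 246847, 152872, 24345, 87059, 340746],
    [19, 27, 230757, 10756, 15761324539, 486012, 202024, 336191, 504158, 209689, 4166, 459786],
    [2, 27, 51045, 42521, 38947, 35934, 1018814460, 62760, 493316, 47686, 49171],
    [27, 27, 406373, 11323695867, 42590, 41084, 293657, 235327, 222248, 454148, 326, 324362],
    [33, 27, 154718, 6909339899, 183833, 149372, 407090, 146239, 10597, 282372, 1350, 200202],
    [4, 27, 47717, 7426483888, 220963, 102524, 92210, 175679, 106334, 335620, 838, 515594],
    [20, 27, 181349, 725429168, 166435, 14304918780, 210442, 361512, 140894, 133636, 1094, 135804],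
    [22, 27, 85093, 13254231984, 204579, 182908, 189534, 313663, 1606, 164658],
    [41, 27, 229130, 66841, 172579, 81202, 269413, 13239213564, 200572, 200708, 1862, 207966],
    [43, 27, 155417, 46942, 154147, 80138, 176485, 72498, 45180, 179204, 326, 403775],
    [45, 27, 91998, 7494492592, 200995, 507914, 39013, 75314, 83836, 317700, 454675, 162623],
    [51, 27, 415582, 152857, 151843, 78858, 8549, 71218, 400764, 176644, 3398, 391487],
    [24, 27, 435240, 943461296],
    [40, 27, 155914, 16950455803, 361548, 166706, 435752, 13180, 99076, 13662],
    [61, 27, 542536880, 455443, 7946, 4220, 7730, 432936, 10078, 4159, 4940],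
    [63, 26, 289118, 869, 73738, 39804, 71730, 62248, 43596, 46084, 66067, 37695],
    [65, 27, 176153, 417832, 173322, 5608856059, 400690, 136798, 132220, 255748, 12358, 127295],
    [14, 27, 321059, 163368, 84490, 176485, 338994, 133214, 377468, 494596, 331078, 154899],
    [44, 27, 20490, 39705, 11900, 474182, 18482, 342366, 39459, 45828, 45669, 315967],
    [46, 27, 406282, 78120, 503110, 84325, 161842, 357907, 153379, 236292, 180348, 63838],
    [60, 27, 218634, 424217, 471878, 486245, 197682, 464222, 420899, 489732, 126844, 112959],
    [81, 27, 234506, 907202044, 273734, 66329, 82226, 199006, 175395, 204036, 12705716222, 202303],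
    [83, 27, 82698, 74590, 340075516, 81990, 5273969918, 21298, 45091, 52484, 495228, 75839],
    [64, 27, 32778, 25896, 28947, 15174, 470885, 29746, 378462, 19204, 363900, 33599],
    [66, 27, 453989, 328744, 216370, 145727, 11281652475, 213002, 135172, 3187821564],
    [80, 24, 139109, 130088, 145939, 149810, 169791, 272478, 165642, 96260, 206460, 76614],
    [82, 26, 349022, 270888, 277349, 199730, 140607, 7810799099, 205578, 125700, 110204, 79891],
    [1, 26, 4883, 313384, 204133, 158302, 8543900412, 8240572411, 10275, 281, 152956, 12870],
    [5, 27, 316766, 420904, 416357, 178319100, 531, 34130793723, 13859, 312700, 17222],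
    [7, 26, 178782, 236328, 235109, 10034, 3347, 18223670267, 335114, 10521, 174460, 12358],
    [13, 27, 40286, 15400, 16997, 2073, 27967, 1240213243, 36874, 547, 10876, 460307],
    [15, 26, 321886, 122152, 134245, 15641, 223807, 9904123387, 295178, 4131, 86908, 76307],
    [17, 28, 34162264574, 2344, 5682, 7494, 176239100, 5923, 8964, 4220, 433427],
    [19, 27, 406366, 131880, 148325, 216089, 298815, 10699878907, 372490, 4387, 401788, 21318],
    [0, 25, 326494, 178216, 188005, 249650, 186943, 5957204987, 226058, 161796, 322940, 17222],
    [2, 27, 53861, 47395, 1395325692, 58131, 41566, 58694, 71720, 483076, 42265, 14062846],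
    [27, 27, 364645, 8464940795, 259850, 200255, 380, 7443, 194088, 433668, 286233, 597797374],
    [33, 27, 6757, 4244145147, 146186, 117311, 119164, 6470, 203289, 280836, 423986, 120414],
    [4, 27, 113765, 260899, 505354, 160063, 244604, 12870, 106280, 358660, 227634, 247134],
    [20, 27, 168549, 348968, 202531, 126844, 13891323132, 223242, 144990, 150532, 23571, 30534],
    [22, 27, 205669, 192040, 442236, 289343, 226595, 411954, 447070, 23366],
    [41, 27, 255845, 233763, 184956, 293898, 6435990523, 9798, 7705, 204036, 14091577340, 186974],
    [43, 27, 171877, 215075, 18556, 129802, 368191, 1094, 5923940603, 187908, 115737, 18782],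
    [47, 27, 27493, 99107, 58748, 174602, 500031, 155411, 15656, 120324, 54834, 522846],
    [42, 26, 102757, 10047, 221052, 174090, 155155, 170310, 185384, 120068, 205874, 331102],
    [61, 25, 230696, 193043, 236095, 256306, 335198, 102470, 127845, 149508, 275068, 216842],
    [63, 26, 94783, 87050, 77331, 92456, 368990, 41030, 51301, 59908, 110460, 102706],
    [65, 27, 106047, 390410, 120926, 419624, 207651, 22598, 27549957627, 262148, 115836, 165682],
    [67, 27, 32575, 192266, 477278, 97064, 181027, 88646, 12808432123, 152324, 456828, 26905],
    [12, 27, 433727, 521226, 445790, 2411339259, 333091, 504390, 76645, 349956, 121724, 92978],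
    [14, 27, 300594, 151909, 137256, 196883, 321916, 394822, 524292, 110686, 120586, 390435],
    [46, 27, 387850, 156284, 342547, 145970, 189475, 53854, 254468, 522566, 66600, 73829],
    [60, 26, 184330, 25212, 31551, 164121, 305187, 195422, 266756, 249670, 8409862907, 246885],
    [81, 27, 304650, 14016908286, 194367, 18457, 252707, 194654, 220676, 279110, 6960757243, 24165],
    [83, 27, 132874, 371324, 22591, 2917, 220195, 22878, 192260, 180038, 118297, 6064024827],
    [16, 25, 168714, 320892, 155199, 198194, 3305902331, 327518, 113156, 38982, 219432, 252517],
    [18, 26, 64531, 169822, 230245, 84550, 84003, 23050, 233988, 272178, 117372, 216360]]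
    (.split 0 0 0 (8400) cert12 cert13)

def cert15 : Cert :=
  .node []
    (.leaf [8060134, 25619, 421892863, 6494, 296, 429952763, 10250, 6207])

def cert16 : Cert :=
  .node [[4, 27, 274692, 428298, 381731],
    [22, 27, 10902005168, 49746406, 9087580923, 100958, 104293, 230719, 100988, 468771],
    [41, 28, 188088038, 381534, 255492, 318499, 34359738620, 418826, 381564, 394341],
    [43, 26, 68190, 33536998, 363583, 45572, 56867, 6126448380, 74762, 68220, 70501],
    [61, 28, 231231, 38714517222, 186116, 8709557499, 485160, 305162, 30004959997],
    [63, 26, 47167, 7898860006, 429150, 37892, 99112, 62218, 1776997115, 6121863421],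
    [12, 27, 19550, 28038858706, 186175, 134916, 399174, 351528, 221194],
    [46, 26, 165130, 164648, 72543, 8133159122, 1575606782, 8922974459, 319612, 63236],
    [81, 28, 218687, 221194, 134916, 28020371154, 127558, 351528, 34359738622, 53598],
    [83, 26, 10777, 36874, 36671, 29444, 6123171026, 21318, 76840, 417148, 6468058366],
    [48, 27, 338014, 34359738558, 430136550, 331388, 465509],
    [50, 0],
    [64, 27, 338014, 430136550, 331388, 465509],
    [66, 26, 171071, 3451195902, 6447184891, 45572, 3451195901, 296293, 119080, 226058],
    [9, 27, 240764, 8355664378, 8668025083, 312360959, 313701, 8668025084, 245342],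
    [15, 26, 174776254, 321886, 306751, 10513376255, 10513376251, 389130],
    [19, 27, 305433, 378748, 209795518, 386398, 368191, 491706367, 491706363, 242698],
    [2, 26, 1371860735, 266244, 1371860690, 26649, 2114001658, 49448, 31589],
    [27, 27, 405311, 75304, 507652, 7702143226, 276249, 327269, 252682],
    [29, 25, 2940, 2354, 292115, 1796],
    [31, 26, 283455, 1564479482, 80168, 321886, 264452, 10513376255, 62233, 73829, 10681084923, 374282],
    [4, 27, 248068, 318499, 418826],
    [20, 26, 118591, 108924, 11648651772, 111198, 93188, 142693, 141404159, 163594, 303400, 793],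
    [22, 27, 13128444080, 74108, 75614, 96613, 7900510203, 234559, 382499, 96054783],
    [41, 28, 321916, 328286, 232964, 417746943, 271907, 419429, 34359738620, 411914],
    [43, 26, 306495, 42364, 4454871804, 30468, 555, 35875, 55141, 42846, 53770],
    [51, 27, 321343, 367484, 374622, 206852, 290073, 228131, 476892413, 37416, 11530],
    [24, 26, 43583, 21337086, 2782027771, 109060, 21337087, 100633, 119141, 354856, 69642],
    [63, 26, 281438, 2443035135, 63275, 2443035133, 98088],
    [14, 26, 18751, 308348, 16900, 4311924946, 17478, 4937206270, 54824, 19978],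
    [44, 26, 358726, 655030718, 131166, 124223],
    [46, 26, 10086786811, 30468, 3903798268, 243270, 3981744127, 52581, 220540, 99624, 295946],
    [83, 26, 37667, 58634, 5051873022, 33284, 44095, 45662, 315516, 2856, 72262],
    [16, 27, 167756, 185610, 167774, 104964, 51263, 347237, 165500, 342056, 181902335],
    [34, 27, 436274, 300133, 245544, 7135366320],
    [48, 28, 23153133311, 509772, 306533, 208478, 24085863614, 330566],
    [50, 26, 347402, 50526, 67076, 16257725947, 5603856639, 178728, 189029, 870252720, 79942],
    [64, 27, 297566, 437093, 293500, 322600703],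
    [66, 26, 282469, 228362, 2646255102, 45572, 9110264315, 148520, 142911, 2646255101],
    [1, 27, 293221, 118307839, 109150, 93188, 134681, 303400, 107644, 15646049274],
    [19, 27, 658085883, 309770, 2564, 130910, 126783, 444185, 8232, 129148, 219724, 141767423],
    [2, 27, 85861, 34590207, 32094, 506884, 88616, 31612, 4809398010, 35097],
    [27, 26, 295525, 200202, 242969, 292612, 7989511419, 200488, 125247, 506724602],
    [33, 27, 411914, 226308, 271907, 34359738619],
    [4, 27, 411914, 226308, 271907],
    [6, 27, 119653, 164415, 88926, 465924, 75048, 386339, 9968300027, 87676, 9611234992, 96311807],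
    [20, 27, 52771, 266250, 185285631, 139524, 19177130492, 170846, 229989, 510760, 108863, 168572],
    [22, 27, 84325, 240703, 67911347, 62814, 6960917499, 61820, 15595025328, 312355],
    [8, 27, 23397, 172298, 90372, 53836, 482344, 86335, 4720638971],
    [10, 27, 119653, 217128, 88926, 4984150267, 4984150268, 96311807, 87676, 31360651184, 465924],
    [24, 26, 21567, 290088, 57445, 47129, 36106, 1616404475, 31100412, 54276],
    [40, 26, 97034, 276008, 66149, 152140, 11583, 13354201083, 50948],
    [65, 27, 88127, 419368, 472074, 195875, 34359738619, 247556],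
    [12, 27, 295487, 8232, 309598, 390154, 233763, 490566, 204548],
    [14, 27, 130595, 169286, 5942248190, 41266, 47114, 446844, 141060],
    [44, 27, 10792, 490566, 2661, 309598, 3850, 294207, 516031995, 5964, 2052],
    [46, 26, 14340, 17192, 247110, 16946, 216842, 5221, 53116, 331027, 1001999356],
    [81, 28, 34359738622, 8488, 422214, 323422, 389898, 308799, 233507, 204292],
    [83, 26, 3677064190, 1064, 45126, 34654, 41738, 33087, 276092, 25123, 21764],
    [34, 27, 367717, 279592, 358450, 12959499952],
    [48, 27, 164965, 163112, 379980, 112710, 9176488703, 57354, 86366, 7890209019, 29956],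
    [50, 26, 209509, 183336, 55390, 72262, 356618, 3666180272, 17847574779, 5867677695, 83460],
    [64, 27, 421733, 313438, 2766081535, 280444],
    [66, 26, 296037, 222760, 2790718460, 74546, 182794, 109375, 10507424763, 95748]]
    (.split 0 0 3 (70000) cert14 cert15)

def cert17 : Cert :=
  .node [[19, 26, 65637, 133952, 8145881318, 338969, 63868, 255814, 202250],
    [21, 27, 4948334014, 123749, 66112, 8610237926, 67452, 270406, 17179869435],
    [23, 27, 160320, 493346, 119044, 10888033787, 5456884454, 78437, 42876, 171334],
    [27, 27, 12087605757, 242466, 293892, 6806067707, 225546, 223077, 121468, 487494, 3439647231],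
    [31, 26, 255010, 9681737413, 176427, 290374],
    [4, 27, 401674, 172834],
    [6, 26, 1238819580, 451850, 15717, 16040949243, 32808, 10274, 105596, 423750, 13503974399],
    [20, 27, 59673, 39036, 11773338364, 4970741503, 281098, 216610, 311080, 155974, 148837],
    [41, 27, 271168, 23164, 14078356220, 2940930303, 500746, 2940930299, 358681, 92486, 507237],
    [65, 27, 168226, 401418, 34359738619, 67904, 514088],
    [67, 26, 331072, 96636, 9471704319, 475146, 160101, 9471704315, 2890187750, 387910, 340505],
    [14, 25, 89408, 152444, 21473988347, 317194, 122146, 68941567, 236840, 110918, 355173],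
    [44, 25, 9434042875, 78912, 67196, 139018, 71714, 156517, 89896, 269638],
    [46, 25, 48252, 232000, 223763, 130850, 6765919227, 311562, 232262, 112229]]
    (.leaf [2832741, 535047458043, 5855040, 569131, 15728650, 1724185, 465427978495, 7337286, 2058274])

def cert18 : Cert :=
  .node [[27, 27, 5261933050, 33320, 507140, 5261933055, 47114, 66630, 28991, 69982],
    [31, 26, 3450841599, 276740, 91947, 3450841597, 333406, 146216],
    [20, 27, 76834, 7290958842, 12248508927, 4957550332, 477706, 154950, 162910, 175656],
    [24, 26, 677627130, 677627135, 81412, 11298, 8518, 13631, 9054, 270888],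
    [61, 28, 34359738623, 34359738621, 168964, 509224],
    [63, 26, 15092733, 15092735, 150827, 1284, 148264, 291166],
    [65, 27, 374282, 34359738619, 35844, 509224, 180770],
    [44, 27, 333375, 500038, 8491518910, 435294],
    [60, 24, 13631, 8875635967, 132702, 8875635963, 161350, 266762],
    [48, 28, 33456886974, 29416764390, 272990, 324678, 409701, 323916],
    [64, 27, 420709, 6058000614, 280158, 228732],
    [66, 26, 3488307965, 75901, 324874, 39684, 19116836091, 105286, 59682, 352357, 251688],
    [1, 25, 462602, 20017927935, 185694, 20017927931, 220998, 26116, 19490, 121896],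
    [5, 28, 119397, 78084, 235304, 257374, 27744427263, 306246, 126015, 119372, 42299355899],
    [7, 28, 495936, 21099238852, 297054, 251426, 198955],
    [17, 24, 6916, 54056, 267018, 82270, 8861449471, 97862, 14882, 13156416763],
    [19, 26, 377625, 19257612262, 178782, 212550, 7907611070, 67660, 357386],
    [27, 26, 74853, 268804, 73753, 1630, 154571007, 1862, 2314, 844, 65320],
    [29, 27, 8680449510, 425482, 181574, 9694774527, 388395, 18375223803],
    [31, 26, 272478, 146728, 255748, 2166790397, 109099, 2166790399],
    [4, 26, 160555, 139365, 65630, 397834, 139033, 169798, 162856, 488604415],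
    [6, 25, 429066, 191272, 101452, 69470, 46084, 19601782779, 82758, 67609, 169061, 7485812735]]
    (.leaf [9104966, 89206930150, 15728650, 2392875, 514077828095, 27733108670, 3856680, 6503262, 603284758011])

def cert19 : Cert :=
  .node [[4, 27, 282402, 506634],
    [20, 27, 223845, 346634, 5958618879, 5541016060, 325160, 193314, 192537, 1985221886, 3973397202],
    [43, 0],
    [51, 27, 263946, 11577867710, 204421115, 221247, 394521, 414844, 204421119, 414814],
    [81, 26, 140810, 458771390, 33630, 8589934846, 513350, 31296],
    [83, 26, 25881, 113930, 24128, 639597522, 5921653246, 400252, 442950],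
    [48, 27, 190272, 342092, 12181422014, 343909],
    [64, 27, 5777906918, 274812, 381534, 394341],
    [82, 27, 369789, 38464, 310366, 39940, 170536, 40738, 178698, 12425500888, 11885234683],
    [13, 26, 103232, 326666, 18245975547, 21538, 42009, 17179869439, 50533],
    [23, 27, 335168, 136473, 249634, 337668, 163941, 3461429243],
    [29, 27, 412426, 195106, 34359738619, 34359738623],
    [33, 27, 412426, 195106, 34359738619],
    [4, 27, 412426, 195106],
    [51, 27, 290826, 487449, 340300],
    [62, 27, 286303, 192266, 305532, 89890, 141106, 170500, 17051283195, 304229, 412456],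
    [83, 26, 4335166206, 76554, 293500, 19225, 389460434, 330822, 14656],
    [34, 27, 7232536240, 415784, 404018, 489061],
    [63, 26, 40829, 38208, 1868434173, 59417, 53800, 326494, 108298, 6193664446, 2975324671, 100395],
    [46, 27, 319808, 57640, 240508, 2204451262, 226610, 122469, 226338, 280159],
    [81, 27, 290826, 14506699518, 135262, 20228, 5346340347, 14370, 498758, 81192],
    [83, 27, 70681, 128778, 5754929406, 493436, 276038, 8012]]
    (.split 1 2 1 (10000) cert17 cert18)

def cert20 : Cert :=
  .node [[7, 0, 448],
    [23, 27, 169497, 1255116026, 445956, 402722, 1871664124, 442432, 196965],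
    [22, 0],
    [41, 27, 17179869436, 94044134, 190814, 72196, 501258, 190844, 100131, 197221],
    [43, 27, 226329, 433983, 244484, 4173018364, 339491, 262757],
    [46, 27, 20008, 195122, 1242890968, 2826129917, 385119, 229410, 274812, 343872],
    [5, 26, 165071550, 513350, 8589934847, 8589934843, 33630, 28479],
    [4, 26, 72196, 501258, 100131]]
    (.split 1 0 1 (-5000) cert16 cert19)

def cert21 : Cert :=
  .node [[1, 28, 379944, 24224135634, 48448271103, 145924, 24224135678]]
    (.split 1 2 0 (30000) cert11 cert20)

def cert22 : Cert :=
  .node [[17, 25, 55974397, 293657, 113788, 67368, 31793, 113758],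
    [19, 25, 152923389, 310396, 70660, 184104, 177433, 310366],
    [2, 27, 119854, 50556, 465412, 111385, 5355575039],
    [27, 27, 89902, 38012, 444164, 83481, 4018189055],
    [61, 26, 88670, 88700, 85508, 322600, 17223479807, 315417],
    [63, 26, 65404, 232473, 62980, 237864, 12699122406, 494430],
    [81, 26, 88444, 314393, 85252, 321832, 18629469650, 61534],
    [83, 26, 45406, 494204, 62724, 237352, 13736531922, 231961]]
    (.leaf [523900, 66820, 252456, 47999462, 246553, 524382])

def cert23 : Cert :=
  .node [[1, 28, 2402784466, 22906492410, 524078, 133215, 190504, 22906492415],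
    [19, 26, 429180, 288296, 194564, 5726623230, 429150, 5726623229],
    [2, 26, 28712, 20319, 3463004670, 6926009087, 79150, 363253202, 331012],
    [27, 26, 5788453887, 2894226942, 18472, 18783, 74030, 276740],
    [35, 26, 1663029759, 429180, 302376, 6835309566, 429150, 5172280061, 435460],
    [8, 26, 432424, 220420],
    [10, 26, 2945517566, 74280, 14874420912, 5891034879, 2945517522, 281604],
    [24, 26, 2662779858, 499496, 254468, 2662779902, 5325559551],
    [42, 26, 5891034879, 2945517566, 281604, 2945517522, 15253506224, 61992],
    [61, 27, 361256, 184068, 17179869414, 17179869437],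
    [12, 26, 17179869394, 361256, 184068],
    [14, 27, 519036, 218408, 271199, 222724, 10386484734, 6794026928],
    [28, 26, 19349512658, 407080, 207364, 2169643519, 2169643514],
    [81, 27, 33886, 13828, 27176, 305686, 17179869438],
    [16, 26, 190844, 94044134, 361256, 184068, 190814, 197221],
    [34, 0],
    [82, 27, 195624, 242782, 9296937470, 99588, 491901, 9719547608],
    [1, 28, 80223, 45812984831, 129320, 22906492414, 3072595410, 389934],
    [19, 26, 283230, 131633, 283260, 1914767357, 1775158014, 187944],
    [2, 26, 14888, 9311, 5262855423, 281604, 2631427838, 352970450, 44846],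
    [23, 27, 4779885310, 16735, 26920, 9559770367, 511492, 81454, 641157074],
    [27, 27, 19039, 4713452798, 504324, 92718, 15400, 9426905343],
    [31, 26, 172840, 429150, 324356, 8216440829, 8216440831],
    [35, 26, 240680, 302686, 351236, 149231357, 377369, 302716],
    [8, 26, 361256, 143364],
    [24, 26, 391976, 1453996498, 155652, 2907992831, 1453996542],
    [28, 26, 309800, 18329326290, 122884, 2298913791, 1149457150],
    [62, 27, 194600, 156722, 5436921341, 4351816152, 304508, 442463, 193796],
    [2, 27, 30760, 1357863378, 9559770367, 511492, 48942, 13663, 4779885310],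
    [24, 26, 292648, 984033022, 108804, 3935, 1968065791, 14126]]
    (.split 1 0 4 (-5000) cert21 cert22)

def cert24 : Cert :=
  .node [[9, 28, 286053, 22906492412, 286076, 22906492370, 22906492411, 22906492415, 286046],
    [10, 27, 6871948029, 343337, 514940, 6871948030, 514910, 264708],
    [30, 26, 5726623230, 286076, 143151],
    [62, 27, 429151, 429180, 429154],
    [48, 27, 34359738558, 429157, 429180, 429150],
    [64, 27, 429157, 429180, 429150],
    [82, 27, 429181, 429154, 429150],
    [10, 26, 321660, 4291290878, 267280, 4291290877, 321630]]
    (.split 1 1 1 (-5000) cert10 cert23)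

def cert25 : Cert :=
  .node [[21, 28, 30016, 169543, 218462, 180324, 420684, 34359738619, 12848863699],
    [23, 26, 10304, 57415, 74078, 11622841595, 61028, 142412, 426018, 4346375123],
    [29, 26, 228396, 58491, 283486, 6189002491, 91236, 140096, 188194, 6319648979],
    [20, 25, 190016, 2683, 4106, 266590, 3940, 262054395, 258850, 71212],
    [22, 25, 192576, 72236, 270686, 3940, 265850107, 92194, 2683],
    [41, 25, 197696, 8422459131, 395614, 79483, 124260, 356898, 80172],
    [43, 26, 109858, 328512, 2591554043, 121694, 24443, 38244, 24620],
    [45, 26, 296226, 135232, 227422, 2814022099, 255532],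
    [47, 26, 48674, 242496, 407902, 5048754131, 42028]]
    (.leaf [2763179956, 280391, 311872, 524382, 6491101139, 224044, 259874])

def cert26 : Cert :=
  .node [[11, 26, 426018, 89932, 240192, 12350986235, 27771, 47966, 2068095231, 81764],
    [17, 28, 516642, 266560, 222075, 33836, 16241471997, 417374, 522521, 85514, 27728923131],
    [21, 28, 273996, 13592335038, 34359738619, 130398, 89415, 11969211647, 117604],
    [23, 26, 426018, 31047, 4710171838, 11906730747, 45150, 95052, 4147708671, 40804],
    [29, 27, 256802, 181568, 295980, 9066220539, 11054873597, 283998, 20121093887],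
    [4, 27, 278562, 290570],
    [6, 27, 17367694587, 11747846590, 192832, 301918, 17367694591, 524042],
    [20, 27, 479778, 7541771773, 7541771775, 167488, 2661030590, 262238, 235530],
    [22, 27, 137260, 9547245055, 318016, 9826581950, 497758, 9547245053, 297994],
    [41, 26, 395298, 247872, 350764, 387678, 2087865810],
    [43, 26, 38434, 293184, 34348, 40030, 1607],
    [51, 26, 3668869350, 123920, 154432, 13084699389, 388190, 64588, 223867, 78602],
    [8, 27, 294178, 34359738558, 252938],
    [10, 26, 20782119614, 2072034811, 5389808895, 221228, 195618, 418910, 3317774333, 168202],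
    [61, 28, 32220816895, 355088, 165386, 217644, 188766, 32220816893, 22469923518, 192290],
    [63, 26, 114960, 1055854591, 62242, 9373496550, 479838, 10429350909, 53514, 7273146302, 70444],
    [16, 26, 106084, 1270738687, 172066, 26432, 245342, 170796, 263184, 168780],
    [18, 26, 15340202982, 376857, 338960, 285790, 162148],
    [48, 28, 291940, 24909464550, 28941311166, 464716, 257118, 222023],
    [50, 25, 512025, 493858, 34660, 71952, 60766, 457292, 46892]]
    (.leaf [454387550, 8474643254452, 335090476, 206543680, 324961808, 217798169, 325423692, 524288034, 43127675, 9051467745787])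

def cert27 : Cert :=
  .node [[35, 26, 535897340, 289856, 535897341, 9997422075, 289886, 130314, 289915, 381474],
    [4, 27, 392738, 413706],
    [6, 27, 14739863807, 368192, 368222, 14739863803, 506634],
    [20, 27, 65839, 6760288506, 74560, 6760288511, 74590, 429602, 356106],
    [22, 27, 328512, 13147441147, 13147441151, 328542, 461834],
    [41, 28, 337186, 34359738578, 34359738620, 34359738598, 307978],
    [8, 27, 34359738558, 337186, 307978],
    [24, 27, 431650, 452416, 339497, 4553617342],
    [61, 28, 337186, 34359738623, 307978, 34359738621, 34359738558],
    [44, 27, 384832, 397639, 384862],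
    [46, 27, 488226, 4244660475, 409644, 4244660479, 370759],
    [81, 28, 478814, 34359738622, 478784, 337186, 334407, 307978],
    [83, 26, 87646, 6279034110, 87616, 61730, 61255, 56330, 429179],
    [16, 27, 337186, 478814, 307978, 34359738623, 478784, 334407],
    [18, 26, 110346, 27230, 6279034110, 27200, 429180, 107335],
    [66, 26, 429120, 8079697403, 14873, 422012, 16892528052, 409378, 12348028370, 3761773308],
    [82, 26, 183616, 183646, 25866, 303484, 148258, 258329, 40519],
    [5, 28, 478784, 478814, 34359738623, 34359738619, 334407],
    [9, 27, 65403, 95838, 11453246460, 11453246463, 9771466450, 344420, 11453246459],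
    [33, 27, 34359738619, 307978, 337186],
    [35, 26, 365120, 365150, 249211, 162353, 348194, 6412049126, 3673229051],
    [4, 27, 307978, 337186],
    [6, 27, 385088, 385118, 14460123903, 454666, 14460123899],
    [20, 27, 155968, 5853295614, 281610, 453922, 155998, 11706590975],
    [41, 27, 85627, 152354, 17179869436, 139786, 450404, 125278, 2199672831],
    [43, 26, 386880, 52273, 19835, 52002, 4781708028, 84746, 256100, 29022, 508313343],
    [51, 26, 279360, 250491, 77105, 53026, 4384841981, 103434, 34148030, 366942, 2059681535],
    [10, 26, 7171936509, 37929, 7171936511, 41482, 5090781886, 382046, 45090],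
    [24, 27, 337698, 284457, 9803944638, 268096],
    [46, 27, 4291245307, 307756, 368674, 331079, 4291245311],
    [83, 26, 28209, 277371, 50442, 3140639486, 33058, 56135, 763045822, 63326, 48192],
    [18, 27, 444540, 208650, 378649, 211015, 1043578046, 86622, 66112],
    [48, 27, 190535, 496972, 3170496767, 193148],
    [64, 26, 450404, 75387, 2501664511, 125278],
    [66, 26, 271460, 93308, 20012, 230434, 271424, 216022267, 302873, 75847],
    [82, 27, 318489, 213824, 1034, 218146, 3384555710, 281182, 416892, 35655],
    [11, 26, 224320, 5649623035, 328482, 166500, 90188, 107313],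
    [13, 27, 279306, 304418, 34359738623, 34359738619],
    [15, 26, 13607441919, 303680, 11105082107, 2502359805, 429150, 53776, 382498],
    [17, 26, 113728, 3810780159, 122122, 149598, 19190547963, 1800101373, 276514],
    [21, 28, 3675145471, 144252, 473676, 163655, 34359738619],
    [29, 27, 34359738623, 305954, 280842, 34359738619],
    [35, 27, 170875, 191040, 456102653, 5230147327, 59920, 29706, 284766, 366668, 469809, 459298],
    [4, 27, 280842, 305954],
    [20, 27, 142361, 189248, 226058, 473890, 28969, 214622, 51323, 6555679743],
    [41, 27, 92204, 247134, 94075, 11283045372, 89393, 195618, 305508, 446781439, 181258],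
    [43, 26, 36913, 298304, 22139, 3166308092, 36958, 27938, 91748, 734598143, 60426],
    [63, 26, 8054900670, 68386, 8054900735, 429150, 8054900733, 63242],
    [12, 27, 291392, 145680, 171042, 474206, 357959, 233994],
    [44, 27, 474206, 7821865662, 342592, 357959],
    [81, 26, 294238, 176394, 90384, 180800, 17179869435, 122695, 296226],
    [83, 27, 215134, 46151, 13811059892, 155456, 416379, 162609, 178978, 3548201918],
    [18, 27, 78430, 154695, 24080, 48192, 428412, 188697, 141322],
    [48, 27, 4698996735, 164167, 140924, 462156],
    [64, 27, 219259, 481380, 7151121407, 335966],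
    [66, 26, 247833, 315236, 241424, 2006667515, 31808, 50722]]
    (.split 0 3 0 (20000) cert25 cert26)

def cert28 : Cert :=
  .node [[23, 26, 2297082874, 270596, 2297082879, 57890, 25182, 25152, 25927],
    [20, 26, 14656, 157956, 1341421823, 14686, 466210, 1341421818, 15175],
    [41, 27, 17179869394, 17179869436, 97284, 287266, 17179869414],
    [43, 26, 7523942870, 429120, 42756, 7523942908, 125730],
    [51, 26, 2775520190, 194368, 108804, 239739, 9594169851, 239710, 320802, 443036646],
    [8, 26, 97284, 287266, 17179869374],
    [10, 25, 10864296678, 10864296699, 123140, 118366, 363298, 122439, 2113707198, 74817],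
    [61, 28, 34359738621, 34359738598, 8964, 26146, 520464, 44608],
    [63, 26, 5666, 7478248166, 2052, 113424, 7478248189, 429150, 9792],
    [30, 25, 10864296678, 363298, 10864296699, 216903],
    [44, 27, 156443090, 347712, 442695, 345182],
    [62, 27, 291362, 323844, 263212, 26183, 337728, 4124458239, 4124458235, 339807],
    [81, 25, 78144, 97284, 287266, 104775, 77662, 8589934843, 35128274],
    [18, 26, 246788, 429180, 392482, 132908, 251719, 9421661691],
    [48, 27, 9505130495, 244604, 372812, 266055],
    [66, 26, 132642, 128281, 297596, 132160, 1396812795, 158303, 45060, 34119],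
    [82, 26, 9444308987, 1124, 428924, 85598, 85824, 315938, 107012, 115271],
    [1, 26, 10038740475, 91200, 41053138, 90718, 10038740479, 335650, 113668, 122439],
    [13, 26, 17179869435, 17179869439, 97284, 287266],
    [15, 26, 11896446203, 400418, 156709372, 345950, 12053155327, 135684, 348224],
    [17, 26, 17853817083, 6208, 2756306, 6238, 673947903, 309794, 104964, 8263],
    [2, 26, 1704778747, 15424, 6971858, 15454, 1704778751, 57122, 265476, 20807],
    [21, 28, 34359738619, 366668, 129660, 10549542911, 239687],
    [23, 27, 3030445819, 27712, 3030445823, 12393170, 27486, 101666, 472068, 36935],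
    [35, 27, 6248772347, 209442, 109388, 486660],
    [20, 26, 422197755, 3904, 419527167, 3934, 301858, 65540, 5191],
    [41, 26, 17179869435, 453220, 870755071, 477986, 114526, 142203, 103684],
    [43, 26, 14773419259, 250724, 284480, 130892, 410914, 89348],
    [45, 26, 17179869435, 17179869439, 103684, 477986],
    [49, 26, 17179869435, 477986, 103684],
    [51, 25, 18239680507, 357196, 507426, 110084],
    [8, 27, 34359738558, 477986, 103684],
    [10, 25, 18258500347, 6026577598, 9548, 6012, 172894, 17653976831, 507938, 110340, 244295],
    [63, 26, 3636013823, 308062, 3636013819, 50722, 147216, 11012, 102931],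
    [65, 27, 441360, 34359738619, 507938, 110340, 84032],
    [67, 26, 646225663, 38220, 389243, 11135019771, 182050, 263774, 125968, 39428],
    [44, 27, 270400, 492359, 3742847934, 306270],
    [46, 25, 12839260923, 12839260927, 246855, 357154, 77572],
    [60, 26, 18649407227, 93248, 209479, 105292, 518946, 456548, 112644, 180574],
    [48, 27, 10744872447, 365388, 225916, 301895],
    [64, 26, 79198, 8017323263, 477284, 90951, 11384734459, 316706, 68868, 118860],
    [66, 25, 72804, 154951, 5513221094, 116092, 117824, 11079492091, 308258, 66820],
    [33, 27, 34359738619, 477986, 103684],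
    [35, 26, 3861410811, 390690, 432204, 297265, 300804],
    [20, 27, 1477295806, 31793, 14919, 1612, 12894, 21348, 510498, 101892, 1309362175],
    [22, 25, 19092067579, 84807, 111180, 73822, 120932, 7492159462, 520226, 8453074622]]
    (.leaf [11007778, 5751646, 6608967, 1449292, 4974864, 220542497766, 374221061310, 15728689, 362997683711, 11193700])

def cert29 : Cert :=
  .node [[1, 28, 286046, 286023, 22906492415, 286016, 22906492330, 22906492410],
    [5, 28, 429150, 429127, 34359738623, 429120, 34359738619],
    [15, 27, 514910, 343420, 6871948028, 13279761578, 6871948029, 514880, 257545],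
    [2, 26, 41287, 3308875178, 3308875263, 41280, 41310, 3308875258, 331012],
    [23, 26, 2737879295, 34375, 2737879210, 34368, 2737879290, 34398, 273924],
    [6, 27, 5317385469, 10634770431, 306723, 398400, 398430, 293380, 5317385468],
    [26, 26, 143145, 286046, 5726623229, 5726623231],
    [42, 26, 9125857476, 4562928893, 157505, 271710, 4562928895, 306466, 43564],
    [12, 25, 107328, 46639, 60743, 107358, 326946],
    [28, 25, 107358, 326946, 46639, 60743, 107328],
    [30, 0],
    [44, 27, 429150, 429127, 429120],
    [62, 26, 34092, 9306016964, 299810, 4845156092, 4845156095, 275008, 154207],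
    [81, 26, 8589934846, 38703, 94302, 309026, 51783, 94272],
    [48, 27, 386631, 34359738598, 374366, 374336],
    [1, 27, 69191, 51759, 11453246458, 412194, 125534, 11453246463, 125504],
    [2, 26, 18247, 2241225722, 108834, 33118, 2241225727, 33088, 263940],
    [4, 25, 91146, 272162],
    [6, 26, 481034, 9180026107, 229470, 9180026111, 229440],
    [6, 26, 7078963963, 176960, 176990, 7078963967, 316682]]
    (.split 1 1 0 (-5000) cert27 cert28)

def cert30 : Cert :=
  .node [[5, 27, 406568, 458084, 126790, 438809, 16786894843, 118572, 4097415358, 105036],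
    [7, 26, 249128, 280676, 14951887867, 205593, 377610, 2510713790, 102476]]
    (.leaf [10425640, 11747940, 11529030, 15728665, 9468716, 111786954164, 21235189438, 11906058, 17272574203, 83853517565])

def cert31 : Cert :=
  .node [[7, 26, 5180155133, 314724, 36475, 59974, 174376, 283146, 154432, 10470401275, 2341581054]]
    (.leaf [497674, 478820, 524358, 17945, 59185, 56128, 28366913789, 2467576831, 35363, 31355])

def cert32 : Cert :=
  .node [[35, 27, 361572, 306216, 400966, 6963580412, 15627763199, 456241, 309002, 173376, 261755, 109572],
    [24, 27, 407336, 327488, 2438143678, 324387],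
    [42, 27, 5951612412, 626603973, 224868, 141066, 490816, 81433],
    [62, 0, 433],
    [66, 27, 150809, 382047, 377468, 198952, 92460],
    [42, 27, 189284, 5558879996, 15620, 6705, 106762, 479040, 44057, 20259],
    [44, 27, 447558, 323167, 296256, 2573777854],
    [46, 27, 9656621307, 37164, 9656621311, 296714, 379712, 39720, 385119],
    [60, 26, 380516, 80991, 139846, 142858, 35648, 76825, 6250678270],
    [81, 27, 16886130174, 9768, 255046, 60767, 268298, 62272, 587478779],
    [64, 26, 383076, 35964, 945478630, 42591],
    [5, 28, 34359738619, 408902, 34359738623, 251456, 3419138238, 275295],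
    [7, 26, 16138181627, 4480639409, 129375, 16138181631, 192070, 507914, 181312],
    [19, 25, 5155, 7409586427, 189510, 1099671293, 7884803839, 1099671292, 275210, 115067, 10289],
    [35, 27, 437297, 155748, 443462, 6052283900, 21024713215, 187688, 368138, 110656, 268923, 163076],
    [67, 26, 305457, 8196, 113764, 12565954303, 231494, 194826, 230720, 63867, 191011],
    [18, 27, 19788, 98886, 373116, 111882, 178713],
    [50, 26, 37958, 25695, 3435984891, 286233, 3189145855, 284682, 26176, 4136, 196172],
    [64, 26, 2033956326, 279396, 94022, 101913, 2498447615, 38956, 103434, 1588906929, 16716, 39007]]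
    (.split 1 3 1 (-10000) cert30 cert31)

def cert33 : Cert :=
  .node [[17, 27, 313157373, 17027870716, 15430, 28938, 1059468287, 18078179323, 322088, 14687, 10244],
    [27, 25, 144735, 13668280059, 153670, 1660570342, 12007709951, 351242, 83752, 27967, 124676],
    [20, 26, 106852, 124795, 252486, 11789360127, 473866, 99880, 329753, 106865584, 27743],
    [41, 27, 10156235772, 4918128581, 48644, 98655, 3642956031, 334090, 380772, 156697, 4988695215, 54563],
    [43, 27, 44844, 275807, 17662666693, 7308257535, 156426, 67377, 50969, 369215, 3332],
    [24, 26, 318248, 340586416],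
    [42, 27, 480576, 231780, 3964498940, 142858, 2600, 95257, 578081968, 8196],
    [61, 28, 34359738598, 461352, 34359738621, 493575088],
    [65, 27, 14464226555, 461352, 174346, 183345, 139033, 493575088, 69411],
    [67, 26, 280902, 4367035644, 21288, 183419, 10947028735, 209418, 167729, 111424, 9248767664, 74244],
    [44, 27, 269888, 386143, 5413716926, 410182],
    [60, 26, 1612, 204895, 261476, 50240, 262410, 227142, 208921, 2500745727, 2500745723],
    [62, 26, 351327, 2604, 98600, 7171165158, 7171165181],
    [81, 26, 114015, 228964, 204328, 40497, 384778, 214086, 215577, 1183405232, 12585486843],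
    [50, 26, 3042279675, 18496, 6184, 2593070847, 296458, 236364, 236313, 28998, 22111],
    [64, 26, 3353694694, 115551, 270436, 89468],
    [66, 27, 492383, 6700, 249640, 384124, 195082, 10942085371, 155161, 68671, 13811850982],
    [5, 28, 200287, 44496438779, 279592, 23672059135, 118348, 264262, 9497, 83264, 277348],
    [7, 25, 13665918459, 32320, 78888, 7792954623, 340234, 33612, 75108, 87110, 65887],
    [19, 25, 27185, 10275, 9384624639, 8085728251, 300810, 121979, 26137, 194886],
    [27, 25, 983706621, 9029054715, 23848, 43071, 10012761087, 273930, 122950, 93023, 121604],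
    [29, 28, 56005998310, 8085234373, 197932, 258570, 306201, 339761, 16308803835],
    [33, 28, 360006, 309292, 487985, 517642, 439833, 11671464187],
    [35, 26, 69727, 5037252859, 310116, 344625, 155462, 223242, 39547, 250408, 11292856575, 99076],
    [67, 26, 248369, 311652, 214056, 12594583216],
    [30, 27, 417887, 254508, 224808, 27339870384],
    [44, 27, 250980, 463686, 20567164411, 374538, 177759, 52761, 267816, 3031300016, 182092],
    [46, 26, 120927, 231012, 131916, 13764072699, 62764, 337674, 116505, 223528, 792511999],
    [60, 26, 5415176934, 209508, 253766, 276234, 301337, 148319, 16972],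
    [62, 26, 7255895014, 35116, 301663, 124968, 7255895037],
    [16, 27, 30643771366, 36964, 467270, 11052, 508426, 31052, 39464, 19551],
    [18, 24, 372505, 177418, 163142, 10828, 11884780518, 154408, 144996, 76127, 43308]]
    (.leaf [284200, 432153, 266596, 126769, 17164596198, 139871, 524298, 4601553403, 438854, 5109378815, 208172])

def cert34 : Cert :=
  .node [[1, 27, 95839, 17179869434, 17179869439, 266566, 363018, 95808],
    [15, 25, 8130201599, 8130201595, 162374, 343562, 730843077],
    [2, 27, 6487060991, 6487060986, 100678, 136970, 36191, 36160, 510212],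
    [23, 27, 6199047679, 131082, 63046, 6199047674, 76127, 76096, 487428],
    [33, 26, 17179869435, 363018, 9075664325],
    [35, 26, 1958330367, 9270743290, 429179, 64546, 354886, 514826, 8501768187, 182532],
    [4, 26, 363018, 9075664325],
    [20, 26, 446986, 1486525693, 230982, 10076460287, 7103409402, 1486525692],
    [41, 27, 524042, 270662, 15969852927, 2420032978, 15969852924, 15969852847],
    [24, 26, 156938, 321576, 136262, 4785035263, 4785035261, 703447742, 66624, 55087],
    [42, 26, 119562, 55134, 3644087292, 3644087295, 3644087215, 1581905618, 354368],
    [61, 27, 357642, 21805063654, 184902, 21805063677, 12554675134],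
    [63, 27, 160266, 132190, 4882561276, 4882561279, 31192443589, 4882561199, 474944],
    [67, 26, 348486, 86307, 11326922492, 35633, 192266, 2071145725, 417403, 300096, 66052],
    [12, 26, 281866, 249926, 1939442622, 126303, 88384],
    [44, 27, 6736879550, 438623, 362822, 306752],
    [62, 26, 4934223038, 295946, 9021932287, 244319, 9021932283, 132671],
    [81, 27, 17179869438, 281866, 95839, 964520638, 251718, 83520],
    [83, 26, 5001517054, 81930, 429179, 27999, 280797886, 73286, 24384],
    [16, 26, 964520638, 281866, 95839, 17179869414, 251718, 83520],
    [18, 26, 5001517054, 280797886, 81930, 429180, 73286, 27999, 24384],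
    [50, 26, 179722, 1931455231, 304508, 244575, 188441, 1931455227, 213056, 2461602238],
    [64, 26, 134922, 8219233023, 349284, 8219232943, 1341312466, 45900, 31839, 105542],
    [82, 27, 465674, 5917305599, 485500, 95564, 439065, 5917305595, 318022],
    [5, 28, 34359738619, 34359738623, 363871, 386374, 316736, 3662320574],
    [13, 26, 281866, 17179869439, 17179869435, 7045203397],
    [27, 25, 170054, 12023125759, 8923601915, 160095, 3099524093, 11071, 343562, 2475902142, 121860],
    [29, 27, 427786, 26074834943, 213804, 26074834939, 10692893637, 151812],
    [33, 26, 281866, 17179869435, 7045203397],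
    [35, 25, 272138, 6902243583, 129403, 27170, 2227657466, 183110, 7685874683, 96516],
    [4, 26, 281866, 7045203397],
    [22, 27, 279878, 357923, 236076],
    [24, 26, 22854, 18954, 283944, 616838397, 84515, 105792, 616838399],
    [42, 26, 61796, 122634, 4379510268, 3247620527, 9497, 59974, 295744, 3247620607],
    [67, 27, 516731, 185098, 12045153788, 191302, 78942, 445248, 24187230661],
    [12, 26, 248134, 263946, 101215, 1309762750, 78912],
    [28, 26, 347718, 142431, 7510527994, 7510527999, 346122, 119872, 29736, 11823],
    [83, 27, 90950, 34911, 516731, 7464, 5830651646, 95498, 29504, 383851003],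
    [18, 27, 143942, 305433, 334460, 67916, 176906],
    [48, 27, 10387602662, 174203, 266566, 363852],
    [50, 26, 200524, 185354, 302873],
    [64, 26, 2118695910, 71548, 368740, 102495],
    [82, 27, 7324650747, 266566, 64844, 7324650751, 305276, 393738, 275737],
    [1, 28, 32588190714, 448326, 183647, 32588190719, 38440, 446218, 154432, 21551],
    [9, 27, 15902798075, 91231, 351844, 15902798079, 181770, 7295303378, 96838, 127257, 9316494076]]
    (.split 1 1 1 (-15000) cert32 cert33)

def cert35 : Cert :=
  .node [[13, 27, 409619, 91231, 122944, 12843343611, 242442, 12843343615],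
    [15, 0, 469],
    [17, 28, 19054811900, 135955, 90719, 325672, 5318635770, 32258848507, 90402, 128778, 6043590910],
    [2, 27, 77864, 62790, 412676, 34585, 57183, 76042, 7070254331, 61540, 110370, 5689729023],
    [23, 27, 183044, 82788, 166208, 10658462459, 99660, 414754],
    [35, 27, 262470, 222724, 498299, 48147, 165642, 11951755003, 325410],
    [4, 27, 224546, 348938],
    [20, 27, 288808, 120595, 391519, 5771122428, 177186, 15407756245, 289802, 5771122431],
    [41, 25, 612, 74048, 9472850901, 294239, 380, 154634, 153875, 546, 32990203],
    [45, 26, 2983846397, 168031, 251923, 142656, 295946, 2983846399],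
    [47, 27, 478278, 386323, 386826],
    [26, 26, 172102, 207967, 14361, 25700, 387648, 16742344955, 8488, 493578, 16166360319],
    [42, 26, 91411, 174687, 5617568469, 294208, 91402],
    [67, 26, 15174, 151386814, 20484, 412516, 312360, 5651, 15995, 17442, 358449],
    [44, 27, 365638, 441951, 9512547774, 296512],
    [60, 26, 480095, 23777761237],
    [62, 26, 8036976381, 346975, 58920, 3903322558, 24098, 38410, 8036976383],
    [81, 27, 317510, 380511, 190248, 195904, 34359738619, 503306, 394274, 1876901077],
    [18, 27, 1722224381, 56415, 433945, 3091, 41024, 41084, 395852, 376074],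
    [48, 28, 21522243558, 208710, 226911, 25527317438, 512076, 282724],
    [50, 26, 175385, 135263, 66684, 75283, 208650, 292416, 120908],
    [64, 27, 4928, 378212, 310367, 172819, 153212, 173900, 173066],
    [1, 27, 132166, 166425, 337427, 439848, 351327, 52490, 6147562235, 179746, 108906751, 242276],
    [5, 28, 206918, 96546, 19204, 303656, 225119, 47576033531, 227148, 21352252671, 180580],
    [7, 26, 84499, 125791, 272192, 87818],
    [13, 27, 145427, 89439, 28533288191, 28533288187, 496650, 193600],
    [27, 27, 34850, 444164, 42536, 64863, 60947, 190592251, 190592255, 31302],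
    [33, 26, 53855, 116544, 17179869435, 299018, 33811],
    [35, 26, 407140, 251908, 351784, 94218, 8929850107, 231473, 51490],
    [4, 26, 53855, 116544, 299018, 33811],
    [6, 26, 92516, 16665, 34564, 155688, 115295, 10932075775, 21456223995, 86092, 474378, 106054],
    [41, 26, 277523, 146752, 12868105941, 441695, 292874],
    [47, 27, 66624, 335891, 447814, 16735, 354570],
    [49, 26, 405312, 418835, 259112, 495711, 176454, 183601, 512778, 4903524859, 60540],
    [51, 25, 186131, 267825, 168804, 275752, 198239, 90182, 138572, 196362]]
    (.leaf [6082609, 11483968, 7623720, 6594886, 8130124, 15728650, 95174267131, 14477407, 13606419])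

def cert36 : Cert :=
  .node [[1, 28, 2716764156, 16672121599, 245348, 239174, 271656, 22276082938, 217122, 143711, 128281],
    [5, 28, 34479495163, 33293775103, 477254, 40036, 296512, 23074, 286815, 168503804, 21017],
    [7, 27, 7774912507, 49532, 49503, 3910, 284224, 302626, 123492],
    [13, 27, 9482653947, 4220, 12578, 442387, 70976, 10340, 165898, 8838485247, 68959],
    [15, 26, 7431523835, 47484, 117860, 270406, 223251, 237120, 144674, 340490],
    [17, 29, 46068829691, 28200252156, 36644017150, 410899, 434472, 180746, 120610, 79711, 10118162175],
    [2, 27, 10400476667, 87135, 372228, 144966, 12900, 89664, 210442, 148002, 10106511615, 7193],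
    [23, 27, 7774912507, 49532, 253188, 3910, 49503, 284224, 123492, 302626],
    [27, 27, 5374845179, 363268, 92742, 4172013268, 121634, 5374845183, 72714],
    [33, 27, 34359738619, 221474, 361482],
    [35, 25, 16002932219, 299620, 68100, 233768, 103202, 168458],
    [4, 27, 221474, 361482],
    [6, 26, 16616165627, 137567, 8488, 228678, 1570, 136768, 29028, 500746, 15956022527, 16409],
    [20, 27, 269066, 6749738495, 96838, 208424, 8660893436, 268322, 58207, 84068, 47385],
    [41, 27, 155743, 15316371195, 9581899516, 12358, 407140, 284706, 381450, 155772, 10777],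
    [47, 26, 50496, 21297, 20836, 284998, 26146, 238099, 243210, 12156],
    [24, 27, 2853627, 2853631, 50692, 15430, 12307, 1003262932, 15650, 501800],
    [26, 26, 10628538619, 7355099391, 80921, 107078, 267328, 76639, 335114, 45352, 143716],
    [42, 27, 179300, 8306050555, 42591, 41753, 471872, 154402, 158218, 42108, 3398],
    [65, 27, 34359738619, 85568, 171298, 404490, 439848],
    [67, 26, 323615231, 19460, 448356, 5958, 6178, 316470484, 340529, 300328],
    [14, 26, 14162118907, 14162118911, 330591, 14617, 141382, 327232, 435722, 636, 15972],
    [44, 27, 17764, 366687, 4377, 856271099, 9340, 16394, 15906, 363072, 501062],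
    [60, 26, 253986, 68633, 294495, 260362, 13666227451, 111168, 146044, 280932, 240710],
    [81, 26, 285474, 209503, 17179869435, 203072, 127507, 387338, 24872, 315206],
    [34, 26, 415839, 279043284, 380179, 3550173435, 407616, 240252, 441866, 48168, 273478],
    [64, 26, 97887, 287588, 199548, 7068891860]]
    (.leaf [3026210, 895575555796, 14985828, 539456, 10210172, 15728689, 899338, 11877160, 879891, 3394886])

def cert37 : Cert :=
  .node [[2, 27, 67136, 476164, 5465138682, 55622, 78114, 67167, 5465138687, 51722],
    [4, 27, 490530, 325898],
    [20, 26, 42560, 6918577919, 35142, 265762, 42591, 3459289086, 187146],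
    [41, 27, 6568082130, 6568082175, 339490, 6568082172, 21223574959, 236810],
    [8, 26, 323392, 6062182334, 309770],
    [10, 26, 429120, 11394496978, 9717972731, 1676524540, 1676524463, 11394497023, 410890],
    [24, 26, 17222, 1686596862, 460584, 91146, 116032, 3373193727, 216198334, 20831],
    [26, 26, 9717972731, 11394496978, 410890, 1676524540, 429120, 11394497023, 1676524463],
    [42, 26, 145698, 2819087058, 101642, 2819087100, 429120, 2819087103, 9109372079],
    [61, 27, 309770, 17179869437, 256064, 17179869439, 8378174654],
    [67, 26, 181318, 531112914, 200970, 219259, 9612503548, 339776, 1531779583, 1531779503],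
    [12, 26, 100934, 7755523538, 309770, 352832, 122207],
    [44, 27, 368198, 352320, 3814182590, 445023],
    [62, 26, 7676258047, 138506, 114496, 7676258045, 3743511230, 429151],
    [81, 28, 391970, 314378, 384838, 390464, 34359738622, 375135],
    [83, 26, 7976, 1028, 4897676286, 94218, 25414, 101440, 352781051, 329339, 108127],
    [18, 26, 5582115327, 429180, 3076, 6748621307, 329482, 26152, 335680, 6032161790, 357215],
    [64, 26, 150415826, 425828, 119391, 143484],
    [82, 26, 74054, 6615414782, 75554, 72287, 75328, 429180, 60426],
    [1, 28, 76870, 105250, 385832, 16050299346, 74847, 10560, 22906492414, 45812984831],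
    [2, 27, 48966, 51746, 471812, 8731218175, 35338, 3624, 47711, 44864, 4365609214],
    [23, 27, 7747899311, 408128, 135780, 6278557179, 343594239, 36447, 470306, 284164, 31356],
    [27, 27, 97606, 5303325183, 24842, 131106, 95071, 1905954299, 396036, 3397371133],
    [33, 27, 339234, 34359738619, 347402],
    [35, 27, 147782, 249378, 4542868479, 8037291771, 89866, 326148, 113531],
    [4, 27, 347402, 339234],
    [20, 27, 6470, 310306, 6966608895, 338186, 6399990226, 6239, 139048, 6966608890],
    [41, 28, 522852, 24203464444, 413194, 20312548527, 140639, 379682, 1324534783, 120188],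
    [24, 26, 1606, 144598267, 3106, 362024, 1290, 1631, 8964, 144598271],
    [26, 26, 10229727999, 339776, 331018, 10229727954, 10229727995],
    [42, 26, 3023769519, 339776, 3602979580, 56610, 61450, 21087, 77924, 18044, 197173247],
    [67, 26, 150854, 264256, 60004, 243210, 4636738555, 5760084476, 115835, 4636738559],
    [12, 27, 445504, 425994, 160802, 375135, 384838],
    [14, 26, 4452590526, 12780782847, 413706, 357215, 276544, 12780782843],
    [62, 26, 96296, 6390391549, 11268, 6390391526, 357215],
    [81, 28, 403526, 392970, 201506, 411712, 34359738622, 346719],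
    [83, 27, 495227, 18216, 278853627, 103178, 54086, 17457, 104512, 6093293822, 121951],
    [18, 27, 9467968763, 4737879551, 74280, 208409, 480892, 425536, 8708, 360714, 495967],
    [48, 27, 3233592254, 403526, 34359738623, 304448, 346719],
    [50, 26, 305276, 114722, 69913852, 276544, 5180629499, 124682, 3007736061, 314975],
    [64, 26, 119420, 123231, 1175902719, 297060],
    [82, 26, 48454, 24354, 4129139454, 49472, 41823, 47114, 305276],
    [7, 27, 11854769071, 393792, 237090],
    [9, 28, 398692, 20781750482, 22906492412, 22906492411, 154719, 22906492415, 126076],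
    [13, 27, 326666, 283170, 34359738619, 34359738623],
    [15, 27, 43590, 187236, 214577, 303936, 26470086085, 230434, 87420],
    [21, 29, 231750, 513124, 32208008126, 19720183295, 68719476987, 199007, 409420],
    [23, 27, 5489356975, 64612, 264452, 51532, 287040, 6157903355, 363042],
    [33, 27, 255266, 34359738619, 356106],
    [4, 27, 255266, 356106],
    [20, 27, 7666861306, 6128892626, 18246, 7666861311, 15711, 255266, 346122, 100648],
    [41, 28, 25700964860, 409444, 2181591295, 17317547695, 158815, 294434, 419594, 129404],
    [10, 26, 10994966271, 1609212410, 129094, 339008, 12604178427, 110943, 430858, 103012, 46105],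
    [26, 26, 12604178431, 339008, 129094, 12604178427, 110943, 46105, 1609212414, 430858, 103012],
    [42, 26, 44810, 276544, 233241855, 2747779836, 16991, 1851479471, 31522, 13948, 43876],
    [65, 27, 429352, 186432, 12036, 34359738619, 101666, 512778],
    [67, 26, 206120, 102720, 411428351, 11590, 17458441467, 344420, 7803, 268810, 57122],
    [44, 27, 275264, 403526, 346719, 5088536254],
    [81, 27, 307270, 254047, 7427487998, 59176, 19504763131, 189760, 300834, 405258],
    [18, 27, 50057727, 32351, 50057723, 472065277, 25664, 502041, 335948, 306186, 26236],
    [48, 28, 264518, 218719, 27087970750, 392548, 449868, 23182100991],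
    [64, 27, 277343, 497764, 225916, 4501905663],
    [82, 27, 154438, 451964, 74777, 52575, 70720, 8058973179, 163082, 156706]]
    (.split 1 3 0 (-65000) cert35 cert36)

def cert38 : Cert :=
  .node [[23, 26, 7026195119, 308258, 2703149778, 310592, 2703149823, 2703149820, 184580],
    [24, 26, 514088, 73763, 110656, 1869589418],
    [7, 27, 19495646383, 504866, 486976],
    [6, 0, 453],
    [12, 26, 432906, 211008, 147746, 211039, 174406],
    [4, 26, 432906, 147746],
    [81, 27, 17179869438, 211008, 117282, 174406, 211039, 370698],
    [16, 26, 370698, 211008, 211039, 117282, 174406, 17179869439]]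
    (.split 1 0 1 (5000) cert34 cert37)

def cert39 : Cert :=
  .node [[5, 25, 380, 7378, 8589934843, 8589934766, 351, 376164],
    [7, 25, 380, 7827435003, 286218, 6610, 7827434926, 351, 342628],
    [19, 26, 271995, 4620997806, 311562, 177222, 8597721541, 4257202939, 4620997884],
    [35, 25, 3735353262, 171274, 97350, 262681, 4729729221, 149371, 194125052, 155236, 127492],
    [61, 26, 17179869358, 26634, 16040423679, 454425, 1470623429, 29484, 28465, 728846587],
    [65, 26, 1605566715, 27146, 462105, 17179869358, 28977, 24867],
    [67, 26, 266875, 46662, 21809, 251673, 6383543982, 269662, 61450, 18979]]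
    (.leaf [613648891, 12652085422, 22538, 812, 382489, 1238184389, 817, 19039, 524388, 416469459])

def cert40 : Cert :=
  .node [[23, 26, 302436, 351, 205060, 344896, 5842, 380, 6905247740, 218914],
    [4, 25, 7378, 17179869358, 380, 376164, 351, 8589934844],
    [6, 24, 351, 6134883323, 6134883246, 380, 5330, 268644, 99850],
    [20, 25, 17179869358, 7378, 351, 376164, 380, 8589934844]]
    (.leaf [11976637691, 11976637614, 9938, 351, 524388, 380, 140578, 61450])

def cert41 : Cert :=
  .node [[63, 27, 14028253125, 14028253180, 374878, 350528, 14028253183, 14028253102],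
    [62, 26, 8589934844, 429151, 17179869439, 8589934843, 25769803950],
    [83, 26, 17179869394, 8589934844, 429179, 8589934843, 25769803950],
    [18, 26, 17179869394, 8589934844, 429180, 8589934843, 25769803950],
    [82, 26, 8589934844, 8589934843, 25769803950, 429180, 17179869394],
    [62, 26, 5787289339, 311903, 11574578406, 17361867438, 5787289340],
    [83, 26, 5787289339, 11574578386, 17361867438, 5787289340, 311931],
    [82, 26, 11574578386, 5787289339, 17361867438, 5787289340, 311932],
    [67, 26, 4265144315, 4265144316, 269662, 173956350, 12969388462, 271995],
    [66, 26, 4434619899, 271967, 8961278, 13312819886, 4434619900, 271996]]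
    (.split 1 0 1 (10000) cert39 cert40)

def cert42 : Cert :=
  .node [[1, 28, 322368, 22906492410, 322399, 22906492415, 22906492330, 257862],
    [5, 28, 483648, 34359738619, 34359738623, 483679, 386886],
    [2, 26, 45888, 3262978298, 45919, 3262978303, 3262978218, 36934, 331012],
    [23, 26, 200768, 4020117970, 4020117930, 4020118015, 4020118012, 271876],
    [27, 27, 9536, 157730, 70239, 2430451134, 4981004031, 4981004026, 56134, 505348],
    [43, 27, 362847, 7262853862, 209443, 14525707461, 181567, 7262853885, 198916],
    [63, 25, 113728, 271626, 100958, 802, 512454118, 90947, 512454140],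
    [28, 27, 483679, 386886, 483648, 34359738538],
    [30, 0],
    [44, 27, 483679, 386886, 483648],
    [48, 27, 34359738598, 421983, 421952, 348998],
    [2, 27, 4981004030, 9962008063, 157730, 30272, 30303, 75334, 505348]]
    (.split 0 1 1 (50000) cert38 cert41)

def cert43 : Cert :=
  .node [[22, 0, 453]]
    (.split 1 2 0 (0) cert29 cert42)

def cert44 : Cert :=
  .node [[21, 28, 13526442430, 149372, 34359738619, 12853746150, 388708, 129855, 330310],
    [35, 0, 473, 433],
    [4, 27, 402698, 332067, 231428],
    [20, 27, 394506, 359464, 4607049433, 414499, 95296, 477540, 473113, 2161580287, 2161580286],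
    [22, 26, 6969391099, 2743649214, 30332, 345123, 2607202303, 78948, 67142, 26431],
    [41, 26, 142602, 4597494012, 105507, 5705450161, 288356, 202265],
    [47, 26, 4120606142, 143198, 317987, 192808, 171644, 188004, 121137, 8722646779],
    [10, 27, 5003344891, 519232, 220185, 313700, 462883, 348420],
    [24, 27, 5226942398, 417344, 376360, 401699],
    [42, 27, 221706, 1214190846, 490048, 1214190845, 323940, 1286027737, 265753],
    [63, 27, 6585133053, 396382, 22824, 258172, 32305, 14109477849, 99088],
    [44, 26, 303174, 73054, 298182334, 42876, 111460, 129827, 128808, 6161362683],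
    [60, 26, 41226, 288582, 8639112188, 23044, 60028, 156260, 154147, 50014, 6677743281],
    [81, 28, 222474, 461126, 177246, 123908, 34359738622, 362275, 122664, 3980370097],
    [64, 26, 122492, 3398, 103775, 1546, 325476, 2595, 4889, 136686001],
    [66, 27, 415356, 248902, 14165563332, 107564, 368675, 271641, 25298680753],
    [82, 26, 281980, 48966, 18782, 13060, 23562, 3642027518, 38435, 13096, 421907121],
    [5, 27, 115324, 343878, 14828327677, 16751701499, 2971827390, 145960, 445796, 2779709951, 147235],
    [7, 26, 68988, 205638, 4801195003, 502471166, 310538, 266596, 87336, 11037037821, 387530748],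
    [13, 27, 26416072957, 3199606015, 60028, 82476, 456036, 120089, 4129564593],
    [15, 27, 312700, 7916761, 211806, 120676, 273960, 388401],
    [17, 29, 24248811004, 291398, 37959225854, 234259, 39336532733, 124707, 377956, 123688, 202265, 11842904059],
    [19, 27, 273960, 10287928281, 259940, 388401],
    [2, 27, 153640, 2448068825, 361988, 222820, 229913, 67344],
    [23, 27, 65916, 196166, 86080, 10935239675, 257284, 459786, 460388, 10049533181, 264488, 131609],
    [33, 27, 13549646587, 145418, 141347, 267289, 149297],
    [35, 27, 329265, 14175275737, 357988, 377384],
    [4, 27, 244484, 368906, 358691],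
    [20, 27, 355624, 24128, 5369807577, 354826, 488804, 366627, 504089, 123152],
    [22, 26, 21884, 64582, 3309505279, 4291034302, 21311, 83812, 336931, 8722647291],
    [47, 26, 290940, 125510, 322097, 9459316414, 236900, 364835, 77608, 1822302971],
    [8, 27, 43900, 324934, 169060, 14621178621, 161034, 202280, 200227, 3698839551, 277008],
    [10, 26, 46385, 93254, 5253384957, 12668, 11268, 46090, 479588, 57379, 356889, 326160],
    [24, 27, 227082, 458054, 61820, 21709055997, 4126155007, 285224, 337252, 282403, 63001, 244752],
    [65, 27, 172042, 346950, 141105, 46716, 19569207293, 101160, 214051, 133401, 123920],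
    [67, 25, 90634, 182854, 111665, 10304271869, 24700, 14632, 307556, 112675, 25113, 97552],
    [81, 26, 151050, 304710, 41084, 37892, 150321, 187939, 163353],
    [16, 27, 5937921988, 234566, 12737874687, 62474, 235048, 350820, 203811, 117628, 79632],
    [18, 25, 403481, 108835, 87306, 125480, 10298402559, 176454, 23932, 187236, 42512],
    [64, 25, 195865, 316772, 1404, 606128358, 6435, 5130, 153640, 10566]]
    (.leaf [7280665, 15728740, 5616650, 661683759101, 6988579, 6738472, 1281841, 11331398, 1523836, 269584])

def cert45 : Cert :=
  .node []
    (.leaf [10531, 192018358, 7178, 9572, 25649, 1118760191, 12614, 1320, 2308, 3934, 10256])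

def cert46 : Cert :=
  .node [[7, 27, 281363, 88369, 366150, 6394571775, 6750, 22395, 483082, 17924, 5672, 104758449],
    [13, 27, 172307, 312369, 22581284607, 23134, 78971, 63236, 20008, 369935025],
    [21, 27, 233747, 220721, 469830, 15963207679, 55931, 8512675013, 57092],
    [23, 26, 244755, 552, 258886, 862, 289290, 285188, 82979, 11218097],
    [33, 27, 475185, 143635, 9735567813, 119931, 169994, 167428, 61219, 159814],
    [35, 26, 17690066117, 261139, 111139, 217979, 309002, 304388, 12849, 290630],
    [4, 27, 363043, 338954, 263940],
    [20, 25, 263971, 280134, 317450, 49787, 263985, 242948, 20258104575, 9045104325]]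
    (.leaf [304665891, 524288070, 413602314, 11532643446758, 93127803, 494257457, 316714500, 26399301172479, 16936352166853])

def cert47 : Cert :=
  .node [[1, 28, 27729859322, 232714, 28539713791, 286243, 809854716, 472646, 100702, 84776, 133636],
    [5, 27, 17179869439, 3262227909, 326214, 17179869435],
    [7, 26, 346890, 255763, 377175237, 325446],
    [15, 26, 202771, 17478998469, 275210, 258118],
    [2, 27, 3883239162, 31242, 14174, 47139, 113410812, 66118, 3996649727, 11816, 502276],
    [21, 27, 17179869435, 17179869439, 3262227909, 326214],
    [4, 27, 401418, 434467, 292356],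
    [20, 26, 5320952830, 240138, 155399420, 268835, 16424, 90694, 19294, 10797304575, 168708],
    [22, 26, 6775415807, 346147, 128838, 1286560965, 6775415803],
    [10, 26, 69499, 89393, 2979123707, 96606, 304419, 289856, 1404486143, 101732, 369488636, 231172],
    [24, 27, 897812677, 54288, 22026, 352552, 89926, 2364075261, 307264, 342563, 2364075263],
    [42, 26, 45691, 37937, 64266, 63326, 921748223, 287296, 65380, 60451, 3429355516, 45060],
    [63, 26, 16675, 142096, 357265093, 273502, 142099, 20544, 12804],
    [44, 26, 3262227909, 326214],
    [60, 27, 170619, 103729, 172042, 268894, 414534, 3822531249, 242788, 228899, 11649242620, 120836],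
    [81, 27, 1049, 47454, 194826, 43304, 266566, 13144853502, 135217, 223779, 8036, 136196],
    [83, 27, 523643, 12638, 58122, 13352, 82758, 3720160766, 41009, 67363, 214716412, 40708],
    [16, 27, 386314, 34359738598, 478278, 4782947781, 351779, 271364],
    [18, 27, 379417, 169232, 2071582971, 194083, 173120, 311396, 149508],
    [34, 26, 36874, 194353, 6433653501, 232512, 348004, 6937, 93254, 310051, 13436, 71952],
    [64, 27, 321118, 381540, 242811, 9277455334],
    [1, 27, 76126, 175114, 10899015421, 80680, 12208194812, 427334, 233763, 23107209983, 122884],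
    [7, 26, 302858, 136262, 48659, 6367044091, 6367044095],
    [9, 28, 60179, 18249086971, 334174, 29160746748, 22532, 422500, 168006, 17506918911, 252795, 29219],
    [15, 27, 327187, 28407642053, 435978, 319046],
    [17, 28, 41054, 77587, 39720, 32099453180, 35588, 80177, 493894, 86051, 31878470141, 4708],
    [19, 27, 457595, 21063517125, 410634, 142897, 1682625457, 105822, 360518, 311315, 80424, 109859],
    [23, 27, 127507, 518922, 3871739389, 456708, 3871739388, 433734, 7705, 18442310399, 164657],
    [35, 27, 181258, 11812335813, 142897, 231172, 299102, 457595, 132678, 197139, 227624, 4756984753],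
    [4, 27, 370698, 288260, 380195],
    [20, 26, 27486, 266275, 241162, 8330225151, 181252, 154182, 3929131005, 29224, 4401094396],
    [22, 26, 326179, 6031043835, 6031043839, 15876, 117318, 34323],
    [41, 27, 42521, 9042148348, 261130, 208433, 166148, 270436, 6179723007, 243235, 213854, 161915],
    [10, 26, 44894, 287552, 8929958399, 231172, 85604, 20347, 102470, 324643, 214577],
    [24, 27, 67850, 256803, 6281920509, 28254, 291112, 6281920511, 158022, 156480, 132112],
    [42, 26, 44554, 48163, 273728, 33284, 34398, 37681, 992589311, 52580, 25979, 2078863612],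
    [63, 27, 274195, 15680, 14852, 18467, 434072575, 445278, 434072571, 286736],
    [65, 28, 459313, 329763, 271912, 14852, 93721, 67678, 419654, 32860624125, 279050, 332816],
    [44, 27, 4782947781, 478278],
    [60, 26, 343601, 276515, 13896065279, 173316, 123486, 53371, 370246, 172388, 230666, 2053775612],
    [81, 26, 307505, 237859, 61992, 105220, 62745, 51806, 313670, 1387768572, 199178, 8205785599],
    [18, 27, 13617, 140579, 119360, 111620, 334873, 3319419131, 378212, 291856],
    [34, 26, 15641, 324643, 52499, 64266, 9454957053, 199488, 214577, 178502, 417636, 155152],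
    [64, 27, 222075, 8950908415, 371044, 271966],
    [1, 26, 34818392575, 344355, 292874, 188420, 70952, 71006, 430406, 16996, 40217, 504369],
    [5, 27, 492337, 61028, 29579267583, 86819, 132115, 11870, 520774, 29700, 7193, 65040],
    [7, 26, 60435, 23396, 274186, 10166185983, 11328, 722713853, 205638, 16419, 6928, 162609],
    [11, 27, 317233, 304228, 316938, 390179, 458259, 147323, 464966, 312616, 5692655025],
    [13, 26, 265521, 38244, 3347, 26915, 19264, 1181014781, 16612960255, 11590, 2314, 10768],
    [17, 25, 279601, 85779, 166666, 205091, 244294, 142596, 29209, 11635973119],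
    [2, 26, 4664436735, 34323, 66826, 82211, 98118, 292100, 6937, 63793],
    [21, 27, 490801, 70500, 28523049983, 86819, 143379, 18526, 520774, 28676, 78608],
    [23, 26, 165937, 12139752191, 89363, 18201, 255046, 253444, 307210, 59171],
    [33, 26, 274225, 34916, 767026173, 29987, 15680, 3353, 16198, 5651, 6666, 15376],
    [4, 27, 378915, 271876, 357386],
    [6, 26, 161329, 21604, 5726, 9407691494, 341795, 54291, 745963263, 189254, 233476, 24080],
    [20, 26, 23321, 427274, 505379, 129299, 17567266815, 368966, 346116, 228401],
    [22, 26, 198193, 26468, 7006, 12469592550, 349475, 66835, 232518, 15364, 29712],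
    [41, 26, 454449, 188516, 72827, 298506, 324643, 7488, 19517547007, 205126, 220420, 122974],
    [45, 26, 168739, 36452, 164618, 11328, 272945, 12722670847, 4457198822, 111876, 31504],
    [63, 27, 22065, 444254, 3392, 2916, 260883, 4131, 1383230719, 2118, 1796, 308496],
    [65, 27, 267299, 121619, 16444910077, 222218, 88616, 233009, 23577, 346950, 134148, 188944],
    [12, 27, 319779, 338186, 4696648389, 469830, 249604],
    [14, 25, 311843, 23955708415, 69499, 194570, 510769, 342598, 61504, 190308, 206340, 156432],
    [46, 24, 146211, 14898260223, 210246, 90980, 156682, 29248, 291633, 92932, 29563, 74768],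
    [60, 26, 338979, 231690, 195172, 128606, 96891, 218131, 401990, 251140, 241213951, 188209],
    [81, 25, 248867, 168970, 18276, 135729, 178707, 293958, 1344, 184580, 3934, 18960],
    [83, 27, 59171, 40458, 459899, 32817, 70214, 37907, 43780, 42031103],
    [32, 27, 319779, 338186, 34359738623, 469830, 249604, 8512675013]]
    (.split 1 1 3 (5000) cert45 cert46)

def cert48 : Cert :=
  .node []
    (.leaf [25635, 19505, 783509446, 1629414573, 9803])

def cert49 : Cert :=
  .node [[4, 27, 319498, 292131, 215044],
    [6, 27, 390193, 24360, 440611, 60004, 5714073855, 401156, 40798, 287819, 52294, 56592],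
    [20, 27, 194609, 219944, 263262, 47227, 13829187071, 146436, 221450, 393251, 11424853700, 5202017713],
    [8, 27, 126790, 13877016038, 98654, 170571, 346161, 191498, 163107, 352296, 243728],
    [10, 27, 205638, 10507884006, 400734, 312592, 478769, 23522563839, 286724, 115835, 245027, 4886268612],
    [12, 27, 313926, 65546, 204072, 303907, 43268, 244318, 4827909041],
    [14, 27, 87163, 360497, 406342, 9650355652, 483619, 430596, 25619299071],
    [18, 27, 458256, 6501321156, 471396, 438547, 325923, 273734, 264542, 243204, 122152, 335665],
    [1, 27, 6851652548, 343331, 288582, 5508988081, 462099, 233000, 278622, 47108],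
    [3, 26, 195121, 171339, 415523, 387398, 228904, 246538, 47204, 228446, 513043],
    [5, 27, 207400, 242251, 123939, 364102, 24592, 482067, 66916, 214622, 36612, 275761],
    [7, 26, 111144, 249107, 188230, 56099, 287242, 23140, 110942, 83275, 94769],
    [9, 27, 193915, 4773688772, 239395, 459283, 13260935345, 201030, 193380, 434526, 46852, 178225],
    [11, 26, 275505, 12436277425, 224035, 140102, 185363, 261386, 66660, 82526, 241995, 122664],
    [13, 27, 1454717124, 72995, 513555, 61254, 52228],
    [15, 26, 320552, 239947, 161827, 78150, 246538, 66148, 319838, 294931, 273201],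
    [17, 27, 116859, 5505554609, 372771, 375366, 496403, 77834, 232744, 278622, 180228, 483377],
    [19, 25, 118395, 24881, 206115, 207686, 4245246641, 43018, 179496, 214878, 306963]]
    (.near 1)

def cert50 : Cert :=
  .node [[7, 27, 367430, 2911456433, 320266, 341854, 236072, 451859],
    [2, 27, 46627, 251851185, 49758, 37416, 161470716, 40518, 3611826426, 3773296895, 478724],
    [20, 27, 464163, 2549875197, 215306, 269918, 4724745980, 7274620927, 12688062148, 227624, 141572],
    [10, 27, 7706487037, 423518, 240192, 7706487039, 161827, 19905425092, 106500],
    [24, 27, 1324276158, 180038, 220510, 8379451645, 301864, 8379451647, 211235, 252944],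
    [63, 26, 175635, 34088, 323422, 148752],
    [12, 27, 6056391601, 390214, 423262, 410147, 262440, 31295],
    [14, 0, 452],
    [44, 27, 9714571454, 423262, 390214, 298559],
    [60, 26, 196387, 149809, 127076, 285790, 84859, 173638, 46530244, 9158389681],
    [81, 26, 190499, 287793, 157480, 14948, 179294, 168518, 189572568, 45157828],
    [83, 27, 93987, 64552, 22290372, 519547, 80734, 130097, 83270, 742038193],
    [16, 27, 345891, 315688, 778, 516, 355166, 32259461631, 33380, 307014, 20603],
    [18, 27, 150307, 457596, 95492, 83249, 35623620, 132934, 51225],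
    [34, 26, 236156, 350243, 249158, 3439574468, 3278181627, 145171, 11801],
    [48, 28, 427339, 256070, 28172211646, 271198, 298596, 26037585638],
    [64, 27, 330590, 364132, 11417580262, 225147],
    [82, 27, 486268, 80675, 83550, 71238, 74792, 7780, 19092932, 128305],
    [1, 27, 412195, 340574, 33284, 523027, 272680, 97750468, 364870, 3130393009],
    [5, 28, 112228, 25447945727, 250182, 265054, 179491, 167755, 43271531515, 9326028990, 164136],
    [7, 27, 330822, 329482, 246056, 307294, 473107],
    [9, 27, 227428, 333603, 295238, 463454, 33028, 518419, 79081412, 247089, 133755, 14013644977],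
    [13, 27, 512787],
    [15, 26, 197139, 311902, 249640],
    [17, 26, 1659, 221475, 1442356657, 157022, 37636, 195910, 52496324, 273969, 125736, 239123],
    [2, 27, 69667, 48734, 473604, 61766, 75027, 16537540, 38952, 448182193],
    [21, 29, 285284, 426315, 68719476987, 243806, 230470, 23425753830, 27855683262],
    [23, 27, 377875, 195880, 244830, 311622, 2249694129, 321034, 275716],
    [33, 26, 2142, 1043, 1659, 1832, 260, 273969, 19645617],
    [35, 26, 299614, 135955, 224891, 239912, 20484, 54065, 2753779121],
    [4, 27, 381731, 329482, 224772],
    [20, 26, 89354, 132190, 267555, 1214572465, 105768, 81171, 69892, 7834907844],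
    [22, 26, 42340, 10150836219, 63051, 36190, 375587, 34118, 4114677438, 3460314342],
    [51, 27, 296744, 431153, 373835, 370782, 461859, 168211, 25092, 3406666673, 278139],
    [8, 27, 175912, 368656],
    [10, 26, 393235, 254814, 323107, 324166, 207108, 167696],
    [24, 27, 362792, 283923, 183902, 234054, 1272710590, 256803, 304656],
    [61, 26, 100904, 58694, 64547, 319276734, 275987, 155664],
    [63, 26, 292702, 48168, 164883, 133904],
    [65, 27, 772362942, 337713, 237096, 105054, 142150, 11705871101, 19836, 155939, 170512],
    [44, 27, 342622, 374086, 8991718078, 274239],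
    [60, 27, 261425, 267364, 452702, 140411, 305734, 15353232049, 328739, 481946820],
    [34, 26, 254790, 214577, 222308, 46942, 211731, 107132, 3850, 269859, 224272],
    [48, 28, 361035, 256326, 301924, 238686, 27268183551, 29971077054],
    [64, 27, 346212, 273758, 11039592703, 201339],
    [66, 26, 338993, 140870, 380004, 94302, 177427, 2058, 253992, 149283, 188688],
    [1, 27, 374086, 3649153713, 477459, 259422, 402211, 219432, 71428, 589391300],
    [5, 26, 17179869439, 115752, 84515, 55396, 150366, 4050587070, 161606, 414001, 121419],
    [7, 27, 335370, 3120947889, 222046, 417555, 187688, 331590],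
    [9, 26, 7766834097, 77435, 129059, 95332, 220254, 17179869439, 120134, 346673, 189149124],
    [13, 27, 24146078463, 17019, 6947, 140051, 20996, 6470, 350257, 10166212],
    [15, 26, 3848610225, 273758, 188947, 231464],
    [2, 27, 227322801, 40570564, 27683, 16222, 30739, 444420, 25926, 13608],
    [21, 27, 6373711294, 29224, 157028, 104798, 261451, 204051, 173382, 393521, 98576],
    [23, 27, 359699, 184670, 325386, 156200, 300292, 305478, 2596102321],
    [33, 27, 403116209, 498481, 24360, 28766, 14611, 24187, 2820],
    [35, 26, 3793437361, 48689, 228136, 269662, 137491, 226683, 26884],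
    [4, 27, 209156, 296202, 358179],
    [6, 26, 99910, 424497, 143204, 93022, 10615003903, 58920, 156932, 350499, 175179, 143888],
    [20, 27, 12083300548, 468515, 6756, 214622, 188200, 122116, 11125595647, 156465, 181258, 2374493617],
    [22, 26, 142923, 381219, 111716, 62558, 121875, 5958271934, 224817, 103494, 58896],
    [51, 27, 343883, 412707, 171539, 336478, 33540, 284712, 379953, 4731693233, 282747],
    [8, 26, 241448, 221987, 135518, 263955, 5642, 224070, 136976],
    [10, 26, 148740, 231971, 14692, 223582, 24842003711, 626234564, 349233, 228166, 176400],
    [24, 26, 122384, 154974, 256326, 276264, 6410, 301843, 253987],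
    [63, 26, 118288, 109126, 322398, 131624, 2826, 303635, 108323],
    [65, 27, 11274, 205840, 20324, 446278, 252766, 515880, 482865, 505875, 442403],
    [12, 27, 8714, 8202080689, 5892, 292702, 342342, 218408, 339235],
    [14, 26, 313158, 256049, 10852, 18289849087, 318499, 860144836, 1886, 210180, 10000],
    [44, 26, 262184, 144715, 231217, 139876, 224291, 267614, 219411, 352582, 50448],
    [60, 27, 149883, 4374814148, 210993, 244836, 272163, 427870, 234310, 14346464945],
    [62, 26, 5863713476, 364835, 276499, 313926, 33028, 17179869361],
    [16, 27, 248872, 5030425028, 34359738623, 312867, 297566, 269382, 5884666801],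
    [32, 27, 248872, 5030425028, 34359738598, 297566, 312867, 269382, 5884666801],
    [34, 25, 132136, 47114, 133425, 182372, 154974, 271907, 275270, 356115, 142864],
    [48, 27, 306014, 313640, 71268, 238155, 129827, 393286, 43041317094, 376625],
    [64, 27, 289630, 339812, 12644523238, 215931],
    [66, 26, 72542, 92195, 240996, 15882, 2330408959, 7875294950, 93254, 242984, 316209, 20752]]
    (.split 1 1 0 (-73000) cert48 cert49)

def cert51 : Cert :=
  .node [[13, 0, 511, 439]]
    (.split 1 2 1 (20000) cert47 cert50)

def cert52 : Cert :=
  .node [[16, 0, 438],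
    [18, 26, 332057],
    [34, 26, 274201]]
    (.leaf [25649, 23500984, 768000182])

def cert53 : Cert :=
  .node [[9, 27, 291166, 13694144252, 9478262783, 2205806769, 11187332091, 175739, 230756, 80198, 44067],
    [24, 27, 410176, 369960, 426531, 1361678014],
    [18, 27, 412736, 4078451672, 393763, 386585, 349796, 274436],
    [64, 27, 418148, 6442178790, 442462, 318331],
    [82, 27, 7487140605, 246652, 113936, 19338865112, 411486, 14120],
    [41, 28, 382052, 5595191782, 391946, 323107, 34359738620, 384350, 276347, 225028],
    [10, 27, 7580627196, 7580627174, 195619, 472384, 208478, 136196],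
    [42, 26, 42875, 59486, 60426, 863162598, 5300629244, 330304, 58980, 49955, 34820],
    [16, 27, 14371, 214622, 151050, 402960, 3122585830, 154443, 329828, 154235, 9988],
    [18, 27, 425241, 159504, 212032, 316260, 175651, 122372],
    [48, 28, 267108, 33921665510, 458566, 353611, 268894, 24026356158],
    [43, 27, 61796, 88395, 8815921403, 22756500657, 123967, 454691]]
    (.split 0 1 3 (70000) cert51 cert52)

def cert54 : Cert :=
  .node [[1, 28, 56384, 185896, 7813795498, 22906492414, 45812984831, 217182, 223011, 299078],
    [11, 0, 433],
    [15, 27, 10250529021, 295464, 512094, 287356, 2758553265],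
    [2, 27, 10048, 4058131450, 4058131455, 33064, 39459, 38494, 1384297898, 53062, 522244],
    [43, 0, 428, 433],
    [8, 26, 3112, 397072],
    [10, 27, 502336, 12356024550, 439843, 308574, 4692556027, 7663468540, 306436],
    [24, 26, 230947, 263744, 1559332522, 192296],
    [42, 26, 1845811140, 269632, 5371682278, 134238, 96010, 5371682300],
    [61, 27, 17179869437, 31784, 264720, 17179869414],
    [12, 27, 370979, 235816, 15376, 337246, 137738, 464710, 68868],
    [30, 0],
    [62, 27, 280134, 34359738545, 343331, 343340, 9040987844],
    [81, 28, 464710, 34359738622, 235816, 370979, 15376, 337246, 137738, 68868],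
    [16, 27, 464710, 235816, 15376, 370979, 34359738623, 337246, 137738, 68868],
    [66, 27, 355398, 407065, 435747, 11477129412, 24065628593, 45100, 498812],
    [82, 26, 73286, 2320, 37160, 58403, 21770, 53086, 5407389438, 356220, 10756],
    [7, 26, 106054, 7836422395, 73280, 280074, 76894, 7836422399],
    [9, 27, 11453246460, 10271258066, 50555, 449636, 11453246459, 74590, 11453246463],
    [63, 26, 120336, 7808407549, 14376, 429150, 7808407551],
    [44, 27, 490566, 203583, 5641872830, 303454],
    [18, 27, 243014, 86794, 205347, 343577, 421244, 143108],
    [48, 27, 14709809638, 170876, 377926, 274251],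
    [64, 25, 547821798, 315748, 35451, 44638],
    [5, 28, 5062518462, 34359738623, 34359738619, 272222, 464454, 182847],
    [15, 26, 6651274214, 138024, 6651274237, 365662, 9216394161],
    [35, 27, 5111502333, 1239457278, 7199536049, 131880, 249979, 314974, 272388],
    [41, 26, 446624230, 269668, 80675, 29051, 36446, 98058, 8589934844, 56324],
    [83, 27, 203825, 67082, 28712, 4628758782, 158499, 522875, 37982, 129577137, 187462, 38404]]
    (.split 1 3 1 (10000) cert44 cert53)

def cert55 : Cert :=
  .node [[5, 27, 206361, 274502, 16121929467, 20740, 169316, 10669080575, 121468, 119103, 106792],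
    [7, 26, 190278, 68377, 7388481023, 84092, 7388481019, 325898],
    [17, 26, 435993],
    [27, 26, 392767, 335897, 183110, 249860, 292589819, 7118493183, 81020, 212068, 413194],
    [33, 26, 267545],
    [35, 27, 178728, 250468, 54598, 473860, 114495, 24188, 268569, 2116349951, 120074],
    [4, 27, 271876, 373539, 389642],
    [20, 27, 328995, 416100, 54591, 123743, 175364, 440089, 708064511, 115580, 427786, 439080],
    [22, 27, 188004, 15241969584, 89670, 348479, 3486043366, 39804, 311075, 241945],
    [41, 26, 87135, 309785, 498411519, 87615, 90372, 292964, 81276, 112675, 252426],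
    [43, 26, 301375, 168267519, 104473, 98916, 30468, 29535, 27516, 38179, 85258],
    [47, 26, 373041, 95295, 228422, 246628, 750355707, 198440, 378236, 300067],
    [24, 26, 283944, 2859953072],
    [40, 26, 143400, 336710, 97636, 11720095741, 28735, 56956, 26147, 4313380351],
    [65, 26, 286745, 303656, 53041, 84836],
    [67, 25, 296804, 210728, 36913, 198937],
    [62, 27, 160266, 52068, 19042761924, 141081, 179551, 366143, 6387487999],
    [81, 26, 305418, 61052, 360774, 73988, 159551, 133928, 265316, 116771, 510489],
    [16, 26, 45436, 268102, 34623, 101636, 13934530559, 57700, 132131, 28968, 150026],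
    [18, 26, 25881, 13834, 31558, 17699, 269692, 14084],
    [64, 27, 8495041535, 360316, 343135, 458852]]
    (.leaf [13803407078, 44924, 46627, 190271, 7172, 205352, 265542, 346212, 291338, 524313])

def cert56 : Cert :=
  .node [[35, 26, 476004, 489738, 8679613439, 313348, 18603403003, 8679613438, 284479, 327464],
    [41, 27, 431460, 17245579004, 436234, 246335, 6404, 8995, 239385],
    [43, 26, 78180, 78858, 3119744252, 1284, 1571, 316223, 43289],
    [44, 27, 511558, 221790, 196415, 2523365054],
    [34, 0],
    [64, 26, 368740, 186431, 48252, 525735932, 5120216831, 5120216827, 116550, 158745, 281098],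
    [66, 26, 98148, 179270, 244249, 7873812731, 74108, 808470780, 7873812735, 286783, 432138],
    [1, 28, 38264524794, 225350, 401960, 339722, 77828, 9902292991, 93052, 255807, 109849, 464996],
    [27, 26, 10524112891, 157510, 7462624510, 65148, 255748, 14378375935, 30504, 302911, 145252, 478730],
    [33, 25, 265521, 3609],
    [35, 25, 2087723005, 244008, 144388, 11770748667, 3240108542, 309604, 139071, 1152385791, 269834],
    [4, 26, 310116, 280104, 56089, 46115, 141887, 251697, 338186],
    [6, 25, 320356, 289576, 184089, 56586, 146751, 203057],
    [41, 27, 377188, 405258, 146751, 14508638460, 160793, 1915916282, 1915916283],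
    [45, 26, 297572, 319754, 115775, 755660283, 64281, 16424209405, 755660287],
    [47, 25, 353380, 79370, 39238, 337960, 67353, 2842117118, 155004, 274737, 163135]]
    (.leaf [524388, 414474, 75900, 156456, 19927883517, 260188158, 410950, 215871, 127025, 181017])

def cert57 : Cert :=
  .node [[21, 28, 11679381247, 325695, 448582, 34359738619, 270460, 325732],
    [41, 28, 416778, 393823, 305955, 583986898, 222724, 34359738620, 409468, 493412],
    [43, 26, 91146, 86367, 67107, 429119, 48900, 7523299324, 127868114, 89724, 108132],
    [24, 26, 20234, 9262, 911624442, 9030, 58628, 911624447, 20287, 322088],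
    [63, 27, 48138, 35903, 1436711163, 11841551577, 25860, 132904, 451678, 245628, 7321854973],
    [44, 27, 297023, 2849970642, 503878, 231774],
    [62, 27, 145418, 8136691967, 6101269956, 457055, 8136691965, 231999],
    [64, 27, 409468, 2453907154, 493412, 341343],
    [82, 26, 6353518078, 467516114, 87622, 37982, 41220, 48703, 356220, 56611, 77066],
    [43, 26, 54307, 53343, 6108494844, 348479, 39684, 62530002, 80484, 55164, 73994],
    [81, 28, 305955, 1322631634, 491846, 213342, 222724, 236351, 34359738622, 416778],
    [18, 27, 224803, 266310, 163588, 379417, 441212, 107530],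
    [64, 27, 302687, 790948095, 457060, 312188],
    [41, 28, 431972, 34359738620, 222724, 703987455, 277884, 305955, 269407, 416778],
    [43, 26, 301119, 58724, 4658445052, 30212, 95445759, 37756, 41507, 36703, 56586],
    [82, 26, 31807, 73030, 31838, 31492, 4898478590, 306044, 43043, 808, 58890]]
    (.split 1 0 4 (25000) cert55 cert56)

def cert58 : Cert :=
  .node [[1, 27, 3234669765, 323654, 17148600831, 1636, 1028, 17190468604, 41868027, 249640],
    [5, 27, 324166, 3240567749, 17179869439, 17179869435],
    [7, 26, 11544748795, 217926, 467722, 11544748799, 2177638341],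
    [9, 28, 2814205381, 281414, 17933322751, 32852831996, 294267, 428900, 17933322747, 339806],
    [11, 26, 845466365, 288561, 845466366, 384100, 104708, 295464],
    [13, 27, 1300935933, 1300935931, 448817, 161028, 33058802943, 1300935932],
    [15, 26, 160326, 344074, 18782399173, 8495812351, 8495812347],
    [2, 27, 721853381, 72262, 3805145087, 356, 473348, 3826904828, 275, 55592],
    [21, 26, 324166, 3240567749, 124209, 42244, 49531, 128787, 6538387686],
    [27, 26, 12667, 32787, 311044, 2707369214, 384356, 250417, 307752],
    [33, 27, 6779, 487473, 166148, 1445732862, 17427],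
    [35, 27, 66630, 14203, 3100260095, 439556, 13406, 3532545532, 666329541, 6675, 54056],
    [4, 27, 420362, 274436, 376099],
    [6, 27, 204667, 8035864752, 375587, 15964638149, 449284, 7261934847, 305969, 256326, 145252, 108840],
    [20, 27, 371210, 463950768, 347683, 227076, 12085731839, 35934, 203846, 12085731836, 180520],
    [22, 27, 23303974341, 16088998064, 326779, 237859, 370737, 190534, 290916, 217640],
    [10, 27, 10515, 34584060848, 11043, 452868, 3284029183, 7774, 70982, 3284029180, 48168],
    [61, 27, 6432217520, 87931, 229395, 75268, 256305, 15407760358, 463912],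
    [63, 27, 8026235568, 209427, 68612, 513374, 199976],
    [65, 26, 54651, 3091, 1059, 31492, 54110, 262705, 6470, 296620284, 257064],
    [67, 26, 285307, 1802, 119345, 16644, 284510, 3107, 11334, 367927036, 115752],
    [12, 26, 198922, 3240567749, 121604, 146211, 324166],
    [14, 26, 2995060144, 38440, 275978, 426033, 393476, 21607498239, 183931, 55652, 283683, 514630],
    [44, 26, 324166, 3240567749],
    [46, 25, 16420483071, 7976, 261130, 586855420, 159748, 267334, 263473, 109860784, 99107, 90491],
    [60, 27, 179038, 239626, 490822, 266596, 146436, 15595841276, 59441, 15581604037, 155171, 200827],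
    [81, 25, 304650, 419654, 6288234949, 299012, 121393, 316451, 306195],
    [83, 26, 195850, 254534, 5239012805, 167940, 68145, 191251, 177699, 285819],
    [16, 27, 228904, 315146, 241222, 332388, 192772, 21740394437, 17914781360, 14123850239, 194171],
    [34, 26, 195368, 283748, 204849, 15290597296],
    [48, 27, 34359738623, 13825933509, 476486],
    [64, 27, 259195, 303710, 7342979839, 443748],
    [66, 26, 274737, 246312, 61563, 139274, 69923, 135955, 328548, 6346497477, 119300, 147782],
    [1, 25, 32778, 502312, 393521, 438110, 370788, 2263890373, 25158, 434811, 60420, 160787],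
    [3, 26, 367114, 67619, 360241, 39524, 2679301296, 20278745599, 22196388805, 169851, 29224, 320838],
    [5, 27, 11812524741, 145969, 366611, 43299, 9293017343, 92164, 56699, 501830],
    [7, 26, 284682, 1859797957, 201235, 197446],
    [9, 25, 188426, 219171, 102193, 96356, 284435, 85854, 221700, 113019, 5074980037, 259398],
    [13, 27, 30986, 11591906303, 182065, 359187, 54051, 114948, 70779, 53318],
    [15, 27, 487946, 316435, 39601512901, 338502],
    [17, 25, 243722, 289059, 134961, 309779, 6308640709, 292612, 52347, 339014],
    [19, 26, 347402, 128547, 59953, 130052, 244499, 22202621125, 249467, 316486],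
    [2, 26, 40458, 62243, 61203, 391645381, 276228, 64582],
    [21, 27, 13825933509, 421907, 121905, 114788, 7804763312, 128260, 134523, 84776, 476486],
    [23, 27, 498698, 367123, 2348521157, 78115, 493828, 387398],
    [27, 26, 423690, 196131, 268081, 252516, 26490537669, 312083, 419844, 296059, 186664, 398406],
    [33, 26, 149770, 69411, 269873, 9360450245, 110355, 148228, 104827, 140870],
    [35, 26, 343562, 159011, 52529, 21469019589, 252947, 340228, 239995, 322886],
    [4, 27, 408099, 373002, 285956],
    [6, 26, 119115, 18246, 133937, 2660, 264995, 1311071743, 215812, 219517616, 527559109, 2088],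
    [20, 26, 501795, 304966, 1849194693, 289043, 351492, 364554],
    [22, 27, 490787, 350769, 19556, 348747, 1695283632, 15144],
    [45, 27, 248355, 7500740805, 445233, 22966971647, 282116, 390154, 98939, 9726473702],
    [63, 27, 388627, 37596894917, 436038, 54563, 34359738544, 472836, 490250],
    [65, 27, 41235, 41798, 467761, 4199964869, 15929908400, 56670, 50180, 51978, 103803, 518952],
    [67, 27, 188691, 191046, 19239392453, 21639947696, 259422, 229380, 237834, 475515, 134184, 103985],
    [12, 27, 313123, 506438, 14698180805, 236804, 327434],
    [14, 27, 374907, 176419, 378980, 428593, 7458346239, 31753854896, 275240, 491012, 82186, 203334],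
    [81, 25, 25979, 117041, 146195, 190499, 7780416197, 168964, 184842, 296774]]
    (.leaf [375930664, 457840251, 464324166, 517388644, 342066737, 414736147, 43375271662000, 478965508, 524288010, 55706915, 40313058208709])

def cert59 : Cert :=
  .node [[15, 23, 247931, 434984, 224019, 259940, 10170426032, 330334, 179505]]
    (.leaf [249166355, 333817211, 524288040, 16624673081008, 350111332, 64420612, 361865822, 241608753])

def cert60 : Cert :=
  .node []
    (.leaf [9030, 4958, 25610, 282648792, 11851, 601981927, 17939, 253667031])

def cert61 : Cert :=
  .node [[1, 28, 1058199804, 189219, 186206, 236644, 146436, 27679515390, 183878, 43302020863, 300584],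
    [7, 26, 2867111102, 80734, 102500, 12439538683, 6771235839, 260, 79686, 343050, 81960],
    [11, 26, 101636, 384100, 1024374270, 280369, 1024374269, 292904],
    [13, 27, 1563879933, 155140, 432689, 32795858943, 1563879931, 1563879932],
    [2, 27, 146076924, 26147, 25694, 32868, 493316, 3820951546, 25414, 2156570879, 41512],
    [27, 26, 188977, 384100, 297732, 2999620094, 2999620093, 264232],
    [33, 27, 5470, 1627985916, 163844, 47093501, 480305, 1627985915, 4731, 24104],
    [4, 27, 307491, 230404, 388362],
    [20, 27, 250122, 125790, 251939, 79972, 141060, 54907, 61766, 5805881855, 11923334396, 282152],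
    [22, 27, 327755, 419363, 66148, 331313, 3585172144, 49448],
    [10, 27, 182622, 106019, 9296375295, 61819, 461316, 787064004, 159281, 96070, 25119187632, 88104],
    [65, 27, 113246, 1004578301, 367903739, 98171, 86276, 506417, 367903740, 511272],
    [12, 27, 409438, 250403, 343306, 193796, 404294, 359999, 38184],
    [14, 27, 3379337668, 454691, 16758651135, 111227, 461316, 287025, 412742],
    [44, 27, 409438, 1038444539, 36427, 13412, 26417, 404294, 347455, 53288],
    [60, 27, 26634, 317475, 395876, 293380, 2195137788, 116273, 325958, 5305170686, 313694],
    [81, 27, 8814840830, 278819, 419377, 241252, 312324, 271686, 263006, 42250, 317224],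
    [83, 27, 576855294, 144419, 87345, 34344, 139268, 2230776572, 157510, 7774, 399995],
    [34, 26, 14470477744, 202033, 268388, 192552],
    [48, 28, 28156110014, 271942, 330340, 25562170623, 263006, 427595],
    [50, 26, 1563291131, 201256, 172358, 152932, 104452, 16193360895, 166750, 185098, 324913],
    [64, 27, 7356939263, 403044, 321118, 248187],
    [66, 26, 247848, 592124924, 321892, 58628, 592124923, 236081],
    [1, 27, 9283178492, 359006, 116294, 246116, 7637514491, 106531, 504616, 256787, 152699],
    [5, 28, 20246684671, 307038, 183878, 231012, 48472792571, 71459, 339240, 198731, 99963],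
    [7, 26, 10516864763, 97630, 100934, 73572, 9492041727, 108072, 277514, 42801],
    [9, 27, 8836451068, 268638, 209478, 268132, 153348, 5870280443, 191779, 328211, 2683],
    [11, 27, 396072, 829974268, 520036, 382257, 829974267, 96004],
    [13, 26, 54622, 285459, 41060, 32049, 3588, 60200],
    [15, 26, 332126, 21252, 249956, 195121, 366888, 190227],
    [2, 27, 43620, 61278, 68422, 497924, 969323260, 62755, 78888, 96787, 704818430],
    [27, 27, 2427, 522084, 505092, 4249890558, 386344, 58643, 286769],
    [33, 27, 9566, 3091, 24104, 180996, 1405723644, 453169, 1405723643, 7547],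
    [35, 27, 61534, 68166, 31844, 476420, 1349517308, 87059, 74792, 62499, 383339771],
    [4, 27, 233220, 299043, 365578],
    [20, 27, 110180, 295459, 106259, 7389008068, 137732, 7960982524, 218634, 236126, 85371, 315944],
    [22, 27, 617902000, 433699, 8548, 301361, 314187, 6184],
    [41, 28, 474378, 149267, 370811, 471140, 344068, 23863104508, 353571, 144177, 472158],
    [43, 27, 307263, 234596, 221188, 3699071483, 238627, 127537, 76072],
    [61, 27, 17531, 44337, 16644, 2770956543, 435475, 10335372464, 461352],
    [63, 26, 3314507696, 297566, 135443, 5124, 130344],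
    [65, 26, 91486, 15123, 266801, 20740, 83835, 270888],
    [67, 26, 572731824, 293982, 48403, 85553, 1796, 268923, 128808],
    [14, 27, 10873114032, 4909201092, 232262, 155748, 449540, 7516754943, 280355, 288561, 230011, 106024],
    [44, 27, 89896, 420422, 10852, 7428, 124937979, 346206, 89675, 90161, 270399],
    [60, 27, 157745, 401990, 343075, 364644, 335620, 7202358012, 306014, 26122, 17704],
    [62, 25, 256040, 265083, 249700, 23044, 5395, 165470, 261169],
    [81, 25, 486184, 408699, 495921, 43780, 10259, 480094, 347236],
    [83, 26, 90152, 311163, 91953, 8196, 1811, 89182, 64612],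
    [16, 27, 461352, 279931, 405604, 356190, 11298311935, 10335372464],
    [18, 27, 325169, 104979, 449540, 89694, 358952, 2214006212, 458852, 66630, 88867, 27496899504],
    [34, 27, 325169, 32024111792, 312360, 458852],
    [48, 27, 111153, 55827, 336715, 157534, 159528, 114020, 193862, 13861307903],
    [64, 27, 279931, 356190, 405604, 11298311935],
    [66, 27, 397617, 390184, 27998, 12307, 21883, 52740, 511076],
    [1, 25, 212859, 1759333119, 95251, 270942, 272424, 190001, 181604],
    [5, 26, 244603, 396593, 376414, 241171, 378920, 55812, 80454, 170315, 252260],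
    [7, 27, 409107, 48459, 258398, 181297, 260136, 318278, 416266, 173156],
    [9, 25, 214139, 183592, 120595, 272478, 192305, 27140, 216932],
    [13, 27, 379, 479251, 21334015, 260, 305],
    [15, 26, 169265, 139539, 12835, 276574, 278312, 27467, 25610, 185444],
    [25, 25, 342139, 319272, 407134, 277297, 23044, 162067, 307300],
    [27, 23, 249211, 201777, 118035, 296542, 328232, 16900, 223588],
    [33, 26, 356475, 399656, 168979, 424286, 460337, 24068, 226916],
    [35, 25, 305787, 144915, 363870, 342568, 20484, 194404, 173361],
    [63, 27, 11646662320, 509278, 274984, 35844, 251667],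
    [65, 26, 71803, 269105, 87390, 3607094960, 285992, 2702779366],
    [67, 26, 259707, 158769, 316510, 2129111984, 168744, 9791672550],
    [14, 26, 280187, 238897, 76638, 20381864624, 253992, 421943807, 224772, 291172],
    [60, 25, 2555647664, 277598, 190513, 227707, 237924, 202536],
    [62, 27, 498043, 520292, 5586941104, 442920, 83806, 416561],
    [81, 26, 438568, 277115, 224868, 5531161264, 369246, 412465],
    [34, 27, 343080, 468836, 38688662192, 322865],
    [66, 27, 340264, 464740, 3993001392, 320817]]
    (.split 1 0 1 (-28000) cert59 cert60)

def cert62 : Cert :=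
  .node [[9, 28, 22906492411, 22906492412, 21169572562, 22906492415, 288350, 359268, 242811],
    [27, 26, 71178, 1368189435, 65343, 284676, 5192226045, 178728, 423268, 5192226046],
    [41, 28, 407050, 34359738620, 298787, 2421747455, 217604, 402014, 500836, 338555],
    [43, 26, 14090, 5246084860, 115235, 298047, 83716, 131172],
    [8, 26, 50954, 1696331454, 33087, 27396, 280360],
    [24, 26, 586608382, 6207, 35076, 586608381, 361000, 51812, 311654907, 9482],
    [44, 27, 503110, 293214, 257087, 1390930622],
    [16, 27, 2186982399, 259195, 4678, 310110, 45316, 464936, 463972, 85323, 84746],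
    [18, 27, 13882028504, 499972, 6825903614, 214312, 511588, 32925582000, 6825903613],
    [34, 0, 472, 432],
    [48, 28, 273758, 497734, 23388930494, 359499, 340836, 36123791871],
    [64, 27, 338555, 2421747455, 402014, 500836],
    [82, 27, 152369, 17551662040, 2672017659, 307068, 43012, 392030, 80394, 3002290173, 52031, 143400],
    [1, 28, 24401289726, 37380, 45336684031, 67172, 20935394514, 383016],
    [5, 28, 27467, 450630, 247902, 32708862975, 5380, 34660, 200511, 36133550843, 55848],
    [2, 27, 7458737663, 4014471422, 506116, 11108, 3444266450, 63016],
    [27, 26, 161576, 344676, 4418414078, 251396, 137994, 4418414077, 4582990331, 89151],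
    [35, 27, 612, 3563302655, 473348, 3583990522, 3563302610, 56360],
    [43, 27, 167268, 160035, 110340, 43786, 491583, 8653396732],
    [8, 26, 42362363, 1028, 1034, 868, 831, 270120],
    [24, 26, 319, 16841469, 16841470, 1028, 522, 1380, 270376, 20862971],
    [63, 26, 6113724671, 344158, 380, 260, 6125544957, 88616],
    [65, 26, 449841, 1802, 503017726, 43012, 503017725, 1087, 240680, 65827835],
    [12, 27, 212543, 489286, 285731, 197124, 389386, 21544, 236638],
    [81, 28, 212543, 489286, 285731, 34359738622, 197124, 389386, 21544, 236638],
    [16, 27, 306782, 1551916543, 291, 2052, 4106, 457572, 3915, 493352, 293499],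
    [18, 26, 264753, 157188, 99609, 251236, 9566577328, 184104],
    [34, 26, 261416, 356452, 13576528816, 521265],
    [64, 27, 310366, 1570643199, 297083, 459620],
    [82, 27, 392497, 220028, 5698898429, 6912678907, 94724, 355678, 187146, 371044, 108863, 351528],
    [9, 27, 205662, 8849976571, 8849976572, 196731, 322916, 7809809918, 8849976575],
    [11, 27, 772, 4165395965, 4165395966, 16164488443, 437258, 508772, 254271, 234024],
    [13, 26, 345905, 16247839231, 932030459, 82180, 932030461, 932030460],
    [15, 27, 228732, 11002860283, 516, 5670611709, 317022, 297738, 196196, 173119, 159272],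
    [17, 28, 168185085, 34212572156, 1796, 168185086, 34212572155, 3940, 495144],
    [33, 26, 376625, 507297788, 89604, 507297789, 507297790, 507297787],
    [20, 27, 118878, 601830911, 168739, 14943126012, 118020, 114043, 229898, 190052, 431912],
    [22, 27, 262961, 380707, 129855, 208971, 75364, 10909946800],
    [65, 27, 3684, 479793, 1313289726, 115972, 1313289725, 480552],
    [83, 27, 178246, 132899, 47153, 6436406782, 113412, 69130, 497787],
    [18, 27, 313137, 333316, 161049, 520804, 18682232752, 398120],
    [34, 26, 260648, 341092, 12231063984, 282673],
    [64, 27, 2566125798, 250491, 454756, 289374],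
    [66, 26, 1464774141, 376872, 129284, 1464774142, 496996, 356401]]
    (.split 1 2 1 (20000) cert58 cert61)

def cert63 : Cert :=
  .node [[1, 29, 220742, 160319, 16901769130, 226094, 482088, 91625969151, 45812984830, 23135630034],
    [2, 27, 22854, 16703, 1753585322, 23598, 49960, 9506339071, 4753169662, 2400358354, 522244],
    [8, 26, 2177115838, 113162, 312616, 103999, 60420],
    [10, 27, 38691, 48478, 8545321983, 1667648252, 3438837246, 66630, 103976, 31039529392, 499972],
    [24, 26, 23622, 4854633215, 55044, 119103, 4130, 357928, 24366, 103178, 2427316734],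
    [61, 28, 3352203454, 34359738623, 93188, 481320, 34359738621, 174346, 160063],
    [63, 26, 36988, 5530198783, 25860, 384606, 133928, 6848524029]]
    (.split 1 3 1 (0) cert57 cert62)

def cert64 : Cert :=
  .node [[23, 27, 5953611002, 59438, 5953611007, 57926, 68874, 496644],
    [4, 27, 483850, 386595, 294148],
    [8, 27, 324899, 34359738558, 423434, 247044],
    [42, 26, 1702842308, 347712, 6738198783, 168286, 131082, 6738198780],
    [12, 27, 324899, 325695, 325726, 423434, 448582, 247044],
    [81, 28, 448582, 34359738622, 324899, 325695, 325726, 423434, 247044],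
    [83, 26, 105798, 5021276926, 86307, 281467, 32522, 65796],
    [16, 27, 390982, 324899, 299339, 8455796966, 423434, 283772, 247044],
    [82, 26, 99910, 7655448830, 94474, 72511, 72542, 72483, 429180, 55044],
    [15, 27, 231743, 180490, 231774, 520060, 9276404222],
    [4, 27, 423434, 324899, 247044],
    [62, 26, 5726623229, 1967775428, 102410, 5726623231, 286047, 143167],
    [18, 26, 198470, 158499, 58890, 305945, 264316, 120324]]
    (.split 1 1 1 (-20000) cert54 cert63)

def cert65 : Cert :=
  .node [[7, 27, 3856653764, 208966, 247932, 9925460219, 506658],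
    [2, 27, 7458, 492036, 56390, 57646, 5783078143, 5783078138, 59658],
    [4, 27, 354594, 511242],
    [20, 27, 272930, 169768, 129862, 94302, 9945533695, 9945533690, 506378],
    [41, 28, 263714, 34359738578, 34359738620, 34359738598, 374794],
    [43, 0],
    [8, 26, 4920339390, 324672, 291594],
    [10, 26, 6166549444, 117062, 238942, 15131308799, 15131308795, 253504, 513546],
    [24, 25, 806813118, 10846, 1127466746, 284968, 1127466751, 14662, 49728, 57354],
    [26, 26, 6166549444, 253504, 117062, 15131308799, 15131308795, 238942, 513546],
    [42, 26, 50978, 6630414020, 351296, 6630414079, 165726, 6630414076, 72458],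
    [61, 27, 17179869414, 17179869437, 9352103870, 207424, 291594],
    [63, 26, 1780525311, 312414, 1780525307, 4676263933, 116860, 2703572670, 99392, 139786],
    [67, 26, 15131308799, 170846, 15131308795, 190278, 4067181764, 161088, 513546],
    [12, 26, 260422, 134750, 3047100350, 46400, 291594],
    [14, 26, 15131308799, 15131308795, 7928007620, 318278, 513546],
    [44, 27, 521030, 269406, 9257129406, 189247],
    [81, 27, 4182486013, 331334, 160606, 40768, 15088626430, 326922],
    [34, 26, 4850060029, 2557604095, 4850060028, 2557604091, 413510, 126995, 429180, 336650],
    [64, 26, 453988, 1319906043, 1319906047, 2218856188, 162118, 74003, 196476, 131850],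
    [66, 26, 120610, 16032315135, 13375158011, 420422, 427572474, 220721, 286076, 513546],
    [82, 26, 5425, 94730, 4642, 108358, 502652, 5574571518],
    [1, 27, 18248591098, 13312005887, 262154, 47656, 12834, 43108, 120956, 299846],
    [5, 26, 13996287487, 256522, 15432003323, 1435716090, 127100, 315206],
    [7, 27, 296036, 384561, 325666, 401216],
    [2, 27, 5484792830, 99082, 10175240959, 492548, 167932667, 42620, 105798],
    [21, 27, 50240, 81162, 382308, 19565550075, 17673043902],
    [23, 27, 12936300285, 36672, 4039243259, 130052, 519458, 279908, 117628, 291398],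
    [27, 27, 93194, 5152045310, 9557936895, 462596, 157744635, 40060, 99398],
    [33, 27, 139810, 22063600635, 279306, 312113],
    [35, 26, 3678, 261732, 182794, 292136, 181508, 13910326011, 88098, 519769855, 7494],
    [4, 26, 84032, 292618, 234536, 208433, 78370, 274020],
    [6, 25, 7714, 339210, 482856, 25604, 23005609979, 432740, 5982, 859621887, 12102],
    [20, 24, 901301247, 10161968635, 100642, 506408, 6238, 12870, 453732, 207409, 163338]]
    (.leaf [23279276799, 832, 505610, 42024, 38756, 524358, 283441, 211324, 10948694523, 90658])

def cert66 : Cert :=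
  .node [[1, 28, 22906492330, 22906492415, 249919, 332870, 22906492410, 249950],
    [5, 28, 374591, 34359738619, 499270, 34359738623, 374622],
    [2, 26, 36671, 3356316586, 3356316670, 48966, 6712632831, 36702, 331012],
    [23, 26, 8408146941, 4617, 210044, 8399961514, 216902, 10301563076, 210014, 276228],
    [42, 0, 452, 469],
    [44, 27, 374591, 499270, 374622],
    [16, 21, 297994, 524656127, 380, 4927, 7238, 4958],
    [18, 26, 3337719748, 214563, 180806, 429180, 8589934846, 137988],
    [48, 27, 34359738598, 448582, 325695, 325726],
    [7, 27, 8347784444, 16695568836, 430656, 208478, 208508, 243234],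
    [2, 26, 36678, 26687, 2799987454, 5599974655, 26718, 2799987370, 276228],
    [23, 26, 469026, 169542, 3129872836, 201340, 8055021051, 122372],
    [27, 27, 1040407250, 35910, 25919, 5134867455, 2741980330, 5134867450, 81710, 506372],
    [31, 26, 1024377087, 6068082173, 303198, 126076, 272936, 233220],
    [35, 27, 5295205375, 681915562, 36934, 5295205370, 26915, 26974, 2467173842, 159272, 522244],
    [10, 26, 6340923878, 158499, 4498022397, 211264, 270686, 1842901756, 96260],
    [12, 24, 129320, 21539, 2001136850, 314122, 21854, 30022],
    [28, 26, 516648, 2212420266, 87075, 8004547282, 87134, 119878],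
    [7, 26, 2327782596, 300066, 5990766843, 149628, 126022],
    [15, 26, 257576, 143228, 5726623229, 286046],
    [23, 26, 5990766843, 2327782596, 149628, 126022, 300066, 91140],
    [22, 0],
    [83, 26, 268554, 6578700286, 328827, 138566, 89379, 67844]]
    (.split 1 0 1 (0) cert64 cert65)

def cert67 : Cert :=
  .node []
    (.split 1 2 1 (-10000) cert43 cert66)

def cert68 : Cert :=
  .node [[31, 26, 6328964010, 6328964030, 6328964093, 6328964095, 316254, 331012]]
    (.split 1 4 0 (0) cert24 cert67)

def cert69 : Cert :=
  .node [[13, 27, 34359738623, 34359738619, 183330, 368650],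
    [17, 28, 29057535738, 39661941499, 211746, 425482],
    [33, 27, 183330, 34359738619, 368650],
    [6, 26, 13696812543, 161094, 123230, 13696812539, 4460703166, 401162],
    [24, 27, 362537, 301858, 255808, 7582997694],
    [83, 26, 6588052477, 6588052479, 17179869401, 363614, 40226, 6588052414, 67338],
    [34, 0],
    [64, 25, 152699643, 2886, 127309488, 8566725, 3362, 430180, 299, 7036, 2314],
    [11, 26, 7576458747, 1350, 522, 301858, 255040, 299, 3196, 192612],
    [19, 25, 10303079931, 197190, 16939, 578007749, 225826, 474748, 151818],
    [4, 27, 209698, 351242],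
    [6, 26, 14748619771, 208198, 10151649791, 46377, 35362, 77918, 211836, 359434],
    [20, 27, 181318, 150569, 337186, 4125471484, 15405964287, 77081, 138590, 103730, 346378],
    [67, 26, 193862, 203545, 8604681392, 154146, 2720273663, 386940, 43786],
    [60, 26, 8689702651, 205382, 111922, 75049, 278709247, 302180, 157022, 218658, 130826],
    [62, 26, 95010, 46352, 142898, 4757576447, 1362447613, 6380305598, 55104, 260958, 292988, 43786],
    [81, 27, 34743251195, 388166, 5170, 13924, 90945, 171561, 253278, 469026, 507146],
    [83, 24, 24414, 77346, 3287163899, 27945, 10084, 70982, 36402, 304252, 47882],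
    [64, 26, 65630, 8906353407, 84530, 100678, 80162, 264548, 497334456, 22794],
    [66, 26, 62986, 27314938623, 400178, 308550, 266018, 201310, 21056, 134416],
    [6, 26, 66866, 11419664895, 44322, 239942, 9198194427, 135804, 300810],
    [20, 26, 15043001855, 265266, 225802, 7268, 295494, 362530, 15710, 153468, 19241],
    [22, 26, 14686, 246322, 17705, 6756, 30498, 274246, 13971872767, 142716, 209930],
    [41, 26, 3332429055, 37938, 24670, 281956, 37702, 278562, 16778145531, 576, 302090],
    [45, 26, 14922855677, 35634, 265572, 2257014015, 141090, 19776, 138762],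
    [47, 26, 22937226749, 54834, 408164, 475718, 217122, 30272, 3469150975, 213002],
    [8, 27, 34359738558, 249634, 300298],
    [24, 26, 162058, 32041, 25182, 16435941566, 185394, 296994, 10797124351, 107900, 206406],
    [26, 26, 188682, 35378, 216105, 12561777915, 263268, 15650, 102721],
    [65, 27, 204298, 20093445054, 14266293757, 344882, 420898, 200572, 319302],
    [67, 25, 120074, 157737, 7834581245, 314468, 237602, 11935240187, 110204, 175430],
    [14, 26, 5732, 569035775, 16681, 14942, 95302, 82210, 92978, 316028, 8458],
    [44, 27, 132220, 383266, 29361635262, 433508, 200542, 95529, 412210, 487238]]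
    (.leaf [524358, 298034, 313444, 450082, 464915, 95612, 159504, 121098])

def cert70 : Cert :=
  .node [[15, 26, 308806, 291106, 32522, 270355],
    [6, 26, 106054, 118622, 10962920447, 4876176830, 10962920443, 321290],
    [20, 27, 104262, 402014, 6768770261, 258345, 328723, 334114, 334346],
    [45, 26, 327443, 128350, 65577, 40769, 92706, 188938],
    [47, 26, 276550, 225555, 62498, 174346],
    [24, 27, 113222, 237150, 230931, 249897, 28123422142, 308002, 235018],
    [42, 26, 270657, 174430, 80906, 104723, 28962, 5761492693],
    [65, 27, 39238, 51038, 30165889019, 56617, 28488315326, 4193849853, 442914, 509962],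
    [67, 26, 58694, 4515458494, 264547, 158761, 251185, 33802, 33043, 90402, 51579],
    [14, 26, 9871569342, 397406, 210497, 16366000379, 35881, 16366000383, 27170, 426506],
    [44, 27, 320838, 416350, 12461017278, 239937],
    [60, 26, 417374, 18034211541],
    [62, 26, 143906, 434195, 20941107902, 516702, 132649, 183562],
    [81, 26, 178985, 98630, 103714, 554337787, 267313, 3859149013, 213598, 21372],
    [34, 25, 221481, 113788, 1110284027, 10561, 201747, 268126, 2568146133, 19466],
    [48, 28, 212550, 24769886207, 244835, 472396, 226910, 26458969534],
    [50, 26, 162835, 385585, 167465, 349772, 229666, 63041, 221790, 122748, 165642],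
    [64, 27, 7920626389, 237155, 376414, 310604, 117062, 403475, 135202, 291082],
    [15, 26, 5470, 231187, 7244, 272710, 14385, 6755, 281634, 746387646],
    [21, 27, 189971, 155230, 21060157374, 203340, 79686, 406065, 7428, 191075, 73738],
    [25, 27, 15329409749, 346899, 431710, 326, 168524, 9250, 336433, 158307, 160778],
    [27, 26, 307234, 18949809342, 339806, 18180, 174406, 415763, 158218],
    [33, 26, 12834, 13150, 874184894, 9571, 6726, 276529, 7465, 15891, 7434],
    [35, 25, 285218, 289630, 19527194302, 214371, 148550, 201265, 166185, 354323, 164362]]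
    (.leaf [7301666, 3497315, 10122801, 7688012, 14401577, 29427136958, 12851550, 15728659, 6593350, 7294218])

def cert71 : Cert :=
  .node [[13, 27, 4381471444, 523539],
    [15, 26, 322630, 269331, 304162, 33802],
    [27, 26, 285510, 269090, 29444, 17179869396, 228115, 29962],
    [35, 26, 200774, 254001, 289314, 12079657172, 11049, 160531, 15430669758, 280419, 168970],
    [6, 27, 308038, 17700852731, 17700852735, 14885585108, 518666],
    [20, 27, 265286, 322579, 252510, 495394, 13148524208, 123945, 347658],
    [45, 27, 1238021076, 518675, 110145, 92766, 177698, 403466],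
    [47, 26, 289606, 214547, 73506, 166666],
    [51, 26, 274737, 349510, 321123, 288297, 258323, 162082, 23747442900, 136458],
    [24, 27, 213318, 157715, 277026, 8554493374, 14487480532, 402729, 55562],
    [42, 27, 92284, 8861649840, 105310, 26378, 149538, 124515, 129585, 24339, 394817],
    [65, 26, 49020, 57670, 30995, 71714, 267825, 1849064894, 7451044820, 217129, 11018],
    [67, 26, 3713315284, 54598, 2192619454, 14346, 70946, 253745, 40467, 210729, 328035],
    [14, 0, 468],
    [44, 27, 332609, 4521363134, 436038, 356190],
    [34, 27, 21889318064, 495454, 7688851451, 198441, 78401, 454524, 109843, 139018],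
    [48, 27, 82466, 120617, 405068, 163683, 13063143380, 239942, 196371, 12042],
    [50, 27, 219441, 487774, 108307, 100905, 102732, 447356, 409153, 130850, 116490]]
    (.leaf [15728689, 135000951764, 5317726, 6289193, 10518306, 11209036, 5319011, 9217606, 9874963, 10640650])

def cert72 : Cert :=
  .node [[13, 27, 34359738623, 34359738619, 183330, 368650],
    [17, 28, 39661941499, 29057535738, 211746, 425482],
    [33, 27, 183330, 34359738619, 368650],
    [6, 26, 13696812543, 13696812539, 161094, 4460703166, 123230, 401162],
    [24, 27, 255808, 7582997694, 301858, 362537],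
    [18, 0, 472],
    [82, 26, 27281784831, 475718, 25188, 595384752, 18497, 363042, 489497, 141066],
    [9, 28, 495740, 22906492412, 22906492415, 303459, 257118, 22906492411, 24347373522],
    [2, 27, 82758, 7022230267, 397828, 37673, 7022230271, 63070, 108066, 93450],
    [35, 27, 118854, 66171, 346116, 135458, 5383815935, 6817577723, 100874],
    [4, 27, 209698, 351242],
    [6, 26, 148294, 12600944383, 4103806910, 113246, 12600944379, 363786],
    [47, 26, 357190, 174716, 16695513343, 75554, 322353, 242698],
    [14, 26, 6588052477, 6588052479, 5305001918, 363614, 48449, 95754],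
    [62, 26, 363614, 6588052477, 6588052479, 6588052414, 40994, 66058],
    [83, 27, 152670, 451451, 60771, 131113, 138801, 85282, 3409275643, 75078, 49674],
    [18, 25, 177502, 350588, 20545, 76841, 58658, 1217505726, 7606876155, 20806, 110602],
    [50, 26, 27206, 232798, 84521, 460156, 168226, 3569242363, 117785, 124737],
    [64, 26, 171102, 227683, 1869805010, 371836],
    [82, 26, 162630, 426620, 133913, 53002, 151074, 1950282491],
    [15, 26, 367174, 329265, 30844, 20254621439, 313634, 75530],
    [6, 26, 133190, 103518, 11341665791, 3750076862, 11341665787, 329738],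
    [20, 27, 166470, 129374, 9236718331, 4942560764, 14179278847, 395042, 158505, 415498],
    [45, 26, 264467, 90914, 667529727, 31553, 667529725, 41566, 193034],
    [47, 26, 354630, 299283, 97826, 211210],
    [24, 27, 164934, 153694, 7316311037, 7316311039, 21176991934, 292898, 188201, 214282],
    [67, 26, 62022, 140073, 2568891645, 209201, 37642, 3478144190, 80930, 41339, 296291],
    [44, 27, 387142, 360542, 274241, 5794859710],
    [60, 26, 163910, 277854, 106108, 49674, 94769, 176674, 3398275835, 141667, 8491390640],
    [81, 27, 361542, 329822, 151361, 736579504, 503306, 34359738619, 149545, 464930],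
    [48, 28, 275782, 251742, 474444, 25415922366, 26206026495, 299619],
    [64, 27, 340318, 405091, 9306317823, 277884],
    [82, 26, 47174, 43102, 19777, 19497, 96096688, 65802, 4482684155, 265084, 60706]]
    (.split 1 3 0 (30000) cert70 cert71)

def cert73 : Cert :=
  .node [[7, 0, 429],
    [11, 26, 3773326331, 286242, 153694, 2378820604, 6152146687, 6152146629, 220224],
    [13, 25, 8589934847, 8589934843, 290, 269322],
    [15, 26, 4962736639, 286242, 99142, 4962736635, 13340808901],
    [2, 27, 9244583679, 45322, 33570, 4622291966, 52038, 50526, 50473, 488452],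
    [29, 26, 804205567, 804205565, 293651, 20062],
    [31, 26, 4962736639, 4962736635, 286242, 13340808901, 99142],
    [33, 25, 269322, 8589934843, 290],
    [4, 25, 269322, 290],
    [6, 27, 288522, 14555386565, 382302, 274451, 395072],
    [20, 26, 284938, 63326, 5793695226, 63273, 65350, 5793695231, 88354],
    [41, 28, 506378, 34359738582, 34359738620, 83234],
    [43, 27, 397632, 225802, 360798, 11051, 15906, 13184257477, 247059],
    [8, 27, 506378, 83234, 34359738558],
    [24, 27, 340258, 326976, 504873, 3153399486],
    [26, 0],
    [42, 0],
    [61, 28, 322314, 34359738623, 53026, 66345, 34359738621, 21876327102, 133904],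
    [14, 26, 7775155711, 146473, 7775155709, 429150, 96516],
    [44, 27, 390494, 8231389886, 403526, 223297],
    [62, 26, 429150, 72970, 7775155711, 4950324414, 15145, 12066, 7775155709, 30224],
    [81, 27, 265566, 457738, 3952311728, 286242, 21521818619, 181289, 336198, 6418960382],
    [83, 27, 307550, 134922, 1982505982, 22306, 495483, 209961, 9156991483, 120068],
    [16, 27, 326494, 289546, 34359738623, 183586, 170537, 413254, 105025],
    [66, 27, 301662, 254770, 407586, 325440, 253053, 10250068966, 110406],
    [1, 28, 244062, 25671668735, 4065950460, 205346, 243241, 69386, 308806, 21605718522],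
    [11, 27, 301662, 1243309030, 380194, 325440, 1243309051, 223531, 66630],
    [2, 27, 32094, 3369246463, 28194, 3369246458, 21801, 16906, 40518, 468740],
    [6, 26, 116574, 12250115839, 12250115835, 125504, 401418, 147526],
    [20, 27, 244002, 8694249214, 97833, 98142, 19024656895, 1636158972, 124230, 446730],
    [4, 27, 156194, 410634],
    [6, 26, 96862, 301578, 10176482043, 10176482047, 104256, 122438],
    [20, 27, 1483583228, 7883489274, 88873, 262690, 9367072255, 112710, 89182, 389642],
    [43, 27, 7746865403, 53547, 63522, 11440160197, 7746865407, 325440, 301662, 226826],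
    [12, 27, 170537, 239138, 105025, 413254, 326494, 195082],
    [44, 27, 413254, 326494, 5991165630, 220225],
    [81, 27, 25153, 404038, 198441, 34359738619, 308830, 475682, 503050],
    [48, 27, 34359738623, 404038, 308830, 5665868222, 208449]]
    (.split 1 3 1 (35000) cert69 cert72)

def cert74 : Cert :=
  .node []
    (.leaf [13331, 6244, 5982, 392592891, 11078, 646057662, 1101, 25634])

def cert75 : Cert :=
  .node []
    (.leaf [327814221, 53563974, 524288034, 130742059, 208865040, 12326678823931, 228074521, 125287428, 154087012, 112658270])

def cert76 : Cert :=
  .node [[81, 26, 520482, 180294, 778896082, 201025, 180062, 28420, 17179869435],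
    [83, 26, 341860, 48930, 10329609433, 131856, 4161, 317790, 3069009854, 11856784637, 2564],
    [48, 27, 255302, 7619125478, 368508, 385357],
    [50, 25, 15161263355, 459298, 25092, 260173],
    [64, 26, 1964958694, 177277, 131422, 354148],
    [1, 26, 92486, 8417862143, 100417, 8895012091, 269602, 3149, 92510, 14852, 7012],
    [9, 26, 34374, 108382, 60285, 18796456443, 68395, 383266, 305764, 80205],
    [19, 26, 274758, 7588364283, 338466, 458620, 100139],
    [20, 27, 838, 2841, 1404, 523554, 2893, 28676, 25504255],
    [41, 25, 68173, 54366, 10532332283, 52267, 371234, 152932, 3076, 31814],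
    [42, 26, 10000334075, 299298, 15364, 145252, 64589, 297025],
    [67, 26, 248646, 7423804646, 455202, 70937, 12647590395, 23300, 359036, 102244, 209473],
    [14, 26, 142692, 123998, 326178, 10529646782, 10896353019, 279676, 16900, 17473],
    [60, 25, 17412, 94302, 340258, 105293, 11369004027, 94278, 119140, 7745],
    [62, 26, 126480, 324446, 7566735869, 9747, 7566735846],
    [48, 28, 31617267390, 366925, 282206, 29089744614, 292422, 415332],
    [50, 25, 20228, 213325, 13205326587, 395298],
    [64, 26, 461346, 184653, 153438, 8496387046, 12649260795, 125766, 225636, 77355],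
    [11, 26, 14536176062, 306526, 174150, 333867, 357666],
    [19, 26, 15403, 91426, 339993, 283664, 116062, 10520422630, 113734, 255076],
    [21, 29, 35350171838, 308557, 256350, 26426272742, 68719476987, 265798, 422500],
    [61, 28, 34359738621, 22159231934, 337442, 34359738598, 171792, 17412, 18241],
    [65, 26, 17412, 4979362750, 337442, 171792, 17179869435, 18241],
    [67, 25, 3873708222, 13572, 262434, 133648, 13365124091, 252772, 14145],
    [44, 27, 341598, 9814234302, 263233, 354118],
    [60, 25, 124493, 94308, 37401, 1835, 10047832059, 87366, 17156, 80478, 342306]]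
    (.split 1 1 0 (0) cert74 cert75)

def cert77 : Cert :=
  .node [[42, 26, 100130, 5380, 354625, 6615345110, 6615345148],
    [67, 26, 416802, 12559499198, 32065, 385891, 13756299259, 22788],
    [12, 27, 520482, 376902, 376926, 377921, 36248786, 28420],
    [14, 26, 359202, 11856784639, 317790, 226308, 11856784635, 15644904620, 317761],
    [44, 27, 376926, 376902, 36248786, 377921],
    [81, 26, 520482, 17179869435, 182622, 28420, 183105, 17560786, 186182],
    [18, 26, 300834, 266049, 189444, 286308, 9925472763, 13096558764],
    [82, 26, 209177, 25949, 5075404543, 118059, 264292, 257857, 343842, 235078],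
    [41, 25, 104030, 812987858, 8589934843, 14340, 310652, 109411, 260386],
    [47, 26, 15907012859, 14237681407, 26372, 110460, 482082, 286022],
    [42, 26, 103006, 7819794939, 13060, 99427, 282748, 326721, 236834, 8006],
    [61, 28, 9158325438, 34359738623, 34359738621, 7684, 8257, 141602, 382224],
    [44, 27, 396638, 386886, 303425, 6513961662],
    [60, 25, 221022, 99649, 8363119355, 13828, 95331, 328572, 109894, 253474],
    [62, 26, 319070, 1609712062, 6039234815, 67088, 6039234813, 1284, 1601, 24866],
    [81, 26, 175710, 147265, 189254, 50704, 25860, 17179869435, 470306],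
    [34, 25, 150622, 2867355838, 4934, 7840321708, 5961862395, 473980, 125249, 180770],
    [48, 27, 351326, 34359738623, 292417, 378438, 6695071934],
    [50, 25, 150622, 137506, 5961862395, 7428, 43536, 4934, 473980, 126273],
    [64, 25, 8780, 109406, 3654, 344444, 1284, 125027, 700793339, 21282],
    [21, 29, 468812, 254558, 274246, 312931, 68719476987, 24898178815, 26002128318],
    [23, 24, 174668, 73732, 310050, 10235701243],
    [33, 27, 6300967340, 509730, 34359738619],
    [35, 24, 7156521727, 73310, 348194, 78918, 11610167035, 89955, 3633, 7473831614]]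
    (.leaf [8747340, 3380062, 330654105318, 3641414, 275094528172, 4152931, 14566449, 15728674, 345314835134])

def cert78 : Cert :=
  .node [[1, 27, 130369, 23929439743, 344866, 130398, 134726, 11964720126, 60420],
    [2, 27, 7740585215, 43590, 42305, 111650, 42334, 3870292734, 508164],
    [4, 26, 495394, 83716],
    [20, 26, 7233, 662979326, 7262, 514338, 7494, 1325958399, 87044],
    [41, 27, 17179869394, 17179869436, 326178, 17179869439, 55300],
    [43, 27, 9325411839, 499776, 233054, 177186, 9325411836, 9325411781, 29956],
    [61, 27, 17179869439, 17179869437, 326178, 17179869374, 55300],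
    [12, 26, 192833, 192862, 326178, 199238, 55300],
    [14, 25, 214593, 304162, 4850013356, 8007275515, 214622, 8007275494, 118276],
    [44, 27, 398662, 385857, 385886],
    [1, 26, 9270580475, 104006, 352034, 97089, 97118, 9270580479, 59652],
    [13, 26, 326178, 17179869435, 991534335, 16188335334, 55300],
    [2, 27, 4505859067, 50502, 171042, 47169, 47198, 4505859071, 501764],
    [23, 27, 45377, 48454, 163874, 45406, 4315022591, 4315022587, 480516],
    [29, 26, 326178, 17179869435, 17179869414, 17924],
    [31, 25, 229702, 473890, 12477498111, 12477498107, 139524],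
    [4, 26, 326178, 17924],
    [20, 26, 332578, 1862, 1886, 1857, 163651839, 163651835, 18180],
    [43, 26, 289314, 144454, 164958, 5096340731, 130091, 176960, 5096340710],
    [45, 26, 520482, 17179869435, 17179869414, 28420],
    [47, 26, 425250, 412230, 7488558587, 191275, 7488558566],
    [49, 26, 520482, 17179869435, 28420],
    [8, 27, 520482, 34359738558, 28420],
    [42, 26, 6660, 121378, 8007275478, 429121, 8007275516],
    [63, 26, 146758, 285986, 174429, 128555, 5034216187, 174401, 5034216166],
    [65, 26, 520482, 17179869374, 17179869435, 28420],
    [12, 27, 357702, 520482, 441950, 2867310526, 365121, 28420],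
    [62, 26, 121378, 429150, 8007275517, 8007275454, 8007275494, 6660],
    [16, 27, 520482, 398430, 390470, 398401, 34359738598, 28420],
    [48, 27, 398401, 390470, 34359738598, 398430],
    [1, 26, 264226, 8719996671, 101185, 99142, 8719996667, 101214, 14596],
    [11, 27, 246306, 237611, 165702, 332864, 214366],
    [13, 27, 34359738619, 256886015, 34102852838, 520482, 28420],
    [15, 26, 231202, 305734, 223019],
    [17, 26, 17244574715, 64705535, 838, 262178, 862, 833, 14340],
    [31, 26, 247842, 967127295, 967127291, 308038, 210475, 214788],
    [47, 26, 398114, 10597017318, 313926, 70955, 10597017339],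
    [44, 27, 370246, 426334, 426305],
    [62, 26, 27170, 1712315838, 73744, 6615345126, 354654, 2369, 6615345149, 1540]]
    (.split 1 3 1 (20000) cert76 cert77)

def cert79 : Cert :=
  .node [[1, 28, 286046, 22906492410, 286022, 286017, 22906492330, 22906492415],
    [5, 28, 429150, 429126, 34359738619, 34359738623, 429121],
    [2, 26, 41310, 3308875258, 41286, 3308875263, 3308875178, 41281, 331012],
    [31, 26, 11019641541, 2053409532, 2053409533, 4106818730, 4106818815, 153926, 273924],
    [6, 27, 429150, 429123, 429120],
    [43, 27, 429150, 429123, 429120],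
    [63, 27, 429121, 429149, 429123],
    [28, 27, 429150, 34359738538, 429121, 429126],
    [44, 27, 429150, 429121, 429126],
    [2, 26, 2737879290, 29761, 2737879210, 29790, 2737879295, 30790, 273924],
    [23, 27, 5028689146, 108590, 1002483882, 25182, 5028689151, 25153, 503044],
    [4, 26, 299018, 390178],
    [12, 25, 273442, 40769, 53033, 93790, 96838],
    [1, 27, 22906492415, 128838, 124766, 70441, 11453246462, 364578, 54337],
    [2, 27, 49478, 4393111290, 47966, 27177, 139810, 4393111295, 20801, 518148]]
    (.split 1 1 0 (-20000) cert73 cert78)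

def cert80 : Cert :=
  .node [[6, 27, 1118590937, 427364, 502592, 266531, 10063043324, 226820],
    [41, 26, 1212473049, 203018, 463204, 115776, 10907624700],
    [43, 26, 342884, 514880, 897607385, 150282, 8075035388],
    [4, 26, 2283064060, 253781721, 145728, 97124, 362506],
    [6, 26, 5138940924, 327744, 571236057, 77066, 218212],
    [41, 26, 371556, 10048, 8746637308, 972261337, 131082],
    [43, 26, 151908, 3575000060, 306496, 397391065, 53514],
    [45, 26, 17179869435, 15972, 372915196, 32064, 41452761, 520458, 17179869439],
    [47, 26, 3662278590, 292618, 261696, 291165, 9765516031, 9765516027],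
    [61, 26, 16442046910, 31552, 17179869435, 514826, 17179869439]]
    (.leaf [10077, 17990, 10048, 6073299, 854118651, 25610, 854118655])

def cert81 : Cert :=
  .node [[19, 25, 145501, 343164, 214592, 2214632956, 1492544210, 4160669438, 118794],
    [4, 25, 4964, 283004, 219456, 120157, 4663098322, 221209, 323594],
    [6, 25, 8548, 489596, 379456, 382489, 207709, 262410, 8066014930],
    [41, 26, 93465, 5581428946, 338812, 75364, 8154161916, 204810, 70976, 143709],
    [43, 26, 58137, 46692, 3467702994, 127242, 473152, 210556, 5066124284, 89437],
    [45, 25, 5837547003, 133657, 71005, 5837547007, 293386, 65856, 167036, 3404, 649656254],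
    [47, 26, 6636448251, 152089, 3916, 6636448255, 333578, 344640, 190076, 3407261630, 371549],
    [61, 25, 5837547003, 133657, 3404, 71005, 293386, 65856, 167036, 9239590846, 5837547007]]
    (.leaf [246189502, 10432628987, 6220, 10432628991, 524298, 294720, 298620, 239129, 329542, 317789])

def cert82 : Cert :=
  .node [[15, 26, 1307573202, 273788, 23366, 75840, 51293, 4200752382, 78346],
    [21, 28, 11010291430, 272508, 374336, 386630, 374371, 34359738619],
    [4, 27, 245539, 482826, 208900],
    [6, 27, 99422, 112764, 482880, 281379, 167021522, 154979, 9665805308, 239620],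
    [22, 27, 144474322, 86110, 97660, 134243, 208960, 8360959227, 486947],
    [41, 27, 296861650, 176734, 200572, 275555, 17179869436, 247306, 93731, 91652],
    [43, 26, 86878, 98684, 515648, 149258, 135523, 8447055612, 145961938],
    [47, 26, 11682542846, 420672, 396643, 243466, 312188, 2095825661],
    [14, 26, 292371, 144990, 146752, 107334, 179978],
    [44, 27, 287837, 481094, 312896, 596245202],
    [46, 26, 332554, 268102, 3212327679, 3212327675, 320787],
    [62, 27, 292702, 403466, 160070, 3899218943, 296256, 3899218939, 389395],
    [81, 27, 2361691858, 431114, 221254, 355392, 168828, 231779, 24408939262],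
    [64, 26, 334691, 46406, 2192729340, 52288, 38666, 243580, 154974],
    [66, 26, 7658387196, 216902, 242954, 271424, 312188, 157715, 58206],
    [80, 25, 212288, 70470, 9876805375, 369162, 9876805371, 66684, 29715, 128355],
    [82, 26, 102976, 124938, 64070, 7070073598, 363132, 62307],
    [5, 26, 147008, 1377202687, 190534, 4101174526, 10324290301, 114300, 1377202683, 279139],
    [7, 26, 9620469503, 197190, 384010, 118396, 9620469499, 1751749630],
    [13, 26, 343360, 520458, 63558, 19719314943, 6190187004, 19719314939, 38268, 93283],
    [15, 23, 359232, 503306, 96838, 216931, 10154971647, 10154971643, 88956, 7201166590]]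
    (.leaf [472896, 285539, 524298, 228422, 9476242174, 265747, 116860])

def cert83 : Cert :=
  .node [[18, 0, 472],
    [50, 26, 167750, 225290, 6503700184, 110173, 304665, 12104188159, 3696884158],
    [50, 26, 251212, 324121, 239626]]
    (.split 1 4 0 (15000) cert81 cert82)

def cert84 : Cert :=
  .node [[4, 26, 161059, 286474, 136964],
    [61, 27, 17179869414, 17179869437, 252736, 351754, 7066243262],
    [63, 26, 7198717670, 429149, 105792, 147466, 2960900798, 7198717693],
    [14, 26, 5056825574, 2079920324, 301406, 126272, 103434, 5056825597],
    [62, 27, 5681844932, 282890, 345152, 396563, 411742],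
    [81, 27, 79686, 17179869438, 351754, 329536, 59485, 11204476370],
    [66, 26, 1262404091, 8293090812, 221450, 270205, 284224, 93022, 1262404095, 129350],
    [4, 27, 496650, 267555, 227588],
    [63, 26, 241133309, 10617055995, 271168, 330845, 399882, 10617055999, 241133286]]
    (.split 1 3 1 (35000) cert80 cert83)

def cert85 : Cert :=
  .node [[11, 27, 337728, 215568, 17534208763, 363876, 71961, 485666],
    [4, 27, 256034, 325386],
    [20, 26, 109858, 282649, 20018, 12878990079, 159357, 300870, 429578],
    [41, 26, 240674, 58153, 16729230587, 347236, 68633, 306442],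
    [8, 27, 243746, 34359738558, 310538],
    [24, 27, 191552, 13050443454, 313129, 286754],
    [42, 27, 107298, 108810, 5932972539, 123236, 24345, 2073984688, 500801],
    [63, 27, 13902919102, 214041, 231690, 3466138109, 11982958566, 129917, 521821, 115009],
    [12, 27, 22080, 211737, 205405, 150372, 235280, 110461, 520518, 449802],
    [30, 27, 363795, 2542361595, 2542361599, 421702, 398346],
    [60, 26, 2578256639, 190077, 7209, 3374181883, 275044, 35421, 367641, 6434, 412998, 397834],
    [81, 26, 7202, 256125, 421913, 3916392955, 465674, 483654, 3523894271],
    [18, 26, 81442, 194429, 22315, 13682390779, 16592305919, 94002, 366918, 450314],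
    [34, 26, 14439807487, 1784306427, 45337, 296006, 195122, 156797, 279562],
    [66, 26, 1231655423, 166194, 8251120637, 72208, 264292, 194374, 165154, 103037, 171072, 67594],
    [82, 26, 303564287, 303564283, 87065, 91206, 300669, 82442],
    [17, 26, 269849, 9686496763, 60722, 201030, 60194, 94077, 10135305215, 266506],
    [29, 26, 291627, 5523195, 1094, 5523199, 787, 778],
    [31, 26, 98564, 256778, 372324, 101213, 28395234494, 154493, 2749565439, 201506, 455961],
    [33, 27, 34359738619, 243746, 310538],
    [20, 26, 3648, 10852, 10025, 200262, 117026, 93821, 10095105023, 195609, 331274],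
    [41, 26, 173858, 41537, 12282802427, 313956, 29993, 118297, 292106],
    [45, 26, 9129404155, 158251, 184866, 52806, 9129404159, 271626],
    [47, 26, 106077, 468618747, 390756, 18731, 29806077886, 148093, 1783307519, 450073, 450314],
    [24, 27, 291625, 170048, 14296021694, 270114],
    [44, 26, 485746175, 235801, 485746171, 58717, 279878, 16489378238, 75389, 216164, 232714],
    [60, 27, 20274, 473188, 1873120763, 115549, 488518, 35362, 16681, 123005, 454425, 448778],
    [64, 27, 16975190783, 8513, 111453, 165958, 167449, 444260, 154890],
    [66, 26, 192290, 120592, 11513187579, 19836098301, 353862, 95296, 145789, 452196, 343562],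
    [82, 27, 955974651, 108825, 257046013, 124998, 12578, 497021, 3369, 7012, 118794],
    [5, 28, 35140132347, 378649, 35140132351, 137821, 449606, 30728535230, 98685, 338276, 374026],
    [17, 27, 180777, 21924359931, 14099783933, 243782, 385892, 98685, 173090, 402713, 410378],
    [21, 28, 22797454310, 33590995963, 149597, 222790, 33330965950, 204313, 366948, 185354],
    [23, 26, 303138, 2754050299, 24068, 104262, 8504636606, 52249, 125227, 93796, 38237],
    [31, 26, 270882, 448793, 434788, 177245, 39492059070, 91261, 136747, 22532, 362762],
    [4, 27, 235554, 315658],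
    [47, 26, 4337125631, 26896, 354404, 60715, 435737, 31558611390, 164701, 105341, 472330],
    [24, 26, 64381, 145689, 10021453567, 16161136830, 188742, 1018732797, 122402, 310538],
    [26, 25, 260905, 32125, 224025, 50497, 272228, 230726, 195883, 3518545403, 275978],
    [61, 27, 149289, 230214, 12555788543, 174608, 329515, 12555788541, 20002, 196874],
    [63, 26, 125993, 16509, 37145, 2295791871, 17936, 5749662654, 179243, 265309, 37666, 53002],
    [65, 27, 110205, 249625, 323398, 15433446846, 18926291965, 129058, 419082],
    [67, 25, 70697, 248089, 16537844735, 265542, 962000318, 78635, 100957, 29218, 236042]]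
    (.leaf [3962921, 2254717, 9908505, 520235, 6987334, 373981379006, 373221772797, 15728740, 3056418, 9431818])

def cert86 : Cert :=
  .node [[11, 26, 203328, 32844, 122468, 312354, 43792, 9417260539],
    [17, 27, 159296, 51978, 57444, 270114, 12059143897, 424217, 13756535035],
    [19, 26, 340002, 75364, 209472, 15853237721, 63564, 8654341883],
    [4, 27, 256034, 325386],
    [6, 27, 505932, 497177, 495370],
    [20, 26, 141388, 10333, 1166300671, 13894, 3996965054, 210457, 61028, 314402, 244490],
    [22, 27, 415820, 408857, 438794],
    [45, 25, 183116, 8589934847, 308249, 246562, 89610],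
    [49, 25, 183116, 308249, 246562, 89610],
    [51, 24, 306764, 279577, 223522, 81418],
    [8, 27, 34359738558, 305442, 251402],
    [61, 26, 17179869439, 169292, 328482, 17179869374, 410649, 119306],
    [63, 26, 351325, 11275507967, 111180, 215586, 11275507902, 269593, 78346],
    [30, 26, 120188, 14664719871, 341574, 21538, 268569, 267018],
    [44, 26, 182372, 145245, 307993, 160588, 237638, 29218, 220944, 54026],
    [46, 26, 2728342015, 65305, 26956, 278050, 299563, 385862, 113674],
    [60, 25, 371481, 103184, 193868, 220004, 195618, 86621, 100166, 91402],
    [48, 27, 72268, 6839274239, 26336556222, 389220, 60253, 62278],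
    [66, 26, 431385, 412432, 486756],
    [17, 26, 186700, 432921, 193314]]
    (.leaf [5862988, 2313572, 702412743398, 6759184, 5708834, 6178653, 6393158, 15728665, 6312202])

def cert87 : Cert :=
  .node [[11, 26, 354338, 39262, 339812, 7388146683, 2701117692, 39037, 4395, 356416],
    [19, 26, 419106, 356672, 492388, 13057999355, 13743890649, 78346],
    [41, 26, 66082, 8589934844, 282724, 32350, 80650, 32381, 197032934],
    [43, 26, 20318, 50954, 5424959228, 178532, 124435942, 20605, 41762, 356672],
    [51, 26, 276800, 86297, 317284, 4917622523, 98338, 14622562777, 128266],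
    [63, 27, 38178, 4950482110, 41513, 46346, 7402222333, 267389, 16276070105, 405597],
    [62, 27, 266078, 151571, 170786, 10095882692, 7434, 297024],
    [83, 27, 96094, 223522, 45587, 211978, 456768, 11182454267, 421732, 31417276121, 25407892164],
    [16, 26, 370547646, 185104, 468324, 2112, 3277618406, 53885, 87622, 79114],
    [34, 26, 192893, 182834, 11780987135, 2242552059, 2670390010, 314438, 295434],
    [64, 25, 29534, 33149, 289380, 82880466],
    [66, 27, 275038, 397437, 241202, 3158480127, 249634, 1482101990, 48138, 144454, 255808],
    [9, 26, 3265423612, 150041, 2064360442, 1314977535, 334180, 3379337723, 15114, 15942, 12381],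
    [11, 26, 277312, 8268, 209252, 8875710203, 63547609, 354850],
    [2, 27, 163106, 361988, 4078145791, 30528, 4078145787, 456323518, 49478, 37981],
    [41, 26, 4670695932, 554005721, 310372, 7838478331, 156706, 190730],
    [43, 26, 278336, 69410, 147300, 3470923003, 60953, 20696281, 90634],
    [48, 26, 760861401, 426084, 17179869374],
    [64, 26, 760861401, 426084],
    [66, 27, 467776, 488226, 471858, 6178745343, 184164, 8008029158, 232317, 378694, 94218],
    [82, 26, 34338, 22336, 3049637118, 1713988859, 17168, 55306, 282237, 57926, 44381],
    [21, 27, 17179869374, 289380, 17179869435, 2360709849],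
    [23, 26, 354850, 8522881470, 143716, 8522881531, 1171141081],
    [20, 27, 68928, 24617, 325922, 80221, 17251082495, 8625541374, 104774, 394762],
    [44, 27, 214336, 7061490110, 417350, 318813]]
    (.split 1 0 4 (-5000) cert85 cert86)

def cert88 : Cert :=
  .node [[17, 27, 216354, 9015076809, 367385, 12139132667],
    [19, 25, 498210, 471628, 58122, 452633],
    [21, 26, 50722, 169548, 8647621862, 86854, 87645, 3752019134, 286489, 4384732632],
    [23, 26, 10168128998, 199500, 5155697880, 103261, 102214, 336921, 471842, 4411734974],
    [25, 24, 194124, 177442, 100445, 99398, 5019239640, 327961, 9899004646, 154634]]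
    (.leaf [10928716, 302786258648, 2785833, 3676742, 10177826, 15728665, 366146071014, 3711069, 6847242])

def cert89 : Cert :=
  .node [[11, 26, 57724, 65636, 81228, 192320, 25693, 340514, 9554551547],
    [17, 26, 92284, 21264, 279065, 5898, 17216, 41309, 36898, 2066810875],
    [19, 27, 472700, 108304, 87872, 32025, 211037, 155682, 6862579707]]
    (.leaf [126844, 28944, 56669, 493132, 23616, 524313, 319010, 248330])

def cert90 : Cert :=
  .node [[2, 27, 361220, 213785, 227660, 164130, 76277243, 58378],
    [35, 26, 354850, 13010068169, 168780, 8875710203],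
    [43, 27, 264292, 17369913801, 39458, 30001, 5035308796, 329024, 76810],
    [83, 26, 24556532735, 379185, 2669917385, 459078, 8738, 61564, 374538],
    [48, 27, 175965, 9090940606, 188742, 16695574527, 285004, 100708],
    [64, 26, 332637, 190308, 356988, 2254992639],
    [11, 27, 126381307, 96838, 190588, 298304, 307234, 229425, 237156],
    [19, 27, 443938, 13210289097, 361036, 336945],
    [21, 28, 14337426687, 9321677502, 162118, 90468, 263756, 151133, 34359738619],
    [35, 27, 13477820105, 332593, 356684, 447266],
    [41, 27, 10307134460, 233572, 10779139835, 389981, 42027, 424828, 8985, 270370, 329226],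
    [43, 27, 106589, 95588, 519744, 6227599100, 140668, 26161, 34338, 94986],
    [63, 26, 7028540671, 4688472510, 39721, 385117, 7028540669, 36386, 44298],
    [14, 26, 9556219647, 271430, 188796, 287257, 19532, 243722],
    [30, 26, 287257, 271430, 9556219622, 19532, 188796, 243722],
    [44, 27, 5696299710, 224320, 414278, 323165],
    [46, 26, 10203614438, 281113, 272966, 215330, 196476, 77834],
    [83, 26, 3180091337, 348284, 30242, 23089, 98118, 4080257278, 62218],
    [48, 27, 132957, 8855521214, 277324, 13297469670, 148806, 95332],
    [64, 27, 369252, 7835213030, 515933, 396924],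
    [17, 27, 56369, 132928, 466160382, 446489, 3376404733, 189474, 147580, 191581, 5670733051],
    [19, 27, 6982, 116240, 360285, 276258, 198208, 488828, 89905, 7759461627],
    [29, 26, 24836, 310334719, 266283, 2826, 2338, 310334715],
    [6, 26, 94274301, 4416, 305689, 15100862, 281164, 6237, 4988, 279306],
    [20, 27, 39209, 197913, 170077, 98374, 449058, 143424, 10036759039, 63356, 345610],
    [22, 26, 247116, 3904, 268569, 5469, 82833405, 4220, 13268414, 254730],
    [41, 27, 492834, 112409, 490077, 93739, 21216509179, 360292, 413052, 441866],
    [43, 27, 61465, 149372, 459840, 113501, 6155489531, 124004, 109602, 155402],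
    [45, 27, 156441, 364075, 304674, 7935679999, 50044, 273162],
    [24, 27, 174144, 288809, 13583543742, 308258],
    [63, 26, 6003815423, 6003815421, 34089, 329053, 34338, 3868540862, 30730],
    [30, 26, 7916670975, 8012, 164633, 308550, 115243, 50044, 280586],
    [44, 27, 234048, 324701, 403526, 6861820094],
    [46, 26, 3038500351, 210722, 210219, 19324, 318278, 59929, 104714],
    [60, 26, 342877, 111168, 161404, 11438669563, 162118, 153956, 1305, 203810, 182282],
    [62, 27, 244002, 133184, 13689636603, 394876, 194118, 1561, 62052, 20495726552, 218122],
    [81, 27, 369954, 20766946555, 211728, 204864, 323142, 85884, 432733, 268057, 357386],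
    [83, 26, 31760, 55586, 65117, 40217, 3123792379, 48710, 30784, 289148, 53770],
    [18, 26, 33314, 10912117976, 33065, 315161, 18776461567, 188742, 6068891582, 190301, 234762],
    [48, 27, 134237, 5747765694, 133190, 13247401958, 326732, 6717027288]]
    (.split 1 2 2 (-10000) cert88 cert89)

def cert91 : Cert :=
  .node [[63, 25, 477308, 17961, 2316638910, 194653, 16674, 3716999933, 6476, 27914],
    [18, 27, 448537, 474444, 380682],
    [34, 27, 319052, 331545, 256010],
    [48, 23, 20800, 3660, 7529426, 275836, 22086, 20573],
    [82, 27, 306508, 358169, 28480, 308234, 1041348859, 1041348863, 28509, 356],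
    [2, 27, 4078145787, 4078145791, 38208, 49222, 37981, 13901266, 163106, 361988],
    [21, 26, 11192106235, 61760, 164166, 478076, 59485, 79370, 2403],
    [23, 26, 14446034, 7388756731, 39744, 109126, 318332, 39517, 310306, 28932],
    [31, 26, 10452426235, 283485, 285504, 86282, 450172, 103974098, 320034],
    [35, 27, 3516665083, 32349, 33600, 42054, 353284, 1379, 147746, 3467236095],
    [4, 27, 340746, 252450],
    [20, 27, 25158, 8106894334, 101934, 361482, 239394, 16213788415],
    [43, 26, 78602, 30558, 5330428370, 21538, 318016, 5280865532, 274044, 18225],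
    [45, 26, 45894, 332849, 205322, 252284, 116002, 13821095935],
    [63, 26, 47138, 65034, 67377, 55081, 1647337467, 359804, 2733302013, 303965, 5109339326],
    [46, 26, 159266, 18986674943, 457265, 523078, 346492, 282122],
    [81, 27, 145186, 200970, 13514711806, 271562450, 123953, 264006, 195421, 199488],
    [83, 26, 1826, 10113871355, 20442717183, 176433, 397382, 4220, 454154]]
    (.leaf [152109685758, 4569488594, 95930894280, 2207814, 3285341, 3355712, 2260490, 1648418, 1408049, 15728764])

def cert92 : Cert :=
  .node [[18, 0, 472],
    [50, 27, 192290, 395876, 252185, 40006, 394561, 67338, 3534787839, 37469]]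
    (.split 1 2 2 (10000) cert90 cert91)

def cert93 : Cert :=
  .node [[7, 27, 225606, 515362, 11299152639, 11299152635],
    [11, 27, 307294, 473920, 7070042620, 11903021311, 381730, 4832978939],
    [2, 27, 48192, 201250, 348676, 4413295871, 49734, 4413295867, 48221],
    [31, 27, 141917, 348164, 141888, 67338, 5679861503, 178978, 5679861499],
    [33, 27, 350242, 364554, 34359738619],
    [4, 27, 350242, 364554],
    [20, 27, 358666, 16710, 7450862078, 14901723903, 116270, 292642],
    [41, 28, 34359738578, 34359738620, 34359738598, 283426, 323850],
    [8, 27, 283426, 34359738558, 323850],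
    [24, 27, 422185, 348962, 422208, 2011894974],
    [26, 0],
    [42, 27, 135750, 143681, 482082, 131421, 23345009840, 12060833275, 12060833254],
    [61, 28, 46882, 48169, 447760, 5681554622, 53514, 34359738621, 34359738598],
    [14, 26, 252230, 7402951876, 12638577663, 12638577659, 405514],
    [44, 27, 388928, 38883282, 401734, 388957],
    [62, 27, 380736, 229666, 2436750335, 13932179451, 11495429350, 381790, 262666, 15239534276],
    [81, 27, 164050, 17179869438, 275466, 1600, 314438, 1629],
    [66, 26, 184128, 134178, 20746, 47174, 160350, 288893, 105522, 1293942780],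
    [82, 26, 56786, 5942438910, 95242, 576, 429181, 108870, 605],
    [5, 28, 361792, 34359738623, 34359738619, 36173778, 387910, 361821],
    [9, 25, 4680171474, 2863311871, 2863311867, 2863311868, 57700, 279164, 4445],
    [13, 27, 283426, 20184643327, 34359738619, 14175095526, 323850],
    [17, 28, 25430265854, 356898, 25430265855, 43289211387, 407818],
    [29, 27, 34359738619, 34359738598, 323850, 283426],
    [33, 27, 283426, 34359738619, 323850],
    [4, 27, 283426, 323850],
    [43, 25, 168000, 62052, 3074293244, 1194609618, 299644, 27486, 46858],
    [24, 27, 327202, 4329650622, 335657, 329024],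
    [28, 27, 329762, 8064693242, 398656, 8064693247, 369162, 29225, 479302, 447325]]
    (.split 1 3 1 (30000) cert87 cert92)

def cert94 : Cert :=
  .node [[31, 26, 72262, 285956, 165154, 3620936699, 3620936703, 806772908],
    [45, 25, 391211, 95814, 6916, 87335675, 87335679, 307234],
    [47, 26, 85318, 293380, 169250, 3712780283, 3712780287, 18442865836]]
    (.leaf [12870, 5636, 561344251, 561344230, 25634, 90458028])

def cert95 : Cert :=
  .node [[4, 26, 487970, 102666],
    [22, 0],
    [12, 26, 342854, 113698, 295434],
    [14, 26, 10706369220, 8368264703, 166982, 8368264699, 350474],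
    [30, 27, 361747, 3247231172, 256326, 268810],
    [83, 27, 3247231172, 256326, 268810, 361747],
    [16, 26, 342854, 295434, 17179869439, 113698],
    [1, 27, 58402, 25920, 25949, 265006, 11078, 22906492415, 11453246462],
    [2, 26, 11810, 5184, 273924, 5213, 53550, 2374, 4622196735, 2311098366],
    [23, 27, 25904364996, 403490, 431364, 5459765759, 109126, 5459765755],
    [4, 26, 337698, 123402],
    [20, 26, 3136, 2102615294, 329250, 4205230335, 121098, 3165, 53294],
    [28, 26, 53282, 406062, 35648, 35677, 12614]]
    (.split 1 1 0 (-10000) cert93 cert94)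

def cert96 : Cert :=
  .node [[1, 28, 286022, 22906492410, 22906492330, 286045, 22906492415, 286016],
    [5, 28, 429126, 34359738619, 429149, 34359738623, 429120],
    [2, 26, 41286, 3308875262, 3308875178, 41309, 6617750015, 41280, 331012],
    [23, 26, 153926, 4106818730, 2053409533, 4106818815, 2053409532, 273924],
    [31, 27, 190498, 5156066815, 89437, 39494, 5156066810, 89408, 515844],
    [22, 26, 5726623186, 5726623206, 5726623228, 286016, 143139],
    [28, 26, 72262, 347950, 5787152594, 5787152554, 72233, 72256],
    [44, 27, 429126, 429149, 429120],
    [62, 27, 429123, 429120, 429150],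
    [48, 27, 386630, 34359738598, 374365, 374336]]
    (.split 1 0 1 (10000) cert84 cert95)

def cert97 : Cert :=
  .node []
    (.split 1 2 1 (0) cert79 cert96)

def cert98 : Cert :=
  .node [[19, 27, 419684, 424976, 433945],
    [27, 27, 299102, 859387389, 263705, 268048, 10660376831, 182141, 473860],
    [31, 27, 161064, 63332, 28193247189, 137085, 69982, 135449, 342020],
    [33, 27, 305177, 300338, 189700],
    [20, 26, 326947, 147038, 161034, 422712829, 89725, 65576, 129817, 5243592959, 152128, 172036],
    [47, 27, 418941, 413977, 193636, 196112, 279587, 200517, 192260],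
    [51, 27, 372068, 391961, 376848],
    [8, 26, 6976, 286992, 4899, 3332],
    [10, 27, 173156, 64606, 120626, 455232, 2486049023, 39293, 481315, 6570868731, 402692],
    [24, 27, 81221, 327232, 5041318653, 13693, 289832, 157968, 5770807295, 345379, 116318, 19737],
    [61, 28, 34359738621, 34359738598, 454928],
    [67, 27, 186403, 259392, 391961, 372068, 189712, 128260],
    [30, 26, 261440, 13835534566, 77072, 7521272829, 335907, 431966, 6314262011],
    [44, 27, 214592, 298309, 10501771454, 345694],
    [62, 26, 10678403558, 141328, 10678403581, 431966],
    [81, 27, 20861, 18901242069, 242704, 16619224062, 370782, 30233],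
    [16, 27, 260989, 9817821926, 454928, 330596, 311902],
    [34, 27, 252029, 96272, 9482594559, 248640, 368946, 359715, 301150, 122188],
    [48, 27, 4770746875, 341836, 17433, 94308, 13082589439, 139280, 129349, 103262],
    [50, 26, 220029, 16656, 101130, 3361989375, 222784, 54578, 4912478973, 25123, 263006, 56068],
    [64, 27, 260989, 9817821951, 330596, 311902],
    [82, 26, 266621, 3090543829, 39696, 2721533950, 60766, 4889],
    [1, 27, 220285, 94533, 81448, 2068655101, 387392, 356633, 17312080895, 415267, 369758, 221700],
    [5, 28, 369989, 8268, 4989, 37668346875, 249408, 96528, 37668346879, 302174, 12057],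
    [7, 27, 121213, 260377, 128332, 284736, 54571, 3066189055, 176734, 322058],
    [19, 27, 350564, 379673, 281616],
    [2, 26, 28285, 51491, 9000, 366674429, 47936, 41497, 2069914367, 265220, 46942, 11845],
    [21, 27, 302156, 13362640123, 137497],
    [23, 27, 224893, 378393, 97808, 101196, 252480, 20267, 9166688767, 449284, 306014, 284170],
    [29, 26, 1385221115, 88099, 1776115197, 65088, 76382, 285483, 3161336063],
    [31, 26, 360061, 153444, 379417, 279056, 4051159295, 226564, 238174, 3906486741],
    [4, 27, 417315, 352522, 260612],
    [20, 26, 78973, 341795, 144394, 46376, 131136, 116761, 4787785727, 178692, 131166, 1398842581],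
    [22, 26, 6681, 384803, 40036, 9144246011, 55595, 59664, 28741, 42078, 102220],
    [41, 26, 195197, 354339, 102244, 1137834197, 198720, 185899, 186905, 206596, 345694, 119562],
    [47, 27, 242813, 394019, 127076, 232473, 101904, 233732, 191019, 298821],
    [51, 27, 255531, 254243, 264804, 431897, 395024, 7944271615, 117764, 278878, 203077],
    [10, 26, 32893, 327459, 60772, 27947, 267328, 6692623611, 226564, 53598, 33356],
    [42, 26, 40970, 63531, 336192, 121123, 66685, 388842197, 63769, 70660, 118110, 34916],
    [30, 26, 209707, 168208, 7251275771, 368163, 4565551359, 19225, 54092, 386654, 263488],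
    [44, 27, 5043081979, 162320, 365637, 42265, 22141, 26956, 5043081983, 373342, 254272],
    [62, 26, 4630338813, 173072, 5708, 12067, 29309, 96299, 6119478783, 45081, 365406, 7744],
    [81, 26, 277785, 230672, 5778302459, 198947, 188029, 12872582357, 141828, 437086, 149568],
    [18, 26, 6476, 114448, 225088, 301859, 233853, 89387, 4124696063, 207108, 290398, 8346970875],
    [48, 27, 3361053183, 108048, 80990, 102169, 87621, 465228, 70179, 42500, 71780, 84779],
    [50, 26, 235389, 40208, 287838, 52515, 56074, 48683, 1502780671, 33028, 5298683133, 236096],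
    [64, 27, 260989, 67088, 322654, 10787, 5898, 86315, 5473668607, 11340, 393060],
    [82, 26, 1096748795, 48400, 90462, 37923, 59161, 2832758997, 26884, 28480, 271741],
    [1, 26, 102988, 84496, 214366, 258083, 9285, 8390833151, 333849, 184068, 166208, 163965],
    [7, 27, 335114, 385561, 211550, 7459, 83472, 205900, 3687806719, 58155, 163904, 162429],
    [17, 27, 9376394747, 322851, 290398, 226052, 384793, 49195, 7140351229, 15888, 242752, 225661],
    [2, 27, 28236, 64291, 59486, 498948, 8292, 2144946175, 87065, 32272, 38976, 47229],
    [21, 28, 150341, 29731, 149086, 58393, 134244, 381772, 32796208635, 236075, 202768],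
    [23, 27, 332810, 342041, 178782, 434180, 70416, 189260, 5367383807, 16171, 138816, 140157],
    [20, 26, 137341, 285219, 173406, 180996, 49764, 6259473407, 182553, 121872, 128522, 91712],
    [22, 26, 39518, 351779, 8683416571, 62507, 15385, 39749, 53776, 35684, 101196],
    [41, 26, 183421, 272419, 246110, 181252, 109066, 130916, 174361, 130603, 120384],
    [51, 26, 212779, 318243, 467993, 263262, 206596, 69957, 169804, 236900, 358160, 144509],
    [10, 26, 7467, 309027, 68172, 14174, 217860, 7893842939, 43876, 221248, 10621],
    [40, 26, 95019, 204835, 2873821691, 179038, 136708, 369177, 72256, 323600, 133501, 325452],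
    [42, 26, 51993, 81187, 38955, 73310, 54020, 276544, 39012, 54653, 32522],
    [61, 26, 326160, 135971, 264473, 74060, 76804, 80448, 9069894399, 223275, 195678, 135293],
    [67, 27, 317977, 157731, 114752, 111620, 5872431355, 418404, 305936],
    [30, 26, 136012, 368163, 4399784187, 332894, 24068, 94745, 213035, 21373, 132112, 234048],
    [60, 26, 71952, 144163, 71749, 366174, 101892, 208409, 165732, 243581, 151360],
    [62, 26, 139307, 57635, 31308, 391774, 46852, 230160, 173593, 93053, 7158164991, 34112],
    [81, 26, 105285, 216355, 297310, 152836, 187889659, 315673, 115472, 183421, 225600],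
    [16, 26, 113707, 424030, 4868, 496656, 7996665087, 330852, 363645, 205081],
    [18, 26, 114192, 347427, 157739, 294238, 252420, 118348, 106265, 4828312059, 255869, 223296]]
    (.leaf [455696, 192547, 104780, 489566, 144644, 264804, 194091, 422781, 524313, 4818431487, 113984])

def cert99 : Cert :=
  .node [[1, 27, 250980, 112675, 352094, 43274, 16446842367, 120652, 169512, 518169, 241533, 273424],
    [3, 26, 91748, 354851, 33886, 38981, 172554, 373068, 463897, 93992, 4164987622],
    [5, 26, 23652, 35363, 80222, 92741, 187980, 26116, 320537, 75280, 9896530150],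
    [7, 27, 90468, 92712, 33374, 471562, 368204, 38469, 457753, 61475, 4109696998],
    [9, 27, 366180, 520030, 12130182399, 8708, 156715, 437785, 365693, 158224],
    [11, 26, 99619, 65100, 210526, 196362, 175173, 150056, 21470306278, 40317, 345369],
    [13, 27, 25700, 87390, 19191727103, 13828, 248107, 275225, 74109, 83216],
    [15, 27, 96291, 141668, 52318, 439818, 445765, 144936, 30109645798, 208509, 507929],
    [17, 26, 35684, 121438, 2828101119, 2052, 36651, 293401, 85373, 115472],
    [19, 26, 175907, 258660, 474649, 95326, 166410, 110149, 11756512486, 160588, 265000],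
    [2, 27, 1124, 1817, 1630, 77483263, 432644, 552, 1149, 1552],
    [6, 26, 358947, 18020, 301849, 61278, 211788, 263428, 7559460582, 58384, 70725],
    [8, 27, 196387, 217881, 44132, 74762, 207436, 295720, 234000],
    [10, 25, 213092, 264061, 384862, 17985490687, 393753, 438544],
    [14, 25, 182397, 20355671807, 425310, 118884, 354841, 395792],
    [18, 25, 118884, 19870255846, 291709, 354841, 425310, 395792]]
    (.near 0)

def cert100 : Cert :=
  .node []
    (.leaf [10792, 7203, 15198, 25625, 5452, 1560161254, 14602, 2941, 12869])

def cert101 : Cert :=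
  .node [[7, 27, 388121, 400460, 497418, 5368557565, 90432, 247831551, 88957, 145758, 247831547],
    [9, 26, 11090884326, 296473, 175485, 287838, 18276],
    [17, 27, 15487282941, 446233, 244861, 402014, 118032],
    [2, 27, 2345307349, 154649, 40232, 451332, 7966438399, 73853, 180318, 133392],
    [27, 27, 16207252198, 433448, 218116, 256125, 420702, 360729],
    [29, 27, 13817878269, 30070444006, 150653, 247390, 315417],
    [20, 27, 89981, 188185, 229160, 368906, 99332, 361251, 9699889407, 219486, 2855632853],
    [47, 27, 848328917, 13138116326, 371269, 188420, 441379, 314237, 135268, 463385, 151592],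
    [8, 27, 314664, 296464],
    [24, 26, 142376, 181529, 33093, 9361615615, 31754, 4131, 86909, 176734, 303376],
    [61, 28, 283688, 34359738623, 34359738621, 267024],
    [67, 27, 396900, 365081, 370960],
    [12, 27, 799846357, 22020, 34851, 279050, 290629, 321630, 268816],
    [14, 26, 11566704614, 11566704637, 431966, 180496],
    [30, 26, 431966, 11566704614, 11566704637, 180496],
    [44, 27, 10738130878, 311390, 193344, 299845],
    [62, 26, 95528, 11566704614, 431966, 11566704637, 89872],
    [81, 26, 333337, 159357, 55562, 57157, 6404, 339038, 10019, 3533740245, 283152],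
    [16, 27, 74596, 65917, 48424, 42019, 233482, 287326, 29602284774, 240197, 256528],
    [18, 26, 63275, 7428, 4238411007, 7261718525, 263293, 348254, 177680],
    [48, 28, 259141, 20842460862, 212830, 176228, 27559729382, 501580],
    [50, 26, 151595, 94028, 448606, 17924, 10153152255, 348797, 312857, 109632, 173578, 322576],
    [64, 27, 290660, 350814, 256381, 15835126758],
    [82, 26, 54809, 2595, 14346, 44382, 1540, 286845, 14917, 4964, 41488],
    [1, 26, 15796826879, 11555, 13352, 242014, 64010, 295193, 114301, 65861, 38500, 223504],
    [5, 28, 3809954534, 224862, 388428, 25302692863, 25302692859, 273733, 462617, 187920],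
    [7, 27, 377420, 392729, 488458],
    [13, 27, 92541, 96606, 19390436863, 34564, 313369, 293931, 80656],
    [17, 26, 98941, 152670, 3563881215, 6404, 335129, 54059, 127504],
    [2, 27, 31101, 17704, 51294, 2397548031, 438532, 54553, 21348, 44816],
    [21, 28, 236126, 30571494886, 407884, 23127058171, 287557, 485913, 197136],
    [23, 27, 450058, 21061, 17246, 313676, 2237172991, 424964, 14888, 15204, 337177, 13584],
    [27, 26, 134013, 91492, 220510, 68612, 10332128486, 279592, 235033],
    [29, 27, 42621, 143641, 41988, 9915721190, 368427],
    [31, 27, 461949, 502312, 27717, 9507, 147204, 439065, 470116, 25610, 62814],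
    [4, 27, 406307, 230916, 311050],
    [20, 27, 291353, 90408, 273502, 166269, 12806001919, 161284, 113252, 375843, 304650, 244496],
    [22, 26, 206617, 726176742, 115038, 393251, 131141, 12644, 191531, 198732, 107280],
    [47, 27, 475417, 20122293990, 196708, 395811, 138756, 279421, 210216, 349253, 26462],
    [8, 28, 311848, 274467, 29496429502, 257802, 321552],
    [24, 27, 59461, 244776, 82782, 215587, 7867399167, 135690, 15485, 233548, 330521, 362512],
    [61, 27, 209228, 260136, 185891, 3820254975, 70922, 16990, 442411, 249369, 268048],
    [63, 27, 85573, 387453, 390500, 11555, 81418, 909164543, 14888, 377625, 316432],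
    [67, 27, 466532, 99112, 365593, 296720],
    [12, 27, 269637, 54141, 48665, 367198, 36131, 23812, 53604, 257290, 322832],
    [30, 26, 128778, 27236, 389214, 269867, 553499391, 338211, 380748, 385561, 317968],
    [44, 27, 289349, 82954, 336990, 49252, 316236, 24957, 337945, 296464],
    [60, 26, 40005, 38410, 322398, 121616, 9507, 165501, 6148, 149017, 164196],
    [62, 26, 29706, 165672, 335710, 231211, 1603285503, 78115, 87884, 104729, 112400],
    [81, 26, 80453, 244240, 77322, 240478, 18979, 129661, 12292, 55908, 299545],
    [18, 26, 121643, 346462, 9014811135, 260477, 12804, 140825, 286224],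
    [48, 27, 291609, 33734674406, 231774, 276812, 315461, 96266, 53604, 235280],
    [50, 26, 424729, 319869, 425310, 149291, 11072190463, 180812, 229898, 15620, 98660, 432144],
    [64, 27, 227965, 16563672806, 318814, 307812],
    [5, 27, 38244, 515353, 164190, 113451, 261964, 8700952806, 246597, 12036, 8412473599, 167696],
    [7, 26, 15460, 267033, 65886, 284938, 129100, 89669, 9572188134, 67088],
    [17, 26, 23396, 296729, 100446, 35371, 2613621247, 3588, 75645, 102672],
    [19, 25, 79204, 265497, 109918, 60200, 46115, 149829, 142346, 97296, 16002486758],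
    [21, 27, 35940, 411161, 154206, 181291, 261964, 246597, 19204, 11567644134, 157456],
    [23, 27, 73828, 406026, 19038, 77608, 282444, 342553, 393476, 25925, 2773325030],
    [25, 27, 322148, 252697, 375646, 296573, 66320, 27908, 264235],
    [27, 26, 130916, 222558, 159101, 302120, 63492, 255513, 11554499046],
    [29, 27, 34685, 137241, 34052, 10376288230, 324651],
    [31, 26, 269924, 48734, 253821, 232473, 1562460134, 57860, 276008],
    [4, 27, 377635, 306186, 232452],
    [6, 26, 20580, 539970303, 174891, 87902, 89872, 89625, 294691, 138821, 191236, 75596],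
    [20, 26, 40548, 41512, 314915, 7518, 5245, 379849727, 121932, 184330, 169988, 143897],
    [22, 26, 21604, 341539, 92510, 120619, 133964, 200985, 139077, 5025367014, 94480],
    [45, 27, 348707, 38220, 18813, 149273, 328970, 330027, 276740, 8753827327],
    [47, 27, 367139, 310597, 46942, 308093, 480793, 264488, 119812, 258660, 21018104575],
    [49, 27, 312355, 317450, 212318, 159869, 493081, 142123, 239108, 49508, 217104],
    [51, 27, 349987, 397099, 214622, 461608, 352793, 296005, 15876, 482148, 135952],
    [8, 27, 251683, 88586, 68964, 290841, 276556, 324136, 259088],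
    [10, 26, 271395, 95754, 252766, 190333, 298316, 475929, 169259, 210436, 280676, 419600],
    [24, 27, 288844, 262691, 92682, 313896, 303641, 14084, 72036, 260112],
    [61, 27, 32581, 247592, 341291, 138531, 10045100543, 257817, 78858, 145996, 245264],
    [63, 27, 94533, 47403, 656778495, 304400, 16419, 30248, 384125, 334105, 92938, 414820],
    [67, 27, 97612, 88867, 133672, 455193, 31242, 506468, 274448],
    [12, 27, 257605, 253706, 369246, 45091, 100477, 79129, 33284, 105572, 344848],
    [16, 28, 320291, 521572, 112906, 350814, 240765, 16391227622, 352076, 482344, 165648],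
    [18, 25, 221821, 315486, 173337, 7375298559, 5380, 94763, 90212, 294416],
    [48, 27, 160612, 86051, 166238, 129576, 400972, 20500946406, 111632, 282649, 191813]]
    (.split 1 0 2 (21000) cert99 cert100)

def cert102 : Cert :=
  .node [[1, 27, 171048, 22906492415, 89635, 9262267093, 11453246462, 274782, 9029, 84032],
    [27, 26, 267801, 246312, 4788638438, 306270, 766084605, 194685, 160004],
    [31, 27, 2991909631, 12550093525, 145021, 199193, 199262, 164904, 429828],
    [24, 27, 460328, 311331, 270656, 2341038526],
    [12, 26, 5719859157, 112709, 3648, 101130, 212496, 288350],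
    [44, 27, 363845, 7324894142, 403038, 244800],
    [60, 26, 429150, 15016993237],
    [81, 28, 34359738622, 413200, 7600123349, 6404, 207626, 448606, 8739, 219205],
    [48, 27, 14425393407, 133957, 141406, 281164, 128868, 13277004990],
    [64, 27, 11479800575, 333156, 232829, 365918],
    [82, 26, 53520, 4445642238, 983343829, 1059, 772, 312189, 58206, 26890, 28485],
    [1, 28, 45812984831, 22906492414, 290344, 14840904917, 186403, 173376, 442974, 17989],
    [5, 28, 34359738623, 34359738619, 319045, 9304410302, 204608, 336990],
    [2, 27, 7693413119, 48680, 3846706686, 31267, 29248, 74590, 2492245717, 3141, 513028],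
    [41, 28, 11065940991, 319588, 317987, 173437, 34359738620, 323422, 386826, 219396],
    [8, 27, 126986, 266512, 162344, 104483, 11278309566],
    [42, 27, 130826, 136804, 10531, 512320, 7860112892, 7428],
    [67, 26, 110096, 265497, 108323, 136768, 185188, 74756],
    [44, 27, 11020324286, 319045, 184128, 336990],
    [60, 26, 12150573525, 347230],
    [16, 27, 185610, 394000, 101732, 190533, 311646, 19491, 64893, 26707395839, 13316],
    [64, 27, 279652, 13328241151, 178557, 332894],
    [9, 28, 22906492412, 22906492411, 6130406101, 22906492415, 505182, 292708, 177021],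
    [17, 26, 10869404117, 17179869437, 310622],
    [27, 27, 483097, 517928, 20258128895, 271229, 505950, 244228],
    [29, 0, 511],
    [33, 0],
    [61, 28, 424208, 176424, 34359738623, 34359738621],
    [67, 27, 379664, 469017, 162112, 128291, 445028, 88580],
    [12, 27, 185610, 394000, 13316, 19491, 8497800405, 433246, 190533],
    [14, 26, 95760, 192291, 243008, 13050319613, 13050319615, 490846, 132612],
    [60, 26, 323166, 11308072149],
    [62, 26, 490846, 169232, 70440, 13717635069, 13717635071],
    [48, 27, 92772, 11385321406, 288076, 118853, 104542, 12901175807],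
    [50, 26, 347230, 61200, 107274, 199232, 9697880573, 211581, 3677120511]]
    (.split 1 0 2 (15000) cert98 cert101)

def cert103 : Cert :=
  .node [[7, 27, 420618, 384025, 136030, 25700, 143936, 29253, 145277, 258636],
    [21, 28, 34359738619, 5325963732, 122468, 7354710206, 156997, 9607091711, 263500],
    [27, 27, 110149, 141864, 241177, 128868, 220285, 17709019092, 102410, 38435, 406788],
    [33, 27, 254258, 419097, 199172],
    [4, 27, 375562, 414243, 284164],
    [20, 27, 369418, 140334, 7808159230, 17533, 31769, 16995991551, 398115, 288260],
    [22, 26, 56396, 1575287998, 26212, 1140755668, 37419, 42309, 338467, 5301710587],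
    [47, 27, 477465, 185956, 5594607078, 388989, 285509, 34320, 166696, 448803, 220164],
    [10, 26, 254528, 1002521084, 93540, 28466, 41341, 8261, 4267344891, 39518, 286243, 235524],
    [24, 27, 21629, 75024, 2274829823, 358184, 330304, 39193, 57925, 576617469, 336163, 3737652948],
    [42, 26, 28285, 399454418, 3493182972, 54628, 262976, 23902, 11314, 48906, 37411, 36100],
    [67, 27, 343824, 122688, 418329, 2306613243, 455780, 150563, 113412],
    [14, 26, 41085, 36907, 561448703, 2615549908, 250176, 224862, 4708417275, 50532, 307235, 235524],
    [30, 26, 204894, 36907, 4478725076, 250176, 46717, 57444, 307235, 4708417275],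
    [81, 28, 240478, 3084682706, 34359738622, 438853, 267328, 368906, 362275, 272900],
    [34, 27, 376926, 1465437179, 61028, 372288, 61765, 405629, 229426, 411171],
    [50, 27, 436318, 1377334738, 4221493758, 27442, 4223110396, 118282, 516221, 485184, 86563, 87556],
    [64, 27, 297054, 3810524626, 432740, 351357],
    [82, 27, 40798, 21298, 522037714, 105029, 91914, 45376, 6568020734, 521853, 67363, 68100],
    [7, 27, 366617, 80734, 11077, 401162, 80448, 12900, 82045, 283468],
    [9, 26, 256606, 214297, 2989791995, 917758716, 2687635454, 110144, 239716, 281469, 135203, 101892],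
    [27, 27, 254248, 422937, 175941, 168714, 33939785428, 244324, 390525, 43555, 332804],
    [31, 27, 238888, 21264, 177989, 171018, 428313, 247140, 395389, 44067, 331780],
    [4, 27, 367626, 380707, 286980],
    [20, 27, 19556, 11020485631, 179758, 338698, 494115, 272153, 122944, 151933, 123486, 387844],
    [22, 26, 27152, 2024640980, 31076, 48427, 56140, 56901, 300835, 5646747387],
    [41, 28, 323934, 32663048444, 492900, 374538, 355197, 3393380862, 360483, 285956],
    [47, 27, 150824, 13328, 438297, 156004, 7775743462, 334717, 279109, 395555, 205060],
    [51, 26, 52008, 86544, 6135886292, 148068, 8154373887, 284697, 136517, 190755, 113924],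
    [10, 26, 43102, 22578, 11391486, 238656, 87396, 5258474491, 43389, 5701, 273699, 235524],
    [42, 27, 101220, 20786, 5475172860, 524213758, 50014, 82954, 63492, 54909, 58659, 490816],
    [67, 27, 423524, 334864, 388633, 2238669563, 81924, 103203, 84800],
    [44, 27, 2114569938, 451909, 270686, 288320],
    [16, 27, 143685, 338192, 334205, 28712, 141322, 432228, 3844, 31011, 28945035732],
    [18, 26, 29765, 32306, 942919420, 231549, 235524, 227934, 10852, 4326946299, 263715, 234560],
    [48, 27, 66859, 185360, 4869858303, 322636, 15880778708, 200773, 221796, 114301, 142873, 5892],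
    [82, 27, 85770, 21554, 319624700, 60451, 43584, 102725, 5877012222, 483453, 41054, 65540],
    [1, 27, 386073, 196654, 15978993151, 192291, 189760, 19300, 53061, 191357, 191838, 169476],
    [5, 28, 287040, 29284, 33132045823, 20771, 39293, 449605, 37401, 16388, 33728849147, 290142],
    [7, 27, 100160, 10340, 258892, 101757, 11589, 397578, 381721, 101214],
    [11, 26, 30358109652, 223844, 36643, 346237, 144709, 142090, 154384, 40232, 387353],
    [17, 27, 213824, 4402, 1568135420, 260131, 1797257470, 477977, 7214925307, 209924, 200798, 215165],
    [19, 25, 14104863188, 175888, 16931, 210532, 67141, 66058, 13572, 271897, 160893],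
    [2, 26, 56896, 60953, 2316890879, 62499, 5988, 35653, 19466, 285188, 57438, 40061],
    [21, 28, 173611, 106084, 63513, 14340, 194117, 375628, 88592, 29364131323, 7104508884],
    [23, 27, 233536, 236126, 7482599935, 82764, 449284, 23908, 366090, 120901, 321817, 180093],
    [4, 27, 381219, 270852, 357386],
    [20, 26, 102981, 373539, 6688506879, 232458, 265476, 16740, 115325, 176153, 165726, 163904],
    [22, 26, 40747, 311331, 20752, 8473, 24932, 1665024468, 45637, 6415369211, 76364],
    [41, 26, 301376, 448291, 464153, 340228, 268900, 473981, 53317, 472414, 124938],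
    [47, 26, 345725, 191779, 196196, 145668, 144453, 13135117524, 163856, 338457, 1034],
    [51, 26, 175229, 172067, 286052, 134660, 138053, 19155681748, 238864, 350489, 49707],
    [8, 26, 74877, 2339, 42596, 1796, 33605, 6985992916, 281360, 73241, 33546],
    [10, 26, 51837, 7029810683, 73828, 296227, 5957, 244544, 224772, 52574, 18764],
    [40, 27, 16626455252, 79941, 448537, 6575819259, 143108, 188707, 405068, 412432, 178045, 131392],
    [46, 26, 55306, 72473, 42084, 275294, 79364, 1397030612, 99363, 47915, 73853, 283200],
    [60, 25, 71434, 150085, 153444, 354142, 194052, 255779, 264985, 270461, 263744],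
    [81, 26, 391744, 222789, 105994, 375646, 288516, 380195, 393497, 236413, 9060],
    [83, 27, 399716, 34359738580, 3631807995, 111620, 147235, 261392, 323609, 122176],
    [16, 26, 349540, 8416265428, 218974, 345360, 355197, 151321],
    [18, 26, 247872, 3653, 7318398164, 163934, 224772, 296227, 40292, 7029810683, 277885]]
    (.leaf [27240326683604, 70025029, 237097536, 171478110, 170553092, 224719651, 249137168, 523854205, 357433700, 524288025])

def cert104 : Cert :=
  .node [[19, 26, 429593],
    [21, 0, 507]]
    (.leaf [196325116, 20861, 20288, 18201, 293975294, 868, 119042731, 17668, 25635, 17758])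

def cert105 : Cert :=
  .node [[5, 28, 34359738619, 34359738623, 6548144850, 311104, 238942, 462405],
    [7, 27, 321661, 259594, 4178315730, 411200, 354654, 369433, 76132],
    [11, 0, 468],
    [27, 27, 2851, 263805, 5447110143, 118282, 399710, 166696, 134725, 362777, 449796],
    [41, 28, 341027, 329597, 376074, 241758, 34359738620, 6645093586, 471652, 254980],
    [8, 26, 319760],
    [24, 27, 392995, 341312, 402216, 4080688062],
    [14, 27, 163172, 7965593852, 205603, 487488, 34359738580, 153604],
    [30, 27, 210738, 475939, 413504, 5076035323, 34359738580, 274276, 133722108],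
    [44, 27, 246366, 320832, 476741, 5691898066],
    [81, 28, 213598, 376074, 442437, 341027, 278080, 254980, 4933970386, 34359738622],
    [16, 27, 242270, 93962, 100933, 12323, 4308699860, 9220, 430864, 489572, 342141],
    [48, 27, 21296566783, 278080, 186212, 130173, 23171859412, 442437],
    [50, 27, 351582, 175626, 3039155410, 458048, 4787112958, 479357, 5089918460],
    [64, 27, 250974, 5585542866, 489572, 342141],
    [82, 26, 8739, 71237, 4059675390, 6404, 265597, 66314],
    [1, 29, 14070907562, 91625969151, 503086, 181317, 11409018322, 113984, 140840, 45812984830],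
    [7, 27, 314718, 474905, 70725, 56652, 351040, 332157, 94564, 338442],
    [9, 27, 192606, 7784293371, 7784293370, 3222566654, 7784293372, 227965, 403300],
    [2, 26, 9226, 2410050047, 35374, 12869, 221785258, 263428, 2410050042],
    [31, 26, 5525191423, 34595, 184645, 262425, 268548, 165501, 39367934, 168202],
    [42, 27, 27171, 505664, 19204, 8262673660, 146020, 131594],
    [67, 26, 131107, 262937, 155712, 93188, 81936, 185956],
    [12, 27, 218462, 367139, 367370, 4236795346, 259648, 261124, 452933],
    [28, 26, 1571, 248070399, 359470, 7690, 7549, 8517, 12057, 12292],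
    [34, 27, 294238, 343331, 305472, 314749, 58181, 580288466, 65636, 343346],
    [48, 27, 8182999230, 264268, 6202421204, 171333, 9790005222, 145764],
    [64, 27, 254302, 300669, 4253439186, 448100],
    [1, 28, 19225, 351790, 12157, 23008133631, 22612228090, 10756],
    [13, 27, 17121070079, 5583136763, 5583136765, 17945, 11389, 5583136764, 330283, 10244],
    [2, 27, 3097, 55854, 1917, 3656739839, 3593817850, 489988],
    [29, 26, 530886911, 16253, 25625, 471851, 14084],
    [41, 28, 228702, 367139, 367370, 34359738620, 270461, 3825452498, 428644, 251908],
    [10, 26, 266019, 211008, 96868, 33586, 4430604539, 240065020, 208644],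
    [67, 27, 242192, 4818612731, 470297, 242496, 305955, 388708, 209924],
    [14, 26, 44157, 40235, 5197098235, 206430, 270912, 336931, 4407818964, 64100, 232196],
    [30, 26, 17021, 4399514875, 279331, 26718, 221504, 16254567380, 98404, 56114],
    [44, 27, 3385063890, 224606, 267072, 465733],
    [16, 27, 290685, 365584, 135946, 37411, 7720, 23372061652, 145221, 423524, 20740]]
    (.split 0 0 4 (80000) cert103 cert104)

def cert106 : Cert :=
  .node [[42, 26, 7203, 276544, 5023144700, 83210, 105828, 5380],
    [67, 27, 400675, 387865, 431680, 326756, 299268],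
    [34, 0],
    [50, 26, 770294014, 5344805117, 222077, 212032, 120586, 305246, 757808380],
    [10, 27, 222243, 478784, 8610866684, 176484, 165892]]
    (.split 1 3 0 (35000) cert102 cert105)

def cert107 : Cert :=
  .node [[5, 28, 92748, 375065, 31967694526, 293470, 23238321915, 23238321919, 300132, 138309],
    [7, 26, 372490, 12236406462, 143641, 112478, 5762643967, 35660, 114788, 5762643963],
    [17, 26, 314393, 2121046745, 28510, 84348, 25128],
    [19, 27, 90137, 122718, 9152522713, 363388, 108328],
    [21, 27, 44364, 491545, 256350, 66117, 261988, 17049428991, 27912661950],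
    [25, 27, 315486, 491545, 322404, 14497263871, 97405],
    [27, 26, 383272, 268382, 304921, 133732, 13767079935, 96004],
    [4, 27, 445736, 345098, 57438, 339491, 354585, 387428, 2020357631, 53629],
    [20, 27, 413480, 314659, 53342, 1873276671, 359268, 337930, 328729, 49789],
    [47, 26, 13839231999, 389657, 33118, 221475, 223076, 47485, 256808, 218949],
    [10, 27, 288537, 357476, 339472],
    [24, 26, 266024, 33356, 40739, 85785, 473085374, 72548, 109328],
    [26, 27, 256025, 317284, 326160],
    [61, 26, 373288, 17179869439, 47888, 380441, 167012],
    [63, 26, 381765, 379658, 64552, 588, 22134712575, 146192, 491033, 215908],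
    [65, 26, 167012, 373288, 47888, 380441],
    [67, 25, 312676, 238632, 219161]]
    (.leaf [197189, 195422, 524313, 337508, 332, 196106, 392744, 20096843494])

def cert108 : Cert :=
  .node [[17, 26, 112764, 272, 3107, 3121, 320537, 1380, 33093, 1064, 31754],
    [19, 27, 485500, 1552, 12835, 5732, 13105, 113433, 142149, 4136, 136458],
    [25, 26, 59772, 295268, 20318, 261657, 16936],
    [27, 25, 66172, 327012, 1827, 289817, 19269, 386600, 18442]]
    (.leaf [30957637, 105754748, 524288100, 464756505, 302583592, 29740042, 2779939, 262155792])

def cert109 : Cert :=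
  .node [[10, 27, 4681804505, 405312, 367641, 379683, 309860, 283652],
    [24, 27, 264000, 513064, 844798142, 269091],
    [42, 27, 1802880509, 283658, 313625, 377956, 1802880510, 444736, 685082329],
    [14, 27, 376444, 90980, 431385, 323678, 301840],
    [28, 27, 2734723070, 272153, 483112, 348516, 219712, 246282, 239651, 355909, 344670, 197403130],
    [30, 27, 301840, 90980, 376444, 323678, 431385],
    [60, 27, 3599143166, 345625, 442468, 306186, 10048, 343109, 339038],
    [81, 28, 34920094974, 321290, 360261, 53785, 68964, 10560, 351326, 327952],
    [83, 26, 4558455550, 36106, 9316, 40773, 297340, 1344, 46430, 43536],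
    [50, 0],
    [64, 27, 427620, 7442097894, 312670, 225917],
    [1, 29, 328232, 205322, 227097, 307044, 6720, 91000679167, 230469, 19550, 49050112254, 497710],
    [19, 26, 67594, 82487998, 3846733310, 263804, 1600, 2654, 74565],
    [2, 27, 155688, 133145, 147812, 455428, 2911723263, 2686307070, 5214],
    [31, 27, 2309157630, 133672, 127076, 2502926079, 114457, 423172, 4446],
    [33, 28, 303395, 368906, 496921, 401457, 32782511611],
    [35, 27, 176168, 1088, 166500, 34826, 11056385278, 457084, 408580, 7262, 39237],
    [20, 27, 502824, 299811, 473625, 453732, 364554, 7172, 49969, 1964836348],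
    [41, 28, 24938192380, 391203, 522340, 473866, 16232151551, 265732, 361822, 470553],
    [43, 27, 154147, 19978, 7740284671, 7740284668, 104708, 172638, 515135],
    [8, 28, 461608, 230179, 278794, 25752657086, 335376],
    [10, 26, 3277529049, 257892, 339481, 217872],
    [44, 27, 11048219070, 356958, 198976, 366149],
    [60, 27, 6705, 300382, 412516, 11555, 3058647550, 380441, 322373, 4356, 304138, 14096],
    [62, 27, 1187696893, 522009, 244860, 472670, 14946013670, 14629587134, 387594, 248127],
    [81, 28, 7473, 13091, 61209, 296542, 358725, 34413370622, 57188, 4612, 338186, 283664],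
    [83, 27, 1329, 2339, 64325, 61790, 521596, 7117501694, 11876, 772, 60682, 59152],
    [48, 28, 35870072254, 280396, 30837942246, 266590, 322373, 433508],
    [50, 26, 216216571, 200780, 4446, 310809, 216216575, 146776510, 226058, 2880],
    [5, 28, 34359738619, 359237, 186432, 297054, 34359738623, 9841861822],
    [9, 26, 127838, 72316, 2517305855, 207716, 49963, 11569, 366105],
    [13, 27, 355115, 133500, 17903705855, 82481, 410905],
    [17, 26, 146556, 3843855614, 333081],
    [19, 26, 3121, 5155, 303228, 143941, 1796, 135690, 131097],
    [27, 27, 156712, 1143764989, 336478, 15279822847, 14136058107, 415236, 374538, 239679],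
    [33, 26, 2339, 2865, 133244, 63301, 59658, 345881],
    [35, 26, 80936, 5155, 4112, 293756, 139333, 86116, 203012, 131594, 206617],
    [20, 27, 412456, 306979, 390681, 439396, 32260, 371978, 20496],
    [10, 26, 243225, 273508, 234000],
    [24, 27, 260643, 177216, 8520284862, 403240],
    [26, 27, 433177, 487012, 432400],
    [61, 28, 379688, 34359738598, 34359738621, 207120],
    [44, 27, 191296, 304734, 368453, 9203665854],
    [60, 27, 346634, 379673, 283486, 32547, 360773, 426852, 21508, 19472],
    [62, 27, 21914563327, 444953, 517726, 92986365, 173692, 455720],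
    [81, 26, 327193, 299077, 48990, 26915, 287242, 115324, 6500, 8452, 17201, 47888],
    [83, 26, 82457, 74565, 8286, 6691, 278908, 1124, 4356, 71690, 7952],
    [64, 27, 8089566438, 229982, 427876, 214141]]
    (.split 1 3 1 (-15000) cert107 cert108)

def cert110 : Cert :=
  .node [[9, 28, 266109, 22906492412, 266078, 21414991058, 22906492411, 22906492415, 354660],
    [41, 28, 374653, 374622, 317987, 2100484351, 386826, 499300, 34359738620, 237572],
    [10, 26, 5767022588, 148771, 148836, 317504, 111108],
    [24, 26, 149283, 274472, 186432, 989513130],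
    [42, 26, 4446, 24469503, 147044, 323136, 4477, 103178, 5871129852],
    [14, 26, 343331, 1552057852, 2630053115, 10680989951, 336704, 6498879741, 429150, 256516],
    [83, 26, 25354, 2250962878, 8589934845, 92176, 429150, 17179869401, 8589934847, 39720, 20771],
    [64, 27, 2100484326, 374622, 374653, 499300],
    [82, 26, 47214014, 4190, 3392, 327549, 98826, 109381, 5637078782],
    [83, 26, 6253003481, 1638578110, 363388, 28968, 6253003518, 18442, 156254, 67088, 15139],
    [19, 26, 6252606974, 52369342, 363388, 121157, 109834, 4702, 3648],
    [35, 26, 7853742078, 128173819, 285820, 132648, 35909, 33802, 4702, 126308, 204548],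
    [83, 26, 5165090302, 24645, 300156, 832, 2988096985, 22026, 98398, 80400]]
    (.split 1 0 4 (0) cert106 cert109)

def cert111 : Cert :=
  .node [[21, 28, 345188, 34359738619, 4017744127, 374336, 386629, 492924, 42845],
    [22, 26, 5779722747, 343331, 675833343, 63040, 65093, 83068, 58212, 7261],
    [41, 27, 2696638674, 211722, 183133, 151843, 17179869436, 279164, 195428, 130052],
    [10, 26, 103705, 116061, 3432109308, 225315, 322880, 1707509202, 176764, 38756, 193028],
    [42, 26, 90378, 429120, 1148938962, 118908, 83300, 78173, 64803, 7319711740, 55556],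
    [61, 27, 379408, 155260, 9731500543, 108644, 19285962493],
    [62, 26, 6559797246, 128862, 32266, 381052, 13350865368, 34373, 122840254, 92944],
    [83, 26, 8441135102, 70494, 104202, 490364, 84544, 110917, 74531, 487370450, 64004],
    [18, 27, 352100, 21002, 2749438680, 399936, 341017, 369955, 316932],
    [34, 27, 315236, 316953, 18698, 2462229464, 358208, 331299],
    [64, 27, 464228, 25446098, 475260, 435037],
    [1, 27, 11604212990, 308270, 5244, 23616, 100238250, 21027, 22755525887, 5476, 15710],
    [7, 27, 296804, 279562, 474236, 455232, 8005, 9020549592, 15926890494],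
    [11, 26, 2353, 6023252478, 105738, 351868, 121413, 17179869400, 5124, 6179],
    [19, 26, 6023252478, 105738, 351868, 121413, 6179, 5124, 2353],
    [33, 25, 264661502, 1605, 9852, 325169, 7172, 1290],
    [35, 26, 2617650174, 165130, 351612, 6870201594, 189509, 9507, 264708],
    [4, 27, 411146, 342051, 293124],
    [22, 26, 299299, 4423263995, 74309, 59004, 60516, 56640, 463136998, 1230757117],
    [41, 28, 438372, 21315794, 364381, 398204, 425482, 28224, 342051, 291588, 33044747260, 56369],
    [8, 26, 321552, 34629, 27516, 29194, 50286078, 837128701, 1340073944],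
    [10, 27, 417059, 225561, 245853, 269180, 581, 91236, 502592, 355332, 962018300, 68657],
    [42, 26, 341568, 49955, 58236, 62218, 64100, 53341, 3112402, 42500, 4824854012, 8241],
    [61, 27, 11827163135, 87420, 89700, 285456, 19523324925],
    [63, 27, 460608, 234033, 450083, 183965692, 32325, 125796, 8577031167, 322564, 215645],
    [67, 26, 274240, 71946, 196899, 334716, 217157, 8168836860, 167684, 641770494, 32305],
    [44, 27, 503621, 1802, 27260, 310336, 467124734, 5392, 1325866712, 297566],
    [46, 27, 5932745688, 201994, 264286, 372604, 400704, 65124, 198169, 4295207678],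
    [81, 26, 232970, 167548, 40739, 6705, 178457, 7817418494, 34820, 262981],
    [83, 26, 123973, 19235, 109834, 430716, 84249, 3121, 3687218174, 16388],
    [16, 27, 245264, 113162, 335740, 323875, 495460, 307008, 296452, 146757],
    [18, 27, 453145, 516240358, 292196, 11333, 179235, 181056, 5244, 144656, 164100],
    [64, 27, 504932, 15882, 24133, 352892, 576, 13337, 463064572, 321373],
    [80, 25, 171364, 309017, 5701, 354684, 89123, 89920, 114960, 81412],
    [5, 26, 57188, 490265, 238661, 500092, 117824, 1034, 4934982616],
    [7, 25, 83556, 497177, 273162, 214597, 449660, 43840, 56080],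
    [11, 25, 126730, 140357, 294012, 51491, 8497, 214041, 8589934808, 44036],
    [17, 24, 6705, 287769, 98058, 108613, 227452, 39971, 34052]]
    (.leaf [7666532, 14980377, 6508298, 7507269, 15728764, 7520803, 4920640, 4757264, 6883844])

def cert112 : Cert :=
  .node [[7, 26, 139018, 840980990, 286302, 3540007933, 254588, 3540007932, 286272],
    [11, 26, 120074, 3334604734, 279134, 4599993341, 248188, 96831, 1969595390],
    [21, 28, 34359738619, 352350, 313468, 375627, 3322568191, 352320],
    [31, 26, 6616031742, 188718, 365180, 659398399, 245508],
    [22, 26, 5850617595, 343331, 59998, 64075, 53372, 565751807, 59968],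
    [41, 28, 405002, 357155, 515422, 371811, 458108, 34359738620, 4858758911, 303108],
    [47, 26, 1841052923, 223523, 282236, 115525, 3937718526, 189700],
    [8, 26, 8202, 58147, 314896, 72256, 49412],
    [10, 26, 109948, 1165373695, 6182424060, 123742, 89187, 302115, 2058759931, 429120, 256516],
    [42, 26, 78179, 75043, 96380, 85002, 429120, 108126, 1019810534, 7211803900, 63748],
    [61, 27, 17923688957, 16786383846, 33148, 37214, 306448],
    [67, 27, 338467, 416576, 2322755785, 3023794171, 230499, 5489077244, 287236],
    [28, 27, 229667, 252224, 46888, 294238, 649101994, 467246],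
    [44, 26, 177733, 216128, 2471193022, 279646],
    [62, 26, 14460, 7261927654, 7753935101, 445278, 132624],
    [81, 28, 391946, 343843, 441920, 34359738622, 378437, 460382, 20240, 291844],
    [34, 26, 97540, 331840, 417315, 381564, 832146429, 130570, 344158, 10213315067, 109044734],
    [48, 27, 366716, 318528, 284098790, 6928, 411086077, 330846, 438859],
    [64, 26, 332156, 224867, 299614, 629406182],
    [82, 26, 374140, 53283, 69696, 8241, 67338, 65349, 72542, 3088, 5358453758, 50180],
    [1, 28, 22834426874, 75555, 80704, 83806, 202355453, 23036782079, 298542, 2570, 1796],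
    [7, 27, 398972, 467520, 4621385468, 202506, 484958, 5793958141, 681023230],
    [2, 27, 3706889466, 3739739391, 13120, 32850173, 48430, 13662, 513284, 522, 12323],
    [21, 28, 108668, 1073645311, 127552, 319495421, 395595, 132190, 34199991035],
    [31, 26, 499580, 1670637562, 253760, 250403, 636143613, 263006, 430340, 6220403710, 17674],
    [33, 26, 958379771, 958379773, 958379772, 176132, 958379774, 316721],
    [35, 27, 21795, 38958, 22080, 3464584447, 55457277, 23134, 471812, 1546, 3409127674],
    [4, 27, 423434, 361988, 464931],
    [20, 27, 9659471359, 9504853754, 108590, 154617597, 483619, 64094, 332804, 409098, 61760],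
    [22, 26, 269347, 755809019, 120651, 131377, 34820],
    [41, 27, 212771, 231178, 220259, 226940, 2906626303, 89649, 14296614396, 230404, 275806]]
    (.leaf [12173859, 67941732347, 165385180157, 12939132, 492950783, 1996849, 15728734, 11703300, 20752657660, 15168832])

def cert113 : Cert :=
  .node [[43, 27, 441919, 215140, 215075, 8339245308, 160772],
    [67, 26, 1977508603, 159587, 215843, 4408284412, 269632, 161284],
    [18, 26, 3147405563, 7016232188, 262244, 343331, 4062192344, 429120, 256516],
    [18, 26, 2629494012, 233251, 233316, 291648, 162073, 174340]]
    (.split 1 4 0 (5000) cert111 cert112)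

def cert114 : Cert :=
  .node [[27, 26, 5972764925, 298334, 103690, 46632, 86847, 1327560382, 5972764927, 247556],
    [4, 27, 434186, 388387, 290308],
    [8, 27, 34359738558, 337699, 396810, 252164],
    [12, 27, 337699, 374336, 396810, 386629, 374366, 252164],
    [81, 28, 396810, 337699, 374336, 386629, 374366, 34359738622, 252164],
    [16, 27, 396810, 337699, 374336, 374366, 386629, 34359738598, 252164],
    [11, 27, 433674, 13048356351, 397150, 2850582269, 10197774587, 345663],
    [4, 27, 396810, 337699, 252164]]
    (.split 1 3 1 (10000) cert110 cert113)

def cert115 : Cert :=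
  .node [[4, 27, 292130, 518922],
    [41, 27, 375306, 266048, 11852184786, 22507554047, 22507554044, 266078],
    [42, 25, 78346, 4703190268, 270144, 55646, 4703190271, 2476638674],
    [61, 27, 22507554022, 375306, 22507554045, 209216, 266078, 15227447742],
    [63, 24, 455946, 392542, 392512, 13668929787, 13668929791]]
    (.leaf [524298, 451422, 313664, 15721562363, 15721562367, 4802456254])

def cert116 : Cert :=
  .node [[1, 28, 286046, 22906492410, 22906492330, 286021, 22906492415, 286016],
    [5, 28, 429150, 429125, 34359738619, 34359738623, 429120],
    [2, 26, 3308875178, 41310, 3308875258, 41285, 3308875263, 41280, 331012],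
    [23, 26, 429150, 5726623229, 11453246438, 5726623228, 11453246378, 429120, 273924],
    [31, 27, 8000, 104994, 95557, 1039630034, 24872, 4865971450, 4865971455, 486660],
    [43, 26, 286046, 5726623229, 5726623206, 143167, 143139, 91396],
    [63, 26, 5726623229, 5726623206, 143139, 286045, 143168, 91396],
    [28, 25, 48478, 309550, 48419, 48448],
    [44, 27, 429150, 429125, 429120],
    [48, 27, 374366, 34359738598, 386629, 374336],
    [7, 26, 274270, 3658629885, 7317259238, 3658629884, 185378, 274240],
    [2, 26, 2737879295, 70446, 6976, 6947, 2737879290, 7006, 273924],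
    [23, 26, 6373037030, 6373037051, 159296, 322594, 159326, 95236],
    [35, 27, 12608, 130094, 12579, 5066865402, 5066865407, 12638, 513028],
    [4, 25, 299274, 49443, 29444],
    [22, 0]]
    (.split 1 0 1 (-5000) cert114 cert115)

def cert117 : Cert :=
  .node [[27, 26, 6328964010, 6328964095, 6328964093, 6328964030, 316254, 331012],
    [30, 26, 214569, 8589934847, 8589934845, 429150]]
    (.split 1 2 0 (0) cert97 cert116)

def cert118 : Cert :=
  .node [[2, 26, 5726623226, 5726623146, 5726623186, 5726623166, 5726623231, 429060],
    [2, 26, 4835785130, 4835785170, 4835785150, 9671570431, 4835785214, 367620]]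
    (.split 1 3 0 (0) cert68 cert117)

theorem check_eq_true : cert118.check nearCenters initialTable = true := by decide +kernel

/-! ### Normalization of a configuration -/

theorem initialTable_holds {x y : ℕ → ℝ} (hx : ∀ i j, i ≤ j → j < 6 → x i ≤ x j)
    (hx₅ : x 5 ≤ x 0 + 100000) (hy₀ : y 0 = 0) (hy₁ : 0 ≤ y 1 ∧ y 1 ≤ 50000)
    (hy : ∀ j, j < 6 → -40000 ≤ y j ∧ y j ≤ 60000) : initialTable.Holds x y := by
  have hX : ∀ i d, i + d + 1 < 6 →
      0 ≤ x (i + d + 1) - x i ∧ x (i + d + 1) - x i ≤ 100000 := by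
    intro i d h
    have h₁ := hx 0 i (by omega) (by omega)
    have h₂ := hx i (i + d + 1) (by omega) h
    have h₃ := hx (i + d + 1) 5 (by omega) (by omega)
    constructor <;> linarith
  have hY : ∀ i d, i + d + 1 < 6 →
      -100000 ≤ y (i + d + 1) - y i ∧ y (i + d + 1) - y i ≤ 100000 := by
    intro i d h
    obtain ⟨h₁, h₂⟩ := hy i (by omega)
    obtain ⟨h₃, h₄⟩ := hy (i + d + 1) h
    constructor <;> linarith
  have key : ∀ i d, i + d + 1 < 6 → i + d + 1 < 6 ∧
      Box.Holds ⟨0, 100000, -100000, 100000⟩ (x (i + d + 1) - x i) (y (i + d + 1) - y i) := by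
    intro i d h
    refine ⟨h, ?_⟩
    simp only [Box.Holds]
    push_cast
    exact ⟨(hX i d h).1, (hX i d h).2, (hY i d h).1, (hY i d h).2⟩
  have key₀ : ∀ d, d < 5 → 0 + d + 1 < 6 ∧
      Box.Holds ⟨0, 100000, -40000, 60000⟩ (x (0 + d + 1) - x 0) (y (0 + d + 1) - y 0) := by
    intro d h
    refine ⟨by omega, ?_⟩
    simp only [Box.Holds, hy₀, sub_zero]
    push_cast
    exact ⟨(hX 0 d (by omega)).1, (hX 0 d (by omega)).2, hy _ (by omega)⟩
  have key₁ : 0 + 0 + 1 < 6 ∧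
      Box.Holds ⟨0, 100000, 0, 50000⟩ (x (0 + 0 + 1) - x 0) (y (0 + 0 + 1) - y 0) := by
    refine ⟨by omega, ?_⟩
    simp only [Box.Holds, hy₀, sub_zero]
    push_cast
    exact ⟨(hX 0 0 (by omega)).1, (hX 0 0 (by omega)).2, hy₁⟩
  intro i row hrow d B hB
  rcases i with _ | _ | _ | _ | _ | i <;> cases hrow <;>
    rcases d with _ | _ | _ | _ | _ | d <;> cases hB <;>
    first
      | exact key₁
      | exact key₀ 1 (by decide)
      | exact key₀ 2 (by decide)
      | exact key₀ 3 (by decide)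
      | exact key₀ 4 (by decide)
      | exact key 1 0 (by decide)
      | exact key 1 1 (by decide)
      | exact key 1 2 (by decide)
      | exact key 1 3 (by decide)
      | exact key 2 0 (by decide)
      | exact key 2 1 (by decide)
      | exact key 2 2 (by decide)
      | exact key 3 0 (by decide)
      | exact key 3 1 (by decide)
      | exact key 4 0 (by decide)

theorem not_separated_of_mem_nearCenters {x y : Fin 6 → ℝ} (h : Separated x y) (hx : x 0 = 0)
    (hy : y 0 = 0) {q : List (ℤ × ℤ)} (hq : q ∈ nearCenters)
    (hn : Near q (fun i => 100000 * x (Fin.ofNat 6 i)) fun i => 100000 * y (Fin.ofNat 6 i)) : False := by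
  simp only [nearCenters, List.mem_cons, List.not_mem_nil, or_false] at hq
  have bounds : ∀ {a b : ℝ}, |100000 * a - b| ≤ 500 →
      b / 100000 - 0.005 ≤ a ∧ a ≤ b / 100000 + 0.005 := by
    intro a b hab
    rw [abs_le] at hab
    constructor <;> linarith
  have unbounds : ∀ {a b : ℝ}, b - 0.005 ≤ a → a ≤ b + 0.005 → |a - b| ≤ 0.005 := by
    intro a b h₁ h₂
    rw [abs_le]
    constructor <;> linarith
  rcases hq with rfl | rfl | rfl
  all_goals
    have a₁ := bounds (a := x 1) (hn 0 _ rfl).1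
    have b₁ := bounds (a := y 1) (hn 0 _ rfl).2
    have a₂ := bounds (a := x 2) (hn 1 _ rfl).1
    have b₂ := bounds (a := y 2) (hn 1 _ rfl).2
    have a₃ := bounds (a := x 3) (hn 2 _ rfl).1
    have b₃ := bounds (a := y 3) (hn 2 _ rfl).2
    have a₄ := bounds (a := x 4) (hn 3 _ rfl).1
    have b₄ := bounds (a := y 4) (hn 3 _ rfl).2
    have a₅ := bounds (a := x 5) (hn 4 _ rfl).1
    have b₅ := bounds (a := y 5) (hn 4 _ rfl).2
    norm_num only at a₁ b₁ a₂ b₂ a₃ b₃ a₄ b₄ a₅ b₅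
  · refine not_separated_of_near (h.relabel (σ := id) Function.injective_id (s := 0)
      (t := ![0, 0, 1, 0, 0, 1])) ?_ ?_ ?_ ?_
    · simp [hx]
    · simp [hy]
    all_goals
      intro k
      apply unbounds
      all_goals fin_cases k <;> simp [hx, hy] <;> linarith
  · refine not_separated_of_near (h.relabel (σ := ![0, 1, 2, 3, 5, 4]) (by decide) (s := 0)
      (t := ![0, 0, 1, 0, 0, 1])) ?_ ?_ ?_ ?_
    · simp [hx]
    · simp [hy]
    all_goals
      intro k
      apply unbounds
      all_goals fin_cases k <;> simp [hx, hy] <;> linarith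
  · refine not_separated_of_near (h.neg_left.swap.neg_left.relabel (σ := ![0, 4, 2, 5, 3, 1])
      (by decide) (s := ![0, 0, 0, 0, 1, 1]) (t := ![0, 1, 1, 1, 1, 1])) ?_ ?_ ?_ ?_
    · simp [hy]
    · simp [hx]
    all_goals
      intro k
      apply unbounds
      all_goals fin_cases k <;> simp [hx, hy] <;> linarith

/-- The points are sorted, and the first coordinate has its largest cyclic gap at the end. -/
structure CyclicSorted (x : Fin 6 → ℝ) : Prop where
  le : ∀ i : Fin 5, x i.castSucc ≤ x i.succ
  gap : ∀ i : Fin 5, x i.succ - x i.castSucc ≤ x 0 + 1 - x 5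

theorem CyclicSorted.rev {x : Fin 6 → ℝ} (h : CyclicSorted x) :
    CyclicSorted fun i => -x i.rev where
  le i := by
    rw [Fin.rev_succ, Fin.rev_castSucc]
    exact neg_le_neg (h.le i.rev)
  gap i := by
    have := h.gap i.rev
    rw [Fin.rev_succ, Fin.rev_castSucc]
    have h₀ : (0 : Fin 6).rev = 5 := rfl
    have h₅ : (5 : Fin 6).rev = 0 := rfl
    rw [h₀, h₅]
    linarith

theorem Separated.exists_cyclicSorted_of_monotone {u y : Fin 6 → ℝ} (h : Separated u y)
    (hu : Monotone u) (h₁ : u 5 ≤ u 0 + 1) :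
    ∃ x' y', Separated x' y' ∧ CyclicSorted x' := by
  obtain ⟨k, hk⟩ := Finite.exists_max
    ![u 1 - u 0, u 2 - u 1, u 3 - u 2, u 4 - u 3, u 5 - u 4, u 0 + 1 - u 5]
  have g₀ := hk 0
  have g₁ := hk 1
  have g₂ := hk 2
  have g₃ := hk 3
  have g₄ := hk 4
  have g₅ := hk 5
  have m₀ : u 0 ≤ u 1 := hu (by decide)
  have m₁ : u 1 ≤ u 2 := hu (by decide)
  have m₂ : u 2 ≤ u 3 := hu (by decide)
  have m₃ : u 3 ≤ u 4 := hu (by decide)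
  have m₄ : u 4 ≤ u 5 := hu (by decide)
  clear hk
  have main : ∀ s : Fin 6 → ℤ,
      CyclicSorted (fun i => u (i + (k + 1)) + s i) → ∃ x' y', Separated x' y' ∧ CyclicSorted x' :=
    fun s hs => ⟨_, _, h.relabel (σ := fun i => i + (k + 1)) (add_left_injective _) (s := s) (t := 0), hs⟩
  fin_cases k
  · refine main ![0, 0, 0, 0, 0, 1] ⟨?_, ?_⟩ <;> intro i <;> fin_cases i <;>
      simp at * <;> linarith
  · refine main ![0, 0, 0, 0, 1, 1] ⟨?_, ?_⟩ <;> intro i <;> fin_cases i <;>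
      simp at * <;> linarith
  · refine main ![0, 0, 0, 1, 1, 1] ⟨?_, ?_⟩ <;> intro i <;> fin_cases i <;>
      simp at * <;> linarith
  · refine main ![0, 0, 1, 1, 1, 1] ⟨?_, ?_⟩ <;> intro i <;> fin_cases i <;>
      simp at * <;> linarith
  · refine main ![0, 1, 1, 1, 1, 1] ⟨?_, ?_⟩ <;> intro i <;> fin_cases i <;>
      simp at * <;> linarith
  · refine main ![0, 0, 0, 0, 0, 0] ⟨?_, ?_⟩ <;> intro i <;> fin_cases i <;>
      simp at * <;> linarith

theorem Separated.exists_cyclicSorted {x y : Fin 6 → ℝ} (h : Separated x y) :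
    ∃ x' y', Separated x' y' ∧ CyclicSorted x' := by
  let σ := Tuple.sort fun i => Int.fract (x i)
  have hmono : Monotone fun i => Int.fract (x (σ i)) :=
    Tuple.monotone_sort fun i => Int.fract (x i)
  replace h := h.relabel σ.injective (s := fun i => -⌊x (σ i)⌋) (t := 0)
  have hfract : (fun i => x (σ i) + ((-⌊x (σ i)⌋ : ℤ) : ℝ)) = fun i => Int.fract (x (σ i)) := by
    ext i
    rw [Int.fract]
    push_cast
    ring
  rw [hfract] at h
  refine h.exists_cyclicSorted_of_monotone hmono ?_
  have := Int.fract_lt_one (x (σ 5))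
  have := Int.fract_nonneg (x (σ 0))
  linarith

theorem d6_sq_lower_bound : 0.1603246 ≤ d6 ^ 2 := by
  obtain ⟨h₁, h₂⟩ := d6_bounds
  have h₃ : Real.sqrt 3 ≤ 1.732050808 := Real.sqrt_le_iff.mpr (by norm_num)
  have h₄ : 0.400405547 ≤ d6 := by
    by_contra! h
    nlinarith [d6_quadratic]
  nlinarith

theorem not_separated_of_cyclicSorted {x y : Fin 6 → ℝ} (h : Separated x y)
    (hx : CyclicSorted x) (hx₁ : x 1 - x 0 ≤ x 5 - x 4)
    (hy : Int.fract (y 1 - y 0) ≤ 1 / 2) : False := by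
  replace h := (h.add_const (-x 0) (-y 0)).relabel (σ := id) Function.injective_id (s := 0)
    (t := fun i => -⌊y i - y 0 + 2 / 5⌋)
  obtain ⟨X, hX⟩ : ∃ X : Fin 6 → ℝ, ∀ i, X i = x i - x 0 := ⟨_, fun _ => rfl⟩
  obtain ⟨Y, hY⟩ : ∃ Y : Fin 6 → ℝ, ∀ i, Y i = y i - y 0 - ⌊y i - y 0 + 2 / 5⌋ :=
    ⟨_, fun _ => rfl⟩
  replace h : Separated X Y := by
    convert h using 1
    · ext i
      simp [hX, sub_eq_add_neg]
    · ext i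
      simp [hY, sub_eq_add_neg]
  have hX₀ : X 0 = 0 := by rw [hX, sub_self]
  have hY₀ : Y 0 = 0 := by
    rw [hY, sub_self, zero_add, zero_sub, neg_eq_zero, Int.cast_eq_zero, Int.floor_eq_zero_iff]
    constructor <;> norm_num
  have hYb : ∀ i, -(2 / 5) ≤ Y i ∧ Y i ≤ 3 / 5 := by
    intro i
    have h₁ := Int.floor_le (y i - y 0 + 2 / 5)
    have h₂ := Int.lt_floor_add_one (y i - y 0 + 2 / 5)
    rw [hY]
    constructor <;> linarith
  have hY₁ : 0 ≤ Y 1 ∧ Y 1 ≤ 1 / 2 := by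
    have hfloor : ⌊y 1 - y 0 + 2 / 5⌋ = ⌊y 1 - y 0⌋ := by
      have h₁ := Int.fract_nonneg (y 1 - y 0)
      rw [Int.fract] at h₁ hy
      rw [Int.floor_eq_iff]
      constructor <;> linarith
    rw [hY, hfloor]
    exact ⟨Int.fract_nonneg _, hy⟩
  have hXle : ∀ i : Fin 5, X i.castSucc ≤ X i.succ := by
    intro i
    simpa [hX] using hx.le i
  have hXgap : ∀ i : Fin 5, X i.succ - X i.castSucc + X 5 ≤ 1 := by
    intro i
    have := hx.gap i
    rw [hX, hX, hX]
    linarith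
  have hXlast : X 1 ≤ X 5 - X 4 := by
    rw [hX, hX, hX]
    linarith
  clear hx hx₁ hy hX hY
  have hmono : Monotone X := Fin.monotone_iff_le_succ.mpr hXle
  have hnorm : Normalized (fun i => 100000 * X (Fin.ofNat 6 i))
      fun i => 100000 * Y (Fin.ofNat 6 i) := by
    refine ⟨?_, ?_, ?_, ?_, ?_⟩
    · show 100000 * X 0 = 0
      rw [hX₀, mul_zero]
    · show 100000 * Y 0 = 0
      rw [hY₀, mul_zero]
    · intro i j hij hj m n
      have hne : Fin.ofNat 6 i ≠ Fin.ofNat 6 j := by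
        intro he
        rw [Fin.ext_iff] at he
        simp only [Fin.ofNat] at he
        omega
      have h₁ := h _ _ hne m n
      have h₂ := d6_sq_lower_bound
      linarith
    · intro i hi
      have := hXgap ⟨i, hi⟩
      interval_cases i <;> simp [Fin.ofNat] at this ⊢ <;> linarith
    · show 100000 * X 1 ≤ 100000 * X 5 - 100000 * X 4
      linarith
  have hX₅ : X 5 ≤ 1 := by
    have h₁ := hXle 0
    have h₂ := hXgap 0
    linarith
  have htable : initialTable.Holds (fun i => 100000 * X (Fin.ofNat 6 i))
      fun i => 100000 * Y (Fin.ofNat 6 i) := by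
    refine initialTable_holds ?_ ?_ ?_ ?_ ?_
    · intro i j hij hj
      have : Fin.ofNat 6 i ≤ Fin.ofNat 6 j := by
        rw [Fin.le_def]
        simp only [Fin.ofNat]
        omega
      have := hmono this
      linarith
    · show 100000 * X 5 ≤ 100000 * X 0 + 100000
      linarith
    · exact hnorm.y_zero
    · show 0 ≤ 100000 * Y 1 ∧ 100000 * Y 1 ≤ 50000
      constructor <;> linarith
    · intro j _
      obtain ⟨h₁, h₂⟩ := hYb (Fin.ofNat 6 j)
      constructor <;> linarith
  obtain ⟨q, hq, hn⟩ := Cert.exists_near_of_check hnorm htable check_eq_true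
  exact not_separated_of_mem_nearCenters h hX₀ hY₀ hq hn

theorem not_separated (x y : Fin 6 → ℝ) : ¬ Separated x y := by
  intro h
  obtain ⟨x, y, h, hx⟩ := h.exists_cyclicSorted
  obtain ⟨x, y, h, hx, hx₁⟩ :
      ∃ x y, Separated x y ∧ CyclicSorted x ∧ x 1 - x 0 ≤ x 5 - x 4 := by
    rcases le_total (x 1 - x 0) (x 5 - x 4) with hx₁ | hx₁
    · exact ⟨x, y, h, hx, hx₁⟩
    · have h' := h.neg_left.relabel Fin.rev_injective (s := 0) (t := 0)
      simp only [Pi.zero_apply, Int.cast_zero, add_zero] at h'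
      refine ⟨_, _, h', hx.rev, ?_⟩
      show -x 4 - -x 5 ≤ -x 0 - -x 1
      linarith
  rcases le_total (Int.fract (y 1 - y 0)) (1 / 2) with hy | hy
  · exact not_separated_of_cyclicSorted h hx hx₁ hy
  · refine not_separated_of_cyclicSorted h.swap.neg_left.swap hx hx₁ ?_
    rw [show -y 1 - -y 0 = -(y 1 - y 0) by ring, Int.fract_neg (by linarith)]
    linarith

end

/-- For every configuration of 6 points on the square flat torus, the minimal
toroidal distance is at most `d6`. -/
theorem six_points_min_dist_le (p : Fin 6 → ℝ × ℝ) :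
    ∃ i j : Fin 6, i ≠ j ∧ ∃ m n : ℤ,
      e2norm (p i - p j + ((m : ℝ), (n : ℝ))) ≤ d6 := by
  by_contra! h
  refine not_separated (fun i => (p i).1) (fun i => (p i).2) fun i j hij m n => ?_
  have h₁ := h j i hij.symm m n
  have h₂ := d6_bounds.1
  rw [e2norm, Real.lt_sqrt (by linarith)] at h₁
  exact h₁
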